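/- Write μ(x) = |Disc(x)|/q⁸ for x ∈ V̂_ℤ. For every δ ∈ (0,1) and ε > 0 there is a constant C(δ,ε) such that for all squarefree q ≥ 1 and every finite set S of pairwise SL₂(ℤ)-inequivalent x ∈ V̂_ℤ with Disc(x) ≠ 0: (i) if 0 < z ≤ q⁻³ and every x ∈ S has μ(x) < z, then Σ_{x∈S} (|Φ̂'_q(x)|/#Stab(x))·μ(x)^{−δ} ≤ C(δ,ε)·q^{2+ε}·z^{1−δ}; (ii) if every x ∈ S has q⁻³ < μ(x) < q⁻², then the same sum is ≤ C(δ,ε)·q^{3δ−1+ε}; (iii) if z > q⁻² and every x ∈ S has q⁻² < μ(x) < z, then the same sum is ≤ C(δ,ε)·q^{1+ε}·z^{1−δ}. Moreover, for every δ > 1 and ε > 0 there is C(δ,ε) such that if z > q⁻² and every x ∈ S has μ(x) > z, then Σ_{x∈S} (|Φ̂'_q(x)|/#Stab(x))·μ(x)^{−δ} ≤ C(δ,ε)·q^{1+ε}·z^{1−δ}. -/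

import Mathlib

open scoped Classical

noncomputable section

/-- An integral binary cubic form `a u³ + b u²v + c uv² + d v³`, recorded by its
coefficient quadruple `(a, b, c, d)`. -/
abbrev BCF := ℤ × ℤ × ℤ × ℤ

namespace BCF

/-- The discriminant of a binary cubic form. -/
def disc (f : BCF) : ℤ :=
  f.2.1 ^ 2 * f.2.2.1 ^ 2 - 4 * f.1 * f.2.2.1 ^ 3 - 4 * f.2.1 ^ 3 * f.2.2.2
    - 27 * f.1 ^ 2 * f.2.2.2 ^ 2 + 18 * f.1 * f.2.1 * f.2.2.1 * f.2.2.2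

/-- The (twisted) action of a matrix `γ` with `det γ = ±1` on binary cubic forms:
`(γ·f)(u,v) = (det γ)⁻¹ · f((u,v)·γ)`, written out on coefficients (for `det γ = ±1`,
dividing by the determinant is the same as multiplying by it). -/
def act (γ : Matrix (Fin 2) (Fin 2) ℤ) (f : BCF) : BCF :=
  let a := f.1; let b := f.2.1; let c := f.2.2.1; let d := f.2.2.2
  let α := γ 0 0; let β := γ 1 0; let g := γ 0 1; let δ := γ 1 1
  (γ.det * (a * α ^ 3 + b * α ^ 2 * g + c * α * g ^ 2 + d * g ^ 3),
   γ.det * (3 * a * α ^ 2 * β + b * (α ^ 2 * δ + 2 * α * β * g)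
      + c * (2 * α * g * δ + β * g ^ 2) + 3 * d * g ^ 2 * δ),
   γ.det * (3 * a * α * β ^ 2 + b * (2 * α * β * δ + β ^ 2 * g)
      + c * (α * δ ^ 2 + 2 * β * g * δ) + 3 * d * g * δ ^ 2),
   γ.det * (a * β ^ 3 + b * β ^ 2 * δ + c * β * δ ^ 2 + d * δ ^ 3))

/-- `SL₂(ℤ)`-equivalence of binary cubic forms. -/
def SLeq (f g : BCF) : Prop := ∃ γ : Matrix (Fin 2) (Fin 2) ℤ, γ.det = 1 ∧ act γ f = g

/-- `GL₂(ℤ)`-equivalence of binary cubic forms. -/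
def GLeq (f g : BCF) : Prop :=
  ∃ γ : Matrix (Fin 2) (Fin 2) ℤ, (γ.det = 1 ∨ γ.det = -1) ∧ act γ f = g

/-- The Davenport–Heilbronn set `U_p`: `f` is not a multiple of `p`, and no
`GL₂(ℤ)`-transform of `f` has leading coefficient divisible by `p²` and second
coefficient divisible by `p`. -/
def inUp (p : ℕ) (f : BCF) : Prop :=
  (¬ ((p:ℤ) ∣ f.1 ∧ (p:ℤ) ∣ f.2.1 ∧ (p:ℤ) ∣ f.2.2.1 ∧ (p:ℤ) ∣ f.2.2.2)) ∧
  ∀ γ : Matrix (Fin 2) (Fin 2) ℤ, (γ.det = 1 ∨ γ.det = -1) →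
    ¬ ((p:ℤ) ^ 2 ∣ (act γ f).1 ∧ (p:ℤ) ∣ (act γ f).2.1)

/-- Membership in the dual lattice `V̂_ℤ`: the middle coefficients are divisible by 3. -/
def inDual (x : BCF) : Prop := (3:ℤ) ∣ x.2.1 ∧ (3:ℤ) ∣ x.2.2.1

/-- The pairing `[x, y] = x₄y₁ − x₃y₂/3 + x₂y₃/3 − x₁y₄` (an integer for `x ∈ V̂_ℤ`). -/
def pairQ (x y : BCF) : ℚ :=
  (x.2.2.2 * y.1 : ℤ) - ((x.2.2.1 * y.2.1 : ℤ) : ℚ) / 3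
    + ((x.2.1 * y.2.2.1 : ℤ) : ℚ) / 3 - (x.1 * y.2.2.2 : ℤ)

/-- `Φ_q`, the characteristic function of forms nonmaximal at every prime `p | q`. -/
def nonmaxAll (q : ℕ) (f : BCF) : Prop := ∀ p : ℕ, p.Prime → p ∣ q → ¬ inUp p f

/-- The cubic Gauss sum `Φ̂_q(x) = q⁻⁸ Σ_y Φ_q(y) exp(2πi [x,y]/q²)`, the sum running
over forms `y` with coefficients in `{0, …, q² − 1}`. -/
noncomputable def PhiHat (q : ℕ) (x : BCF) : ℂ :=
  ((q : ℂ) ^ 8)⁻¹ *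
    ∑ y1 ∈ Finset.range (q ^ 2), ∑ y2 ∈ Finset.range (q ^ 2),
    ∑ y3 ∈ Finset.range (q ^ 2), ∑ y4 ∈ Finset.range (q ^ 2),
      (if nonmaxAll q ((y1 : ℤ), (y2 : ℤ), (y3 : ℤ), (y4 : ℤ)) then 1 else 0) *
        Complex.exp (2 * Real.pi * Complex.I *
          ((pairQ x ((y1 : ℤ), (y2 : ℤ), (y3 : ℤ), (y4 : ℤ)) : ℚ) : ℂ) / (q : ℂ) ^ 2)

/-- The order of the stabilizer of `x` in `SL₂(ℤ)`. -/
noncomputable def stabCard (x : BCF) : ℕ :=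
  Nat.card {γ : Matrix (Fin 2) (Fin 2) ℤ // γ.det = 1 ∧ act γ x = x}

/-- The Davenport–Heilbronn set `V_p ⊆ U_p`: additionally, the reduction of `f` mod `p`
is not a scalar multiple of the cube of a linear form over `𝔽_p` (i.e. `p` is not
totally ramified in the associated maximal cubic ring). -/
def inVp (p : ℕ) (f : BCF) : Prop :=
  inUp p f ∧ ¬ ∃ s l₁ l₂ : ZMod p,
    (f.1 : ZMod p) = s * l₁ ^ 3 ∧ (f.2.1 : ZMod p) = 3 * s * l₁ ^ 2 * l₂ ∧
    (f.2.2.1 : ZMod p) = 3 * s * l₁ * l₂ ^ 2 ∧ (f.2.2.2 : ZMod p) = s * l₂ ^ 3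

/-- `Φ'_q`, the characteristic function of forms outside `V_p` for every prime `p | q`. -/
def outVpAll (q : ℕ) (f : BCF) : Prop := ∀ p : ℕ, p.Prime → p ∣ q → ¬ inVp p f

/-- The Gauss sum `Φ̂'_q(x) = q⁻⁸ Σ_y Φ'_q(y) exp(2πi [x,y]/q²)`. -/
noncomputable def PhiHat' (q : ℕ) (x : BCF) : ℂ :=
  ((q : ℂ) ^ 8)⁻¹ *
    ∑ y1 ∈ Finset.range (q ^ 2), ∑ y2 ∈ Finset.range (q ^ 2),
    ∑ y3 ∈ Finset.range (q ^ 2), ∑ y4 ∈ Finset.range (q ^ 2),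
      (if outVpAll q ((y1 : ℤ), (y2 : ℤ), (y3 : ℤ), (y4 : ℤ)) then 1 else 0) *
        Complex.exp (2 * Real.pi * Complex.I *
          ((pairQ x ((y1 : ℤ), (y2 : ℤ), (y3 : ℤ), (y4 : ℤ)) : ℚ) : ℂ) / (q : ℂ) ^ 2)

end BCF

namespace BCF

/-! ### Basic properties of the action -/

lemma act_one (f : BCF) : act 1 f = f := by
  obtain ⟨a, b, c, d⟩ := f
  simp [act]

lemma act_mul (σ γ : Matrix (Fin 2) (Fin 2) ℤ) (f : BCF) :
    act (σ * γ) f = act σ (act γ f) := by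
  obtain ⟨a, b, c, d⟩ := f
  simp only [act, Matrix.det_fin_two, Matrix.mul_apply, Fin.sum_univ_two, Prod.mk.injEq]
  refine ⟨?_, ?_, ?_, ?_⟩ <;> ring

lemma disc_act (γ : Matrix (Fin 2) (Fin 2) ℤ) (f : BCF) :
    disc (act γ f) = γ.det ^ 10 * disc f := by
  obtain ⟨a, b, c, d⟩ := f
  simp only [act, disc, Matrix.det_fin_two]
  ring

/-- First Hessian coefficient. -/
def hP (f : BCF) : ℤ := f.2.1 ^ 2 - 3 * f.1 * f.2.2.1
/-- Second Hessian coefficient. -/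
def hQ (f : BCF) : ℤ := f.2.1 * f.2.2.1 - 9 * f.1 * f.2.2.2
/-- Third Hessian coefficient. -/
def hR (f : BCF) : ℤ := f.2.2.1 ^ 2 - 3 * f.2.1 * f.2.2.2

lemma hess_disc (f : BCF) : 4 * hP f * hR f - hQ f ^ 2 = 3 * disc f := by
  simp only [hP, hQ, hR, disc]; ring

/-- The congruence conditions: `f` has a triple root modulo every prime dividing `k`, and
discriminant divisible by `l`. -/
def Cond (k l : ℕ) (f : BCF) : Prop :=
  (k : ℤ) ∣ hP f ∧ (k : ℤ) ∣ hQ f ∧ (k : ℤ) ∣ hR f ∧ (l : ℤ) ∣ disc f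

lemma Cond_act {k l : ℕ} {f : BCF} (γ : Matrix (Fin 2) (Fin 2) ℤ) (h : Cond k l f) :
    Cond k l (act γ f) := by
  obtain ⟨h1, h2, h3, h4⟩ := h
  have e1 : hP (act γ f) = γ.det ^ 4 * (γ 0 0 ^ 2 * hP f + γ 0 0 * γ 0 1 * hQ f
      + γ 0 1 ^ 2 * hR f) := by
    simp only [act, hP, hQ, hR, Matrix.det_fin_two]; ring
  have e2 : hQ (act γ f) = γ.det ^ 4 * (2 * γ 0 0 * γ 1 0 * hP f
      + (γ 0 0 * γ 1 1 + γ 0 1 * γ 1 0) * hQ f + 2 * γ 0 1 * γ 1 1 * hR f) := by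
    simp only [act, hP, hQ, hR, Matrix.det_fin_two]; ring
  have e3 : hR (act γ f) = γ.det ^ 4 * (γ 1 0 ^ 2 * hP f + γ 1 0 * γ 1 1 * hQ f
      + γ 1 1 ^ 2 * hR f) := by
    simp only [act, hP, hQ, hR, Matrix.det_fin_two]; ring
  refine ⟨?_, ?_, ?_, ?_⟩
  · rw [e1]
    exact Dvd.dvd.mul_left (dvd_add (dvd_add (h1.mul_left _) (h2.mul_left _)) (h3.mul_left _)) _
  · rw [e2]
    exact Dvd.dvd.mul_left (dvd_add (dvd_add (h1.mul_left _) (h2.mul_left _)) (h3.mul_left _)) _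
  · rw [e3]
    exact Dvd.dvd.mul_left (dvd_add (dvd_add (h1.mul_left _) (h2.mul_left _)) (h3.mul_left _)) _
  · rw [disc_act]; exact h4.mul_left _

lemma adj_mul {γ : Matrix (Fin 2) (Fin 2) ℤ} (h : γ.det = 1) : γ.adjugate * γ = 1 := by
  rw [Matrix.adjugate_mul, h, one_smul]

lemma mul_adj {γ : Matrix (Fin 2) (Fin 2) ℤ} (h : γ.det = 1) : γ * γ.adjugate = 1 := by
  rw [Matrix.mul_adjugate, h, one_smul]

lemma det_adj {γ : Matrix (Fin 2) (Fin 2) ℤ} (h : γ.det = 1) : γ.adjugate.det = 1 := by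
  rw [Matrix.det_adjugate, h]; simp

lemma act_adj {γ : Matrix (Fin 2) (Fin 2) ℤ} (h : γ.det = 1) (f : BCF) :
    act γ.adjugate (act γ f) = f := by
  rw [← act_mul, adj_mul h, act_one]

lemma SLeq_refl (f : BCF) : SLeq f f := ⟨1, by simp, act_one f⟩

lemma SLeq_symm {f g : BCF} (h : SLeq f g) : SLeq g f := by
  obtain ⟨γ, h1, rfl⟩ := h
  exact ⟨γ.adjugate, det_adj h1, act_adj h1 f⟩

lemma SLeq_trans {f g h : BCF} (h1 : SLeq f g) (h2 : SLeq g h) : SLeq f h := by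
  obtain ⟨γ, h1, rfl⟩ := h1
  obtain ⟨σ, h2, rfl⟩ := h2
  exact ⟨σ * γ, by rw [Matrix.det_mul, h1, h2]; norm_num, act_mul _ _ _⟩

/-- The setoid of `SL₂(ℤ)`-equivalence. -/
def slSetoid : Setoid BCF := ⟨SLeq, SLeq_refl, SLeq_symm, SLeq_trans⟩

/-- A fixed representative of each class. -/
def rep (f : BCF) : BCF := (Quotient.mk slSetoid f).out

lemma SLeq_rep (f : BCF) : SLeq (rep f) f := by
  have := @Quotient.mk_out _ slSetoid f
  exact this

lemma rep_eq {f g : BCF} (h : SLeq f g) : rep f = rep g := by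
  unfold rep
  have : Quotient.mk slSetoid f = Quotient.mk slSetoid g := Quotient.sound h
  rw [this]

/-- The lower unipotent matrix acting by `u ↦ u + n v`. -/
def uni (n : ℤ) : Matrix (Fin 2) (Fin 2) ℤ := !![1, 0; n, 1]

lemma uni_det (n : ℤ) : (uni n).det = 1 := by simp [uni, Matrix.det_fin_two]

lemma act_uni (n a b c d : ℤ) : act (uni n) (a, b, c, d) =
    (a, b + 3 * a * n, c + 2 * b * n + 3 * a * n ^ 2, d + c * n + b * n ^ 2 + a * n ^ 3) := by
  simp only [act, uni, Matrix.det_fin_two, Matrix.of_apply, Matrix.cons_val', Matrix.cons_val_zero,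
    Matrix.cons_val_one, Matrix.cons_val_fin_one, Prod.mk.injEq]
  refine ⟨?_, ?_, ?_, ?_⟩ <;> ring

end BCF

namespace BCF

/-! ### Reduction theory -/

/-- Evaluation of a form at a real point. -/
def fe (f : BCF) (u v : ℝ) : ℝ :=
  f.1 * u ^ 3 + f.2.1 * u ^ 2 * v + f.2.2.1 * u * v ^ 2 + f.2.2.2 * v ^ 3

lemma exists_real_root (a b c d : ℝ) (ha : 1 ≤ a) :
    ∃ θ : ℝ, a * θ ^ 3 + b * θ ^ 2 + c * θ + d = 0 := by
  set M : ℝ := 1 + |b| + |c| + |d| with hM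
  have hb := abs_nonneg b
  have hc := abs_nonneg c
  have hd := abs_nonneg d
  have hM1 : 1 ≤ M := by linarith
  have hb1 := neg_abs_le b
  have hb2 := le_abs_self b
  have hc1 := neg_abs_le c
  have hc2 := le_abs_self c
  have hd1 := neg_abs_le d
  have hd2 := le_abs_self d
  have hM2 : M ≤ M ^ 2 := by nlinarith
  have hM3 : M ^ 3 = M ^ 2 + (|b| + |c| + |d|) * M ^ 2 := by rw [hM]; ring
  have hM2' : 1 ≤ M ^ 2 := by linarith
  have p1 : |b| * M ^ 2 ≥ -b * M ^ 2 := by nlinarith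
  have p1' : |b| * M ^ 2 ≥ b * M ^ 2 := by nlinarith
  have p2 : |c| * M ^ 2 ≥ |c| * M := by nlinarith
  have p3 : |c| * M ≥ -c * M := by nlinarith
  have p3' : |c| * M ≥ c * M := by nlinarith
  have p4 : |d| * M ^ 2 ≥ |d| := by nlinarith
  have p5 : a * M ^ 3 ≥ M ^ 3 := by
    have : 0 ≤ M ^ 3 := by positivity
    nlinarith
  have hcont : ContinuousOn (fun θ : ℝ => a * θ ^ 3 + b * θ ^ 2 + c * θ + d) (Set.Icc (-M) M) := by
    fun_prop
  have := intermediate_value_Icc (by linarith : -M ≤ M) hcont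
  have h0 : (0 : ℝ) ∈ Set.Icc (a * (-M) ^ 3 + b * (-M) ^ 2 + c * (-M) + d)
      (a * M ^ 3 + b * M ^ 2 + c * M + d) := by
    constructor
    · have : a * (-M) ^ 3 + b * (-M) ^ 2 + c * (-M) + d = - (a * M ^ 3) + b * M ^ 2 - c * M + d := by
        ring
      rw [this]; nlinarith
    · nlinarith
  obtain ⟨θ, -, h⟩ := this h0
  exact ⟨θ, h⟩

lemma quad_aux {Δ ρ L q : ℝ} (hΔ : 0 ≤ Δ) (hρ : 0 ≤ ρ) (hq : 0 ≤ q) :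
    (5 * ρ ^ 2 * Δ) ^ 3 * (L * q) ^ 4 ≤ 125 * (Δ * ρ ^ 2) * (Δ * L ^ 2 + ρ * q) ^ 6 := by
  have h4 : Δ * ρ ^ 2 * (L * q) ^ 2 ≤ (Δ * L ^ 2 + ρ * q) ^ 3 := by
    obtain ⟨x, hx⟩ : ∃ x, x = Δ * L ^ 2 := ⟨_, rfl⟩
    obtain ⟨y, hy⟩ : ∃ y, y = ρ * q := ⟨_, rfl⟩
    have hx0 : 0 ≤ x := by rw [hx]; positivity
    have hy0 : 0 ≤ y := by rw [hy]; positivity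
    have e : Δ * ρ ^ 2 * (L * q) ^ 2 = x * y ^ 2 := by rw [hx, hy]; ring
    rw [e, ← hx, ← hy]
    have : 0 ≤ x ^ 3 + 3 * x ^ 2 * y + 2 * x * y ^ 2 + y ^ 3 := by positivity
    nlinarith
  obtain ⟨z, hz⟩ : ∃ z, z = Δ * L ^ 2 + ρ * q := ⟨_, rfl⟩
  rw [← hz] at h4 ⊢
  have h5 : (Δ * ρ ^ 2 * (L * q) ^ 2) ^ 2 ≤ (z ^ 3) ^ 2 :=
    pow_le_pow_left₀ (by positivity) h4 2
  calc (5 * ρ ^ 2 * Δ) ^ 3 * (L * q) ^ 4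
      = 125 * (Δ * ρ ^ 2) * (Δ * ρ ^ 2 * (L * q) ^ 2) ^ 2 := by ring
    _ ≤ 125 * (Δ * ρ ^ 2) * (z ^ 3) ^ 2 := by gcongr
    _ = _ := by ring

lemma quad_of_factor (f : BCF) (α β p r s : ℝ) (ha : (f.1 : ℝ) = α * p)
    (hb : (f.2.1 : ℝ) = α * r + β * p) (hc : (f.2.2.1 : ℝ) = α * s + β * r)
    (hd : (f.2.2.2 : ℝ) = β * s) (hD : (disc f : ℝ) < 0) :
    ∃ P Q R : ℝ, 0 < P ∧ 0 < 4 * P * R - Q ^ 2 ∧ ∀ u v : ℝ,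
      (4 * P * R - Q ^ 2) ^ 3 * fe f u v ^ 4 ≤
        125 * |(disc f : ℝ)| * (P * u ^ 2 + Q * u * v + R * v ^ 2) ^ 6 := by
  wlog hp : 0 ≤ p generalizing α β p r s
  · exact this (-α) (-β) (-p) (-r) (-s) (by linarith) (by linarith) (by linarith) (by linarith)
      (by linarith)
  have hDe : (disc f : ℝ) = (r ^ 2 - 4 * p * s) * (p * β ^ 2 - r * α * β + s * α ^ 2) ^ 2 := by
    simp only [disc]; push_cast; rw [ha, hb, hc, hd]; ring
  obtain ⟨Δ, hΔ⟩ : ∃ Δ, Δ = 4 * p * s - r ^ 2 := ⟨_, rfl⟩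
  obtain ⟨ρ, hρ⟩ : ∃ ρ, ρ = p * β ^ 2 - r * α * β + s * α ^ 2 := ⟨_, rfl⟩
  have hDe' : (disc f : ℝ) = - (Δ * ρ ^ 2) := by rw [hDe, hΔ, hρ]; ring
  have hΔ0 : 0 < Δ := by
    by_contra h
    push Not at h
    have : 0 ≤ -(Δ * ρ ^ 2) := by nlinarith [sq_nonneg ρ]
    linarith
  have hp0 : 0 < p := by
    rcases hp.lt_or_eq with h | h
    · exact h
    · rw [← h] at hΔ; nlinarith [sq_nonneg r]
  have hqpos : ∀ x y : ℝ, 0 ≤ p * x ^ 2 + r * x * y + s * y ^ 2 := by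
    intro x y
    have : 0 ≤ 4 * p * (p * x ^ 2 + r * x * y + s * y ^ 2) := by
      have : 4 * p * (p * x ^ 2 + r * x * y + s * y ^ 2) = (2 * p * x + r * y) ^ 2 + Δ * y ^ 2 := by
        rw [hΔ]; ring
      rw [this]; positivity
    by_contra h
    push Not at h
    nlinarith
  have hρ0 : 0 < ρ := by
    have h1 : 0 ≤ ρ := by have := hqpos β (-α); rw [hρ]; linarith
    rcases h1.lt_or_eq with h | h
    · exact h
    · rw [← h] at hDe'; norm_num at hDe'; rw [hDe'] at hD; norm_num at hD
  refine ⟨Δ * α ^ 2 + ρ * p, 2 * Δ * α * β + ρ * r, Δ * β ^ 2 + ρ * s, by positivity, ?_, ?_⟩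
  · have : 4 * (Δ * α ^ 2 + ρ * p) * (Δ * β ^ 2 + ρ * s) - (2 * Δ * α * β + ρ * r) ^ 2
      = 5 * ρ ^ 2 * Δ := by
      have : ρ ^ 2 * Δ + 4 * Δ * ρ * (p * β ^ 2 - r * α * β + s * α ^ 2) = 5 * ρ ^ 2 * Δ := by
        rw [← hρ]; ring
      rw [← this, hΔ]; ring
    rw [this]; positivity
  · intro u v
    have h1 : 4 * (Δ * α ^ 2 + ρ * p) * (Δ * β ^ 2 + ρ * s) - (2 * Δ * α * β + ρ * r) ^ 2
      = 5 * ρ ^ 2 * Δ := by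
      have : ρ ^ 2 * Δ + 4 * Δ * ρ * (p * β ^ 2 - r * α * β + s * α ^ 2) = 5 * ρ ^ 2 * Δ := by
        rw [← hρ]; ring
      rw [← this, hΔ]; ring
    rw [h1]
    obtain ⟨L, hL⟩ : ∃ L, L = α * u + β * v := ⟨_, rfl⟩
    obtain ⟨q, hq⟩ : ∃ q, q = p * u ^ 2 + r * u * v + s * v ^ 2 := ⟨_, rfl⟩
    have hq0 : 0 ≤ q := by rw [hq]; exact hqpos u v
    have h2 : fe f u v = L * q := by
      simp only [fe]; rw [ha, hb, hc, hd, hL, hq]; ring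
    have h3 : (Δ * α ^ 2 + ρ * p) * u ^ 2 + (2 * Δ * α * β + ρ * r) * u * v
        + (Δ * β ^ 2 + ρ * s) * v ^ 2 = Δ * L ^ 2 + ρ * q := by rw [hL, hq]; ring
    rw [h2, h3, hDe', abs_neg, abs_of_pos (by positivity)]
    exact quad_aux hΔ0.le hρ0.le hq0

lemma exists_quad (f : BCF) (hD : disc f ≠ 0) :
    ∃ P Q R : ℝ, 0 < P ∧ 0 < 4 * P * R - Q ^ 2 ∧ ∀ u v : ℝ,
      (4 * P * R - Q ^ 2) ^ 3 * fe f u v ^ 4 ≤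
        125 * |(disc f : ℝ)| * (P * u ^ 2 + Q * u * v + R * v ^ 2) ^ 6 := by
  rcases lt_or_gt_of_ne hD with h | h
  · have hD' : (disc f : ℝ) < 0 := by exact_mod_cast h
    rcases lt_trichotomy f.1 0 with h1 | h1 | h1
    · have : (1 : ℝ) ≤ ((-f.1 : ℤ) : ℝ) := by exact_mod_cast (by omega : (1 : ℤ) ≤ -f.1)
      obtain ⟨θ, hθ⟩ := exists_real_root _ (-f.2.1) (-f.2.2.1) (-f.2.2.2) this
      push_cast at hθ
      exact quad_of_factor f 1 (-θ) f.1 (f.2.1 + f.1 * θ) (f.2.2.1 + f.2.1 * θ + f.1 * θ ^ 2)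
        (by ring) (by ring) (by ring) (by linarith) hD'
    · refine quad_of_factor f 0 1 f.2.1 f.2.2.1 f.2.2.2 ?_ (by ring) (by ring) (by ring) hD'
      rw [h1]; simp
    · have : (1 : ℝ) ≤ (f.1 : ℝ) := by exact_mod_cast h1
      obtain ⟨θ, hθ⟩ := exists_real_root _ (f.2.1) (f.2.2.1) (f.2.2.2) this
      exact quad_of_factor f 1 (-θ) f.1 (f.2.1 + f.1 * θ) (f.2.2.1 + f.2.1 * θ + f.1 * θ ^ 2)
        (by ring) (by ring) (by ring) (by linarith) hD'
  · have hD' : (0 : ℝ) < (disc f : ℝ) := by exact_mod_cast h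
    have hΔ : 4 * (hP f : ℝ) * hR f - (hQ f : ℝ) ^ 2 = 3 * disc f := by
      exact_mod_cast hess_disc f
    have key : ∀ u v : ℝ, 27 * (disc f : ℝ) * fe f u v ^ 2 ≤
        4 * (hP f * u ^ 2 + hQ f * u * v + hR f * v ^ 2) ^ 3 := by
      intro u v
      obtain ⟨a, b, c, d⟩ := f
      have : 4 * ((hP (a, b, c, d) : ℝ) * u ^ 2 + hQ (a, b, c, d) * u * v
          + hR (a, b, c, d) * v ^ 2) ^ 3 = 27 * (disc (a, b, c, d) : ℝ) * fe (a, b, c, d) u v ^ 2 +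
          ((2 * b ^ 3 - 9 * a * b * c + 27 * a ^ 2 * d) * u ^ 3
            + 3 * (b ^ 2 * c + 9 * a * b * d - 6 * a * c ^ 2) * u ^ 2 * v
            - 3 * (b * c ^ 2 + 9 * a * c * d - 6 * b ^ 2 * d) * u * v ^ 2
            - (2 * c ^ 3 - 9 * b * c * d + 27 * a * d ^ 2) * v ^ 3) ^ 2 := by
        simp only [hP, hQ, hR, disc, fe]; push_cast; ring
      rw [this]
      refine le_add_of_nonneg_right (sq_nonneg _)
    refine ⟨hP f, hQ f, hR f, ?_, by rw [hΔ]; positivity, ?_⟩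
    · have h1 := key 1 0
      have h2 : 0 ≤ 27 * (disc f : ℝ) * fe f 1 0 ^ 2 := by positivity
      have h3 : (0 : ℝ) ≤ (hP f : ℝ) ^ 3 := by
        have : 4 * ((hP f : ℝ) * 1 ^ 2 + hQ f * 1 * 0 + hR f * 0 ^ 2) ^ 3 = 4 * (hP f : ℝ) ^ 3 := by
          ring
        linarith
      have h4 : (0 : ℝ) ≤ hP f := by
        by_contra hc
        push Not at hc
        have := Odd.pow_neg (by decide : Odd 3) hc
        linarith
      rcases h4.lt_or_eq with h5 | h5
      · exact h5
      · rw [← h5] at hΔ; nlinarith [sq_nonneg (hQ f : ℝ)]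
    · intro u v
      rw [hΔ, abs_of_pos hD']
      have k1 := key u v
      have k2 : (27 * (disc f : ℝ) * fe f u v ^ 2) ^ 2 ≤
        (4 * (hP f * u ^ 2 + hQ f * u * v + hR f * v ^ 2) ^ 3) ^ 2 :=
        pow_le_pow_left₀ (by positivity) k1 2
      generalize (hP f * u ^ 2 + hQ f * u * v + hR f * v ^ 2 : ℝ) = H at *
      have : (3 * (disc f : ℝ)) ^ 3 * fe f u v ^ 4 =
        (disc f : ℝ) / 27 * (27 * (disc f : ℝ) * fe f u v ^ 2) ^ 2 := by ring
      rw [this]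
      calc (disc f : ℝ) / 27 * (27 * (disc f : ℝ) * fe f u v ^ 2) ^ 2
          ≤ (disc f : ℝ) / 27 * (4 * H ^ 3) ^ 2 := by gcongr
        _ = (16 / 27) * (disc f * H ^ 6) := by ring
        _ ≤ 125 * (disc f * H ^ 6) := by
            have : 0 ≤ (disc f : ℝ) * H ^ 6 := by positivity
            linarith
        _ = _ := by ring

end BCF

namespace BCF

lemma fe_act (γ : Matrix (Fin 2) (Fin 2) ℤ) (h : γ.det = 1) (f : BCF) (u v : ℝ) :
    fe (act γ f) u v = fe f (u * γ 0 0 + v * γ 1 0) (u * γ 0 1 + v * γ 1 1) := by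
  simp only [fe, act, h]; push_cast; ring

lemma exists_min_row (P Q R : ℝ) (hP : 0 < P) (hΔ : 0 < 4 * P * R - Q ^ 2) :
    ∃ x y : ℤ, IsCoprime x y ∧ ∀ x' y' : ℤ, IsCoprime x' y' →
      P * x ^ 2 + Q * x * y + R * y ^ 2 ≤ P * x' ^ 2 + Q * x' * y' + R * y' ^ 2 := by
  have hR : 0 < R := by
    by_contra h
    push Not at h
    nlinarith [sq_nonneg Q]
  obtain ⟨Δ, hΔe⟩ : ∃ Δ, Δ = 4 * P * R - Q ^ 2 := ⟨_, rfl⟩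
  rw [← hΔe] at hΔ
  obtain ⟨N, hN⟩ := exists_nat_ge (4 * (P + R) * P / Δ)
  have hbound : ∀ x y : ℤ, P * (x : ℝ) ^ 2 + Q * x * y + R * (y : ℝ) ^ 2 ≤ P →
      (x, y) ∈ Finset.Icc (-(N : ℤ)) N ×ˢ Finset.Icc (-(N : ℤ)) N := by
    intro x y h
    have hy : Δ * (y : ℝ) ^ 2 ≤ 4 * (P + R) * P := by
      have e : 4 * P * (P * (x : ℝ) ^ 2 + Q * x * y + R * (y : ℝ) ^ 2)
        = (2 * P * x + Q * y) ^ 2 + Δ * (y : ℝ) ^ 2 := by rw [hΔe]; ring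
      nlinarith [sq_nonneg (2 * P * x + Q * y), mul_pos hP hR]
    have hx : Δ * (x : ℝ) ^ 2 ≤ 4 * (P + R) * P := by
      have e : 4 * R * (P * (x : ℝ) ^ 2 + Q * x * y + R * (y : ℝ) ^ 2)
        = (2 * R * y + Q * x) ^ 2 + Δ * (x : ℝ) ^ 2 := by rw [hΔe]; ring
      nlinarith [sq_nonneg (2 * R * y + Q * x), mul_pos hP hP]
    have conv : ∀ w : ℤ, Δ * (w : ℝ) ^ 2 ≤ 4 * (P + R) * P → w ∈ Finset.Icc (-(N : ℤ)) N := by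
      intro w hw
      have h1 : (w : ℝ) ^ 2 ≤ N := by
        refine le_trans ?_ hN
        rw [le_div_iff₀ hΔ]; linarith
      have h2 : w ^ 2 ≤ (N : ℤ) := by exact_mod_cast h1
      rw [Finset.mem_Icc]
      constructor <;> nlinarith
    exact Finset.mem_product.2 ⟨conv x hx, conv y hy⟩
  let s : Finset (ℤ × ℤ) := (Finset.Icc (-(N : ℤ)) N ×ˢ Finset.Icc (-(N : ℤ)) N).filter
    (fun z => IsCoprime z.1 z.2)
  have h10 : ((1 : ℤ), (0 : ℤ)) ∈ s := by
    refine Finset.mem_filter.2 ⟨hbound 1 0 (by norm_num), ?_⟩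
    exact isCoprime_one_left
  obtain ⟨z, hz, hmin⟩ := Finset.exists_min_image s
    (fun z => P * (z.1 : ℝ) ^ 2 + Q * z.1 * z.2 + R * (z.2 : ℝ) ^ 2) ⟨_, h10⟩
  refine ⟨z.1, z.2, (Finset.mem_filter.1 hz).2, ?_⟩
  intro x' y' hc
  by_cases h : P * (x' : ℝ) ^ 2 + Q * x' * y' + R * (y' : ℝ) ^ 2 ≤ P
  · exact hmin (x', y') (Finset.mem_filter.2 ⟨hbound x' y' h, hc⟩)
  · have := hmin _ h10
    norm_num at this
    linarith

lemma exists_reduced (P Q R : ℝ) (hP : 0 < P) (hΔ : 0 < 4 * P * R - Q ^ 2) :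
    ∃ γ : Matrix (Fin 2) (Fin 2) ℤ, γ.det = 1 ∧ ∃ P' Q' R' : ℝ,
      0 < P' ∧ |Q'| ≤ P' ∧ P' ≤ R' ∧ 4 * P' * R' - Q' ^ 2 = 4 * P * R - Q ^ 2 ∧
      ∀ u v : ℝ, P * (u * γ 0 0 + v * γ 1 0) ^ 2
        + Q * (u * γ 0 0 + v * γ 1 0) * (u * γ 0 1 + v * γ 1 1)
        + R * (u * γ 0 1 + v * γ 1 1) ^ 2 = P' * u ^ 2 + Q' * u * v + R' * v ^ 2 := by
  obtain ⟨x, y, hc, hmin⟩ := exists_min_row P Q R hP hΔ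
  obtain ⟨m, n, hmn⟩ := hc
  -- rows (x, y) and (-n, m), shifted
  obtain ⟨P', hP'⟩ : ∃ P', P' = P * (x : ℝ) ^ 2 + Q * x * y + R * (y : ℝ) ^ 2 := ⟨_, rfl⟩
  have hP'0 : 0 < P' := by
    have hne : (x : ℝ) ≠ 0 ∨ (y : ℝ) ≠ 0 := by
      by_contra h
      push Not at h
      have h1 : x = 0 := by exact_mod_cast h.1
      have h2 : y = 0 := by exact_mod_cast h.2
      rw [h1, h2] at hmn; simp at hmn
    have e : 4 * P * P' = (2 * P * x + Q * y) ^ 2 + (4 * P * R - Q ^ 2) * (y : ℝ) ^ 2 := by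
      rw [hP']; ring
    have : 0 < 4 * P * P' := by
      rw [e]
      by_cases hy : (y : ℝ) = 0
      · have hx : (x : ℝ) ≠ 0 := by tauto
        rw [hy]
        have : (2 * P * (x : ℝ) + Q * 0) ≠ 0 := by simp [hx, hP.ne']
        positivity
      · positivity
    by_contra h
    push Not at h
    nlinarith
  let Q0 : ℝ := 2 * P * x * (-n) + Q * (x * m + y * (-n)) + 2 * R * y * m
  let k : ℤ := round (-Q0 / (2 * P'))
  have hk := abs_sub_round (-Q0 / (2 * P'))
  let β : ℤ := -n + k * x
  let δ : ℤ := m + k * y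
  have hdet : x * δ - y * β = 1 := by simp only [β, δ]; linarith
  refine ⟨!![x, y; β, δ], ?_, P', 2 * P * x * β + Q * (x * δ + y * β) + 2 * R * y * δ,
    P * (β : ℝ) ^ 2 + Q * β * δ + R * (δ : ℝ) ^ 2, hP'0, ?_, ?_, ?_, ?_⟩
  · simp [Matrix.det_fin_two]; linarith
  · have e : 2 * P * x * β + Q * (x * δ + y * β) + 2 * R * y * δ = Q0 + 2 * P' * k := by
      simp only [Q0, β, δ, hP']; push_cast; ring
    rw [e]
    have e2 : Q0 + 2 * P' * k = -(2 * P') * (-Q0 / (2 * P') - k) := by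
      field_simp; ring
    rw [e2, abs_mul, abs_neg, abs_of_pos (by positivity)]
    calc 2 * P' * |(-Q0 / (2 * P') - k)| ≤ 2 * P' * (1 / 2) := by gcongr
      _ = P' := by ring
  · rw [hP']
    refine hmin β δ ⟨-y, x, by linarith⟩
  · have hdet' : (x : ℝ) * δ - y * β = 1 := by exact_mod_cast hdet
    rw [hP']
    have : 4 * (P * (x : ℝ) ^ 2 + Q * x * y + R * (y : ℝ) ^ 2) *
        (P * (β : ℝ) ^ 2 + Q * β * δ + R * (δ : ℝ) ^ 2) -
        (2 * P * x * β + Q * (x * δ + y * β) + 2 * R * y * δ) ^ 2 =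
        (4 * P * R - Q ^ 2) * ((x : ℝ) * δ - y * β) ^ 2 := by ring
    rw [this, hdet']; ring
  · intro u v
    simp only [Matrix.of_apply, Matrix.cons_val', Matrix.cons_val_zero,
      Matrix.cons_val_one, Matrix.cons_val_fin_one]
    rw [hP']; ring

lemma le_of_pow4_le {x y : ℝ} (hy : 0 ≤ y) (h : x ^ 4 ≤ y ^ 4) : |x| ≤ y := by
  have : |x| ^ 4 ≤ y ^ 4 := by
    rwa [Even.pow_abs (by decide : Even 4)]
  exact le_of_pow_le_pow_left₀ (by norm_num) hy this

/-- Membership in the standard box. -/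
def InBox (A B C D : ℝ) (f : BCF) : Prop :=
  |(f.1 : ℝ)| ≤ A ∧ |(f.2.1 : ℝ)| ≤ B ∧ |(f.2.2.1 : ℝ)| ≤ C ∧ |(f.2.2.2 : ℝ)| ≤ D

lemma exists_box (f : BCF) (hD : disc f ≠ 0) (lam : ℝ) (hl : 0 < lam)
    (hlam : |(disc f : ℝ)| ≤ lam ^ 4) :
    ∃ γ : Matrix (Fin 2) (Fin 2) ℤ, γ.det = 1 ∧ ∃ t : ℝ, 1 ≤ t ∧
      InBox (13 * lam / t ^ 3) (13 * lam / t) (13 * lam * t) (13 * lam * t ^ 3) (act γ f) := by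
  obtain ⟨P, Q, R, hP, hΔ, hf⟩ := exists_quad f hD
  obtain ⟨γ, hγ, P', Q', R', hP', hQ', hR', hΔ', hq⟩ := exists_reduced P Q R hP hΔ
  refine ⟨γ, hγ, ?_⟩
  rw [← hΔ'] at hf
  have hR0 : 0 < R' := by linarith
  have hbd : ∀ u v : ℝ, 27 * (P' * R') ^ 3 * fe (act γ f) u v ^ 4 ≤
      125 * lam ^ 4 * (P' * u ^ 2 + Q' * u * v + R' * v ^ 2) ^ 6 := by
    intro u v
    have h1 := hf (u * γ 0 0 + v * γ 1 0) (u * γ 0 1 + v * γ 1 1)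
    rw [hq, ← fe_act γ hγ] at h1
    have h2 : 3 * (P' * R') ≤ 4 * P' * R' - Q' ^ 2 := by
      have : Q' ^ 2 ≤ P' ^ 2 := sq_le_sq' (by linarith [neg_abs_le Q']) (by linarith [le_abs_self Q'])
      nlinarith
    have h3 : (3 * (P' * R')) ^ 3 ≤ (4 * P' * R' - Q' ^ 2) ^ 3 :=
      pow_le_pow_left₀ (by positivity) h2 3
    calc 27 * (P' * R') ^ 3 * fe (act γ f) u v ^ 4
        = (3 * (P' * R')) ^ 3 * fe (act γ f) u v ^ 4 := by ring
      _ ≤ (4 * P' * R' - Q' ^ 2) ^ 3 * fe (act γ f) u v ^ 4 := by gcongr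
      _ ≤ _ := h1
      _ ≤ _ := by gcongr
  clear hf hΔ hq hΔ'
  generalize act γ f = g at *
  obtain ⟨a, b, c, d⟩ := g
  -- t = (R'/P')^(1/4)
  obtain ⟨t, ht1, ht⟩ : ∃ t : ℝ, 1 ≤ t ∧ R' = P' * t ^ 4 := by
    refine ⟨(R' / P') ^ ((1 : ℝ) / 4), ?_, ?_⟩
    · apply Real.one_le_rpow
      · rw [le_div_iff₀ hP']; linarith
      · norm_num
    · rw [← Real.rpow_natCast, ← Real.rpow_mul (by positivity)]
      norm_num
      field_simp
  refine ⟨t, ht1, ?_⟩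
  have ht0 : 0 < t := by linarith
  have main : ∀ u v w : ℝ, 0 ≤ w → P' * u ^ 2 + Q' * u * v + R' * v ^ 2 ≤ w * P' →
      0 ≤ P' * u ^ 2 + Q' * u * v + R' * v ^ 2 →
      27 * t ^ 12 * fe (a, b, c, d) u v ^ 4 ≤ 125 * lam ^ 4 * w ^ 6 := by
    intro u v w hw h1 h0
    have h2 := hbd u v
    have h3 : (P' * u ^ 2 + Q' * u * v + R' * v ^ 2) ^ 6 ≤ (w * P') ^ 6 :=
      pow_le_pow_left₀ h0 h1 6
    have h4 : 27 * (P' * R') ^ 3 * fe (a, b, c, d) u v ^ 4 ≤ 125 * lam ^ 4 * (w * P') ^ 6 :=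
      h2.trans (by gcongr)
    rw [ht] at h4
    have h5 : P' ^ 6 * (27 * t ^ 12 * fe (a, b, c, d) u v ^ 4) ≤ P' ^ 6 * (125 * lam ^ 4 * w ^ 6) := by
      calc _ = 27 * (P' * (P' * t ^ 4)) ^ 3 * fe (a, b, c, d) u v ^ 4 := by ring
        _ ≤ _ := h4
        _ = _ := by ring
    exact le_of_mul_le_mul_left h5 (by positivity)
  have hPR : P' ≤ P' * t ^ 4 := by linarith
  have ha : |(a : ℝ)| ≤ 2 * lam / t ^ 3 := by
    apply le_of_pow4_le (by positivity)
    have h := main 1 0 1 (by norm_num) (by norm_num) (by norm_num; positivity)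
    simp only [fe] at h
    norm_num at h
    rw [div_pow, le_div_iff₀ (by positivity)]
    have : 0 ≤ lam ^ 4 := by positivity
    nlinarith
  have hd : |(d : ℝ)| ≤ 2 * lam * t ^ 3 := by
    apply le_of_pow4_le (by positivity)
    have h := main 0 1 (t ^ 4) (by positivity) (by rw [ht]; linarith) (by norm_num; positivity)
    simp only [fe] at h
    norm_num at h
    have h2 : t ^ 12 * (27 * (d : ℝ) ^ 4) ≤ t ^ 12 * (125 * lam ^ 4 * t ^ 12) := by
      calc _ = 27 * t ^ 12 * (d : ℝ) ^ 4 := by ring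
        _ ≤ _ := h
        _ = _ := by ring
    have h3 := le_of_mul_le_mul_left h2 (by positivity)
    have : 0 ≤ lam ^ 4 * t ^ 12 := by positivity
    calc (d : ℝ) ^ 4 ≤ 125 / 27 * (lam ^ 4 * t ^ 12) := by linarith
      _ ≤ 16 * (lam ^ 4 * t ^ 12) := by linarith
      _ = _ := by ring
  have hpm : ∀ s : ℝ, |s| = t ^ 2 → |fe (a, b, c, d) s 1| ≤ 11 * lam * t ^ 3 := by
    intro s hs
    have hs2 : s ^ 2 = t ^ 4 := by rw [← sq_abs, hs]; ring
    have hqs : |Q' * s| ≤ P' * t ^ 2 := by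
      rw [abs_mul, hs]; gcongr
    have ht2 : P' * t ^ 2 ≤ P' * t ^ 4 := by
      gcongr
      norm_num
    have := abs_le.1 hqs
    have h := main s 1 (3 * t ^ 4) (by positivity) (by rw [ht, hs2]; linarith)
      (by rw [ht, hs2]; linarith)
    apply le_of_pow4_le (by positivity)
    have h2 : t ^ 12 * (27 * fe (a, b, c, d) s 1 ^ 4) ≤ t ^ 12 * (91125 * lam ^ 4 * t ^ 12) := by
      calc _ = 27 * t ^ 12 * fe (a, b, c, d) s 1 ^ 4 := by ring
        _ ≤ _ := h
        _ = _ := by ring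
    have h3 := le_of_mul_le_mul_left h2 (by positivity)
    have : 0 ≤ lam ^ 4 * t ^ 12 := by positivity
    calc fe (a, b, c, d) s 1 ^ 4 ≤ 91125 / 27 * (lam ^ 4 * t ^ 12) := by linarith
      _ ≤ 14641 * (lam ^ 4 * t ^ 12) := by linarith
      _ = _ := by ring
  have h1 := hpm (t ^ 2) (abs_of_pos (by positivity))
  have h2 := hpm (-t ^ 2) (by rw [abs_neg]; exact abs_of_pos (by positivity))
  have e1 : fe (a, b, c, d) (t ^ 2) 1 = a * t ^ 6 + b * t ^ 4 + c * t ^ 2 + d := by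
    simp only [fe]; ring
  have e2 : fe (a, b, c, d) (-t ^ 2) 1 = -(a * t ^ 6) + b * t ^ 4 - c * t ^ 2 + d := by
    simp only [fe]; ring
  rw [e1] at h1
  rw [e2] at h2
  have h1 := abs_le.1 h1
  have h2 := abs_le.1 h2
  have hd' := abs_le.1 hd
  have hat : |(a : ℝ) * t ^ 6| ≤ 2 * lam * t ^ 3 := by
    rw [abs_mul, abs_of_pos (by positivity : 0 < t ^ 6)]
    calc |(a : ℝ)| * t ^ 6 ≤ 2 * lam / t ^ 3 * t ^ 6 := by gcongr
      _ = _ := by field_simp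
  have hat' := abs_le.1 hat
  refine ⟨?_, ?_, ?_, ?_⟩
  · refine ha.trans ?_
    gcongr; norm_num
  · have : |(b : ℝ) * t ^ 4| ≤ 13 * lam * t ^ 3 := by
      rw [abs_le]; constructor <;> linarith
    rw [abs_mul, abs_of_pos (by positivity : 0 < t ^ 4)] at this
    rw [le_div_iff₀ ht0]
    have h3 : t ^ 3 * (|(b : ℝ)| * t) ≤ t ^ 3 * (13 * lam) := by linarith
    exact le_of_mul_le_mul_left h3 (by positivity)
  · have : |(c : ℝ) * t ^ 2| ≤ 13 * lam * t ^ 3 := by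
      rw [abs_le]; constructor <;> linarith
    rw [abs_mul, abs_of_pos (by positivity : 0 < t ^ 2)] at this
    have h3 : t ^ 2 * (|(c : ℝ)|) ≤ t ^ 2 * (13 * lam * t) := by linarith
    exact le_of_mul_le_mul_left h3 (by positivity)
  · refine hd.trans ?_
    gcongr; norm_num

/-- Dyadic version, with all the translates in the box. -/
lemma exists_dyadic (f : BCF) (hD : disc f ≠ 0) (lam : ℝ) (hl : 0 < lam)
    (hlam : |(disc f : ℝ)| ≤ lam ^ 4) :
    ∃ γ : Matrix (Fin 2) (Fin 2) ℤ, γ.det = 1 ∧ ∃ j : ℕ, ∀ n : ℕ, n < 4 ^ j →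
      InBox (832 * lam / (2 ^ j) ^ 3) (832 * lam / 2 ^ j) (832 * lam * 2 ^ j)
        (832 * lam * (2 ^ j) ^ 3) (act (uni n) (act γ f)) := by
  obtain ⟨γ, hγ, t, ht, ha, hb, hc, hd⟩ := exists_box f hD lam hl hlam
  refine ⟨γ, hγ, ?_⟩
  generalize act γ f = g at *
  obtain ⟨a, b, c, d⟩ := g
  obtain ⟨j, hj1, hj2⟩ := exists_nat_pow_near ht (by norm_num : (1 : ℝ) < 2)
  refine ⟨j, ?_⟩
  intro n hn
  obtain ⟨T, hT⟩ : ∃ T : ℝ, T = 2 ^ j := ⟨_, rfl⟩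
  have hT1 : 1 ≤ T := by rw [hT]; exact one_le_pow₀ (by norm_num)
  rw [pow_succ, ← hT] at hj2
  rw [← hT] at hj1 ⊢
  have hT0 : 0 < T := by linarith
  have hn' : (n : ℝ) ≤ T ^ 2 := by
    have : (n : ℝ) ≤ ((4 ^ j : ℕ) : ℝ) := by exact_mod_cast hn.le
    refine this.trans (le_of_eq ?_)
    rw [hT]; push_cast
    rw [← pow_mul, mul_comm, pow_mul]; norm_num
  simp only at ha hb hc hd
  have hn0 : (0 : ℝ) ≤ n := Nat.cast_nonneg n
  have hAt : |(a : ℝ)| * T ^ 3 ≤ 13 * lam := by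
    rw [← le_div_iff₀ (by positivity)]
    refine ha.trans ?_
    gcongr
  have hBt : |(b : ℝ)| * T ≤ 13 * lam := by
    rw [← le_div_iff₀ (by positivity)]
    refine hb.trans ?_
    gcongr
  have hCt : |(c : ℝ)| ≤ 26 * lam * T := by
    refine hc.trans ?_
    have : 13 * lam * t ≤ 13 * lam * (T * 2) := by gcongr
    linarith
  have hDt : |(d : ℝ)| ≤ 104 * lam * T ^ 3 := by
    refine hd.trans ?_
    have : 13 * lam * t ^ 3 ≤ 13 * lam * (T * 2) ^ 3 := by gcongr
    linarith [mul_pow T 2 3]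
  have a0 := abs_nonneg (a : ℝ)
  have b0 := abs_nonneg (b : ℝ)
  have c0 := abs_nonneg (c : ℝ)
  rw [act_uni]
  -- powers of n times coefficients
  have an : |(a : ℝ)| * n * T ≤ 13 * lam := by
    calc |(a : ℝ)| * n * T ≤ |(a : ℝ)| * T ^ 2 * T := by gcongr
      _ = |(a : ℝ)| * T ^ 3 := by ring
      _ ≤ _ := hAt
  have an2 : |(a : ℝ)| * n ^ 2 ≤ 13 * lam * T := by
    calc |(a : ℝ)| * n ^ 2 ≤ |(a : ℝ)| * (T ^ 2) ^ 2 := by gcongr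
      _ = (|(a : ℝ)| * T ^ 3) * T := by ring
      _ ≤ _ := by gcongr
  have an3 : |(a : ℝ)| * n ^ 3 ≤ 13 * lam * T ^ 3 := by
    calc |(a : ℝ)| * n ^ 3 ≤ |(a : ℝ)| * (T ^ 2) ^ 3 := by gcongr
      _ = (|(a : ℝ)| * T ^ 3) * T ^ 3 := by ring
      _ ≤ _ := by gcongr
  have bn : |(b : ℝ)| * n ≤ 13 * lam * T := by
    calc |(b : ℝ)| * n ≤ |(b : ℝ)| * T ^ 2 := by gcongr
      _ = (|(b : ℝ)| * T) * T := by ring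
      _ ≤ _ := by gcongr
  have bn2 : |(b : ℝ)| * n ^ 2 ≤ 13 * lam * T ^ 3 := by
    calc |(b : ℝ)| * n ^ 2 ≤ |(b : ℝ)| * (T ^ 2) ^ 2 := by gcongr
      _ = (|(b : ℝ)| * T) * T ^ 3 := by ring
      _ ≤ _ := by gcongr
  have cn : |(c : ℝ)| * n ≤ 26 * lam * T ^ 3 := by
    calc |(c : ℝ)| * n ≤ (26 * lam * T) * T ^ 2 := by gcongr
      _ = _ := by ring
  have lT : 0 ≤ lam * T := by positivity
  have lT3 : 0 ≤ lam * T ^ 3 := by positivity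
  refine ⟨?_, ?_, ?_, ?_⟩
  · simp only
    rw [le_div_iff₀ (by positivity)]; linarith
  · simp only; push_cast
    rw [le_div_iff₀ (by positivity)]
    have : |(b : ℝ) + 3 * a * n| ≤ |(b : ℝ)| + 3 * (|(a : ℝ)| * n) := by
      refine (abs_add_le _ _).trans ?_
      rw [abs_mul, abs_mul, abs_of_nonneg hn0]; norm_num; linarith
    calc |(b : ℝ) + 3 * a * n| * T ≤ (|(b : ℝ)| + 3 * (|(a : ℝ)| * n)) * T := by gcongr
      _ = |(b : ℝ)| * T + 3 * (|(a : ℝ)| * n * T) := by ring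
      _ ≤ _ := by linarith
  · simp only; push_cast
    have : |(c : ℝ) + 2 * b * n + 3 * a * n ^ 2| ≤
        |(c : ℝ)| + 2 * (|(b : ℝ)| * n) + 3 * (|(a : ℝ)| * n ^ 2) := by
      refine (abs_add_le _ _).trans (add_le_add ((abs_add_le _ _).trans ?_) ?_)
      · rw [abs_mul, abs_mul, abs_of_nonneg hn0]; norm_num; linarith
      · rw [abs_mul, abs_mul, abs_of_nonneg (by positivity : (0 : ℝ) ≤ n ^ 2)]; norm_num; linarith
    linarith
  · simp only; push_cast
    have : |(d : ℝ) + c * n + b * n ^ 2 + a * n ^ 3| ≤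
        |(d : ℝ)| + |(c : ℝ)| * n + |(b : ℝ)| * n ^ 2 + |(a : ℝ)| * n ^ 3 := by
      refine (abs_add_le _ _).trans (add_le_add ((abs_add_le _ _).trans
        (add_le_add ((abs_add_le _ _).trans ?_) ?_)) ?_)
      · rw [abs_mul, abs_of_nonneg hn0]
      · rw [abs_mul, abs_of_nonneg (by positivity : (0 : ℝ) ≤ n ^ 2)]
      · rw [abs_mul, abs_of_nonneg (by positivity : (0 : ℝ) ≤ n ^ 3)]
    linarith

end BCF

namespace BCF

/-! ### Counting lattice points in boxes with congruence conditions -/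

lemma sqfree_dvd {n : ℕ} (hn : Squarefree n) {z : ℤ}
    (h : ∀ p : ℕ, p.Prime → p ∣ n → (p : ℤ) ∣ z) : (n : ℤ) ∣ z := by
  rw [← Nat.prod_primeFactors_of_squarefree hn, Int.natCast_dvd]
  refine Finset.prod_primes_dvd _ ?_ ?_
  · intro p hp
    exact (Nat.prime_of_mem_primeFactors hp).prime
  · intro p hp
    rw [← Int.natCast_dvd]
    exact h p (Nat.prime_of_mem_primeFactors hp) (Nat.dvd_of_mem_primeFactors hp)

lemma card_class {s : Finset ℤ} {D : ℝ} (hD : 0 ≤ D) {n : ℕ} (hn : 0 < n)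
    (hs : ∀ x ∈ s, |(x : ℝ)| ≤ D) (hc : ∀ x ∈ s, ∀ y ∈ s, (n : ℤ) ∣ x - y) :
    (s.card : ℝ) ≤ 2 * D / n + 1 := by
  rcases s.eq_empty_or_nonempty with h | h
  · rw [h]; simp; positivity
  · have h0 := s.min'_mem h
    obtain ⟨x0, hx0⟩ : ∃ x0, x0 = s.min' h := ⟨_, rfl⟩
    rw [← hx0] at h0
    have hn' : (0 : ℤ) < n := by exact_mod_cast hn
    have hcard : s.card ≤ (Finset.range (⌊2 * D / n⌋₊ + 1)).card := by
      refine Finset.card_le_card_of_injOn (fun x => ((x - x0) / n).toNat) ?_ ?_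
      · intro x hx
        obtain ⟨k, hk⟩ := hc x hx x0 h0
        have hle : x0 ≤ x := by rw [hx0]; exact Finset.min'_le _ _ hx
        simp only [Finset.coe_range, Set.mem_Iio]
        rw [hk, Int.mul_ediv_cancel_left _ hn'.ne']
        have hk0 : 0 ≤ k := by
          by_contra hneg
          push Not at hneg
          nlinarith
        rw [Nat.lt_succ_iff]
        apply Nat.le_floor
        have : ((k.toNat : ℕ) : ℝ) = (k : ℝ) := by
          exact_mod_cast congrArg (fun z : ℤ => (z : ℝ)) (Int.toNat_of_nonneg hk0)
        rw [this, le_div_iff₀ (by exact_mod_cast hn)]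
        have e : (k : ℝ) * n = x - x0 := by
          have := congrArg (fun z : ℤ => (z : ℝ)) hk
          push_cast at this; linarith
        rw [e]
        have h1 := abs_le.1 (hs x hx)
        have h2 := abs_le.1 (hs x0 h0)
        linarith
      · intro x hx y hy hxy
        obtain ⟨k, hk⟩ := hc x hx x0 h0
        obtain ⟨k', hk'⟩ := hc y hy x0 h0
        have hle : x0 ≤ x := by rw [hx0]; exact Finset.min'_le _ _ hx
        have hle' : x0 ≤ y := by rw [hx0]; exact Finset.min'_le _ _ hy
        have e1 : (x - x0) / n = k := by rw [hk, Int.mul_ediv_cancel_left _ hn'.ne']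
        have e2 : (y - x0) / n = k' := by rw [hk', Int.mul_ediv_cancel_left _ hn'.ne']
        simp only [e1, e2] at hxy
        have hk0 : 0 ≤ k := by
          by_contra hneg
          push Not at hneg
          nlinarith
        have hk0' : 0 ≤ k' := by
          by_contra hneg
          push Not at hneg
          nlinarith
        have : k = k' := by omega
        rw [this] at hk
        linarith
    rw [Finset.card_range] at hcard
    have : (s.card : ℝ) ≤ (⌊2 * D / n⌋₊ : ℝ) + 1 := by exact_mod_cast hcard
    refine this.trans ?_
    gcongr
    exact Nat.floor_le (by positivity)

lemma card_residues {s : Finset ℤ} {D : ℝ} (hD : 0 ≤ D) {n : ℕ} (hn : Squarefree n)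
    (hs : ∀ x ∈ s, |(x : ℝ)| ≤ D)
    (hc : ∀ p : ℕ, p.Prime → p ∣ n → ∀ x ∈ s, ∀ y ∈ s, ∀ z ∈ s,
      (p : ℤ) ∣ x - y ∨ (p : ℤ) ∣ x - z ∨ (p : ℤ) ∣ y - z) :
    (s.card : ℝ) ≤ 2 ^ n.primeFactors.card * (2 * D / n + 1) := by
  let φ : ℤ → (∀ p ∈ n.primeFactors, ℤ) := fun x p _ => x % p
  let t := n.primeFactors.pi (fun p => s.image (fun x : ℤ => x % p))
  have hmaps : ∀ x ∈ s, φ x ∈ t := by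
    intro x hx
    rw [Finset.mem_pi]
    intro p hp
    exact Finset.mem_image_of_mem (fun x : ℤ => x % p) hx
  have ht : t.card ≤ 2 ^ n.primeFactors.card := by
    rw [Finset.card_pi]
    refine Finset.prod_le_pow_card _ _ _ ?_
    intro p hp
    by_contra hcon
    push Not at hcon
    obtain ⟨u, v, w, hu, hv, hw, h1, h2, h3⟩ := Finset.two_lt_card_iff.1 hcon
    obtain ⟨x, hx, rfl⟩ := Finset.mem_image.1 hu
    obtain ⟨y, hy, rfl⟩ := Finset.mem_image.1 hv
    obtain ⟨z, hz, rfl⟩ := Finset.mem_image.1 hw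
    have := hc p (Nat.prime_of_mem_primeFactors hp) (Nat.dvd_of_mem_primeFactors hp) x hx y hy z hz
    rcases this with h | h | h
    · exact h1 ((Int.emod_eq_emod_iff_emod_sub_eq_zero).2 (Int.emod_eq_zero_of_dvd h))
    · exact h2 ((Int.emod_eq_emod_iff_emod_sub_eq_zero).2 (Int.emod_eq_zero_of_dvd h))
    · exact h3 ((Int.emod_eq_emod_iff_emod_sub_eq_zero).2 (Int.emod_eq_zero_of_dvd h))
  have hfib := Finset.card_eq_sum_card_fiberwise hmaps
  have hn0 : 0 < n := Nat.pos_of_ne_zero hn.ne_zero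
  rw [hfib]
  push_cast
  calc (∑ b ∈ t, ((s.filter (fun x => φ x = b)).card : ℝ))
      ≤ ∑ b ∈ t, (2 * D / n + 1) := by
        refine Finset.sum_le_sum ?_
        intro b _
        refine card_class hD hn0 (fun x hx => hs x (Finset.mem_filter.1 hx).1) ?_
        intro x hx y hy
        apply sqfree_dvd hn
        intro p hp hpn
        have e : φ x = φ y := (Finset.mem_filter.1 hx).2.trans (Finset.mem_filter.1 hy).2.symm
        have := congrFun (congrFun e p) (Nat.mem_primeFactors.2 ⟨hp, hpn, hn.ne_zero⟩)
        exact Int.ModEq.dvd (Eq.symm this)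
    _ = t.card * (2 * D / n + 1) := by rw [Finset.sum_const, nsmul_eq_mul]
    _ ≤ _ := by
        gcongr
        exact_mod_cast ht

/-- Nonzero integers of absolute value at most `A`. -/
def nz (A : ℝ) : Finset ℤ := (Finset.Icc (-⌊A⌋) ⌊A⌋).erase 0

lemma mem_Icc_floor {A : ℝ} {a : ℤ} : a ∈ Finset.Icc (-⌊A⌋) ⌊A⌋ ↔ |(a : ℝ)| ≤ A := by
  rw [Finset.mem_Icc, abs_le]
  constructor
  · rintro ⟨h1, h2⟩
    have := Int.floor_le A
    have h1' : -(⌊A⌋ : ℝ) ≤ a := by exact_mod_cast h1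
    have h2' : (a : ℝ) ≤ ⌊A⌋ := by exact_mod_cast h2
    constructor <;> linarith
  · rintro ⟨h1, h2⟩
    refine ⟨?_, Int.le_floor.2 h2⟩
    have : -a ≤ ⌊A⌋ := Int.le_floor.2 (by push_cast; linarith)
    linarith

lemma mem_nz {A : ℝ} {a : ℤ} : a ∈ nz A ↔ a ≠ 0 ∧ |(a : ℝ)| ≤ A := by
  rw [nz, Finset.mem_erase, mem_Icc_floor]

lemma card_nz_dvd {A : ℝ} (hA : 0 ≤ A) {k : ℕ} (hk : 0 < k) :
    (((nz A).filter (fun a => (k : ℤ) ∣ a)).card : ℝ) ≤ 2 * A / k := by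
  have h0 : (0 : ℤ) ∉ (nz A).filter (fun a => (k : ℤ) ∣ a) := by
    simp [mem_nz]
  have := card_class (s := insert 0 ((nz A).filter (fun a => (k : ℤ) ∣ a))) hA hk ?_ ?_
  · rw [Finset.card_insert_of_notMem h0] at this
    push_cast at this
    linarith
  · intro x hx
    rcases Finset.mem_insert.1 hx with rfl | hx
    · simpa using hA
    · exact (mem_nz.1 (Finset.mem_filter.1 hx).1).2
  · have : ∀ x ∈ insert 0 ((nz A).filter (fun a => (k : ℤ) ∣ a)), (k : ℤ) ∣ x := by
      intro x hx
      rcases Finset.mem_insert.1 hx with rfl | hx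
      · exact dvd_zero _
      · exact (Finset.mem_filter.1 hx).2
    intro x hx y hy
    exact dvd_sub (this x hx) (this y hy)

lemma sum_gcd_nz {A : ℝ} (hA : 0 ≤ A) {k m : ℕ} (hk : 0 < k) (hm : 0 < m)
    (hkm : Nat.Coprime k m) :
    (∑ a ∈ (nz A).filter (fun a => (k : ℤ) ∣ a), (Int.gcd a m : ℝ)) ≤
      2 * A * (m.divisors.card : ℝ) / k := by
  set s := (nz A).filter (fun a => (k : ℤ) ∣ a) with hs
  calc (∑ a ∈ s, (Int.gcd a m : ℝ))
      ≤ ∑ a ∈ s, ∑ g ∈ m.divisors, (if (g : ℤ) ∣ a then (g : ℝ) else 0) := by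
        refine Finset.sum_le_sum ?_
        intro a _
        have hmem : Int.gcd a m ∈ m.divisors := by
          rw [Nat.mem_divisors]
          refine ⟨?_, hm.ne'⟩
          have := Int.gcd_dvd_right a m
          exact_mod_cast this
        have := Finset.single_le_sum (s := m.divisors)
          (f := fun g : ℕ => if (g : ℤ) ∣ a then (g : ℝ) else 0)
          (fun g _ => by positivity) hmem
        simp only [Int.gcd_dvd_left, if_true] at this
        exact this
    _ = ∑ g ∈ m.divisors, ∑ a ∈ s, (if (g : ℤ) ∣ a then (g : ℝ) else 0) := Finset.sum_comm
    _ ≤ ∑ g ∈ m.divisors, 2 * A / k := by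
        refine Finset.sum_le_sum ?_
        intro g hg
        have hg0 : 0 < g := Nat.pos_of_mem_divisors hg
        rw [← Finset.sum_filter, Finset.sum_const, nsmul_eq_mul]
        have hsub : s.filter (fun a => (g : ℤ) ∣ a) ⊆
            (nz A).filter (fun a => ((k * g : ℕ) : ℤ) ∣ a) := by
          intro a ha
          rw [Finset.mem_filter, hs, Finset.mem_filter] at ha
          rw [Finset.mem_filter]
          refine ⟨ha.1.1, ?_⟩
          push_cast
          refine IsCoprime.mul_dvd ?_ ha.1.2 ha.2
          exact Nat.isCoprime_iff_coprime.2 (hkm.coprime_dvd_right (Nat.dvd_of_mem_divisors hg))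
        have h1 : ((s.filter (fun a => (g : ℤ) ∣ a)).card : ℝ) ≤ 2 * A / (k * g : ℕ) :=
          le_trans (by exact_mod_cast Finset.card_le_card hsub) (card_nz_dvd hA (by positivity))
        calc ((s.filter (fun a => (g : ℤ) ∣ a)).card : ℝ) * g ≤ 2 * A / (k * g : ℕ) * g := by gcongr
          _ = 2 * A / k := by push_cast; field_simp
    _ = _ := by rw [Finset.sum_const, nsmul_eq_mul]; ring

end BCF

namespace BCF

lemma dvd_eq {p x y : ℤ} (h : p ∣ x) (e : y = x) : p ∣ y := e ▸ h

/-- The slice of a finite set of pairs over a first coordinate. -/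
def slice {β : Type} (F : Finset (ℤ × β)) (a : ℤ) : Finset β :=
  (F.filter (fun x => x.1 = a)).image (fun x => x.2)

lemma mem_slice {β : Type} {F : Finset (ℤ × β)} {a : ℤ} {y : β} :
    y ∈ slice F a ↔ (a, y) ∈ F := by
  simp only [slice, Finset.mem_image, Finset.mem_filter]
  constructor
  · rintro ⟨⟨a', y'⟩, ⟨h1, h2⟩, h3⟩
    simp only at h2 h3
    rw [← h2, ← h3]; exact h1
  · intro h
    exact ⟨(a, y), ⟨h, rfl⟩, rfl⟩

lemma card_slice {β : Type} (F : Finset (ℤ × β)) (s : Finset ℤ) (h : ∀ x ∈ F, x.1 ∈ s) :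
    F.card = ∑ a ∈ s, (slice F a).card := by
  rw [Finset.card_eq_sum_card_fiberwise (f := fun x : ℤ × β => x.1) (t := s) h]
  refine Finset.sum_congr rfl ?_
  intro a _
  rw [slice, Finset.card_image_of_injOn]
  rintro ⟨x1, x2⟩ hx ⟨y1, y2⟩ hy hxy
  simp only [Finset.coe_filter, Set.mem_ofPred_eq] at hx hy hxy
  rw [hx.2, hy.2, hxy]

lemma prime_ne_of_coprime {p k n : ℕ} (hp : p.Prime) (h : p ∣ k) (hc : Nat.Coprime k 6) (hn : n ∣ 6)
    : ¬ p ∣ n := fun h' => by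
  have := Nat.dvd_gcd h (h'.trans hn)
  rw [hc] at this
  exact hp.one_lt.ne' (Nat.dvd_one.1 this)

/-- the set of possible third coefficients -/
lemma card_c {k l : ℕ} (hk : Squarefree k) (h6 : Nat.Coprime k 6) {C : ℝ} (hC : 0 ≤ C)
    (a b : ℤ) (s : Finset ℤ) (hs : ∀ c ∈ s, |(c : ℝ)| ≤ C ∧ ∃ d, Cond k l (a, b, c, d)) :
    (s.card : ℝ) ≤ 2 * C / k + 1 := by
  refine card_class hC (Nat.pos_of_ne_zero hk.ne_zero) (fun c hc => (hs c hc).1) ?_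
  intro c hc c' hc'
  obtain ⟨d, h1, h2, h3, -⟩ := (hs c hc).2
  obtain ⟨d', h1', h2', h3', -⟩ := (hs c' hc').2
  simp only [hP, hQ, hR] at h1 h2 h3 h1' h2' h3'
  apply sqfree_dvd hk
  intro p hp hpk
  have hpk' : (p : ℤ) ∣ k := by exact_mod_cast hpk
  have hpp : Prime (p : ℤ) := Nat.prime_iff_prime_int.1 hp
  have hp3 : ¬ (p : ℤ) ∣ 3 := by
    have := prime_ne_of_coprime hp hpk h6 (n := 3) (by norm_num)
    exact_mod_cast this
  by_cases ha : (p : ℤ) ∣ a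
  · have hb : (p : ℤ) ∣ b := by
      apply hpp.dvd_of_dvd_pow (n := 2)
      have := dvd_add (hpk'.trans h1) (ha.mul_left (3 * c))
      exact dvd_eq this (by ring)
    have hc1 : (p : ℤ) ∣ c := by
      apply hpp.dvd_of_dvd_pow (n := 2)
      have := dvd_add (hpk'.trans h3) (hb.mul_left (3 * d))
      exact dvd_eq this (by ring)
    have hc2 : (p : ℤ) ∣ c' := by
      apply hpp.dvd_of_dvd_pow (n := 2)
      have := dvd_add (hpk'.trans h3') (hb.mul_left (3 * d'))
      exact dvd_eq this (by ring)
    exact dvd_sub hc1 hc2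
  · have := dvd_sub (hpk'.trans h1') (hpk'.trans h1)
    have e : (p : ℤ) ∣ 3 * (a * (c - c')) := by
      exact dvd_eq this (by ring)
    rcases hpp.dvd_or_dvd e with h | h
    · exact absurd h hp3
    · exact (hpp.dvd_or_dvd h).resolve_left ha

lemma div_gcd_facts {m : ℕ} (hm : Squarefree m) (a : ℤ) :
    ∃ n : ℕ, n ∣ m ∧ Squarefree n ∧ (1 / (n : ℝ) = (Int.gcd a m : ℝ) / m) ∧
      ∀ p : ℕ, p.Prime → p ∣ n → ¬ (p : ℤ) ∣ a := by
  have hg : Int.gcd a m ∣ m := by exact_mod_cast Int.gcd_dvd_right a m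
  obtain ⟨n, hn⟩ := hg
  have hm0 := hm.ne_zero
  have hn0 : n ≠ 0 := by rintro rfl; simp at hn; exact hm0 hn
  have hg0 : Int.gcd a m ≠ 0 := by intro h; rw [h, zero_mul] at hn; exact hm0 hn
  refine ⟨n, ⟨_, hn.trans (mul_comm _ _)⟩, hm.squarefree_of_dvd ⟨_, hn.trans (mul_comm _ _)⟩, ?_, ?_⟩
  · have : (m : ℝ) = (Int.gcd a m : ℝ) * n := by exact_mod_cast hn
    have h1 : (n : ℝ) ≠ 0 := by exact_mod_cast hn0
    have h2 : (Int.gcd a m : ℝ) ≠ 0 := by exact_mod_cast hg0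
    conv_rhs => rw [this]
    field_simp
  · intro p hp hpn hpa
    have hpm : p ∣ m := hpn.trans ⟨_, hn.trans (mul_comm _ _)⟩
    have hpg : p ∣ Int.gcd a m := by
      have := Int.dvd_coe_gcd hpa (show (p : ℤ) ∣ m by exact_mod_cast hpm)
      exact_mod_cast this
    have : p * p ∣ m := by rw [hn]; exact mul_dvd_mul hpg hpn
    exact hp.one_lt.ne' (Nat.isUnit_iff.1 (hm p this))

lemma card_primeFactors_le {n m : ℕ} (h : n ∣ m) (hm : m ≠ 0) :
    n.primeFactors.card ≤ m.primeFactors.card :=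
  Finset.card_le_card (Nat.primeFactors_mono h hm)

/-- the set of possible fourth coefficients, `a ≠ 0` -/
lemma card_d {k l : ℕ} (hm : Squarefree (k * l)) (h6 : Nat.Coprime (k * l) 6) {D : ℝ} (hD : 0 ≤ D)
    (a b c : ℤ) (s : Finset ℤ) (hs : ∀ d ∈ s, |(d : ℝ)| ≤ D ∧ Cond k l (a, b, c, d)) :
    (s.card : ℝ) ≤ 2 ^ (k * l).primeFactors.card *
      (2 * D / (k * l : ℕ) * (Int.gcd a (k * l : ℕ) : ℝ) + 1) := by
  obtain ⟨n, hn, hnsq, hn1, hn2⟩ := div_gcd_facts hm a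
  have := card_residues (s := s) hD hnsq (fun d hd => (hs d hd).1) ?_
  · refine this.trans ?_
    have e : 2 * D / n = 2 * D / (k * l : ℕ) * (Int.gcd a (k * l : ℕ) : ℝ) := by
      rw [div_eq_mul_one_div, hn1]; ring
    rw [e]
    have := card_primeFactors_le hn hm.ne_zero
    gcongr
    norm_num
  · intro p hp hpn x hx y hy z hz
    have hpa := hn2 p hp hpn
    have hpm := hpn.trans hn
    have hpp : Prime (p : ℤ) := Nat.prime_iff_prime_int.1 hp
    have hp3 : ¬ (p : ℤ) ∣ 3 := by
      have := prime_ne_of_coprime hp hpm h6 (n := 3) (by norm_num)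
      exact_mod_cast this
    obtain ⟨-, hx2, -, hx4⟩ := (hs x hx).2
    obtain ⟨-, hy2, -, hy4⟩ := (hs y hy).2
    obtain ⟨-, hz2, -, hz4⟩ := (hs z hz).2
    simp only [hQ, disc] at hx2 hx4 hy2 hy4 hz2 hz4
    rcases hp.dvd_mul.1 hpm with h | h
    · left
      have h' : (p : ℤ) ∣ k := by exact_mod_cast h
      have := dvd_sub (h'.trans hy2) (h'.trans hx2)
      have e : (p : ℤ) ∣ 3 * (3 * (a * (x - y))) := by exact dvd_eq this (by ring)
      exact (hpp.dvd_or_dvd ((hpp.dvd_or_dvd ((hpp.dvd_or_dvd e).resolve_left hp3)).resolve_left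
        hp3)).resolve_left hpa
    · have h' : (p : ℤ) ∣ l := by exact_mod_cast h
      by_cases hxy : (p : ℤ) ∣ x - y
      · exact Or.inl hxy
      by_cases hxz : (p : ℤ) ∣ x - z
      · exact Or.inr (Or.inl hxz)
      right; right
      have h1 := dvd_sub (h'.trans hx4) (h'.trans hy4)
      have h2 := dvd_sub (h'.trans hx4) (h'.trans hz4)
      have e1 : (p : ℤ) ∣ (x - y) * (-27 * a ^ 2 * (x + y) + 18 * a * b * c - 4 * b ^ 3) := by
        exact dvd_eq h1 (by ring)
      have e2 : (p : ℤ) ∣ (x - z) * (-27 * a ^ 2 * (x + z) + 18 * a * b * c - 4 * b ^ 3) := by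
        exact dvd_eq h2 (by ring)
      have h3 := dvd_sub ((hpp.dvd_or_dvd e2).resolve_left hxz) ((hpp.dvd_or_dvd e1).resolve_left hxy)
      have e3 : (p : ℤ) ∣ 3 * (3 * (3 * (a * (a * (y - z))))) := by exact dvd_eq h3 (by ring)
      have f1 := (hpp.dvd_or_dvd e3).resolve_left hp3
      have f2 := (hpp.dvd_or_dvd f1).resolve_left hp3
      have f3 := (hpp.dvd_or_dvd f2).resolve_left hp3
      have f4 := (hpp.dvd_or_dvd f3).resolve_left hpa
      exact (hpp.dvd_or_dvd f4).resolve_left hpa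

/-- the set of possible fourth coefficients, `a = 0` -/
lemma card_d0 {k l : ℕ} (hm : Squarefree (k * l)) (h6 : Nat.Coprime (k * l) 6) {D : ℝ} (hD : 0 ≤ D)
    (b c : ℤ) (s : Finset ℤ) (hs : ∀ d ∈ s, |(d : ℝ)| ≤ D ∧ Cond k l (0, b, c, d)) :
    (s.card : ℝ) ≤ 2 ^ (k * l).primeFactors.card *
      (2 * D / l * (Int.gcd b l : ℝ) + 1) := by
  have hl : Squarefree l := hm.squarefree_of_dvd (dvd_mul_left l k)
  obtain ⟨n, hn, hnsq, hn1, hn2⟩ := div_gcd_facts hl b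
  have := card_residues (s := s) hD hnsq (fun d hd => (hs d hd).1) ?_
  · refine this.trans ?_
    have e : 2 * D / n = 2 * D / l * (Int.gcd b l : ℝ) := by
      rw [div_eq_mul_one_div, hn1]; ring
    rw [e]
    have := card_primeFactors_le (hn.trans (dvd_mul_left l k)) hm.ne_zero
    gcongr
    norm_num
  · intro p hp hpn x hx y hy z hz
    have hpb := hn2 p hp hpn
    have hpl := hpn.trans hn
    have hpp : Prime (p : ℤ) := Nat.prime_iff_prime_int.1 hp
    have hp2 : ¬ (p : ℤ) ∣ 2 := by
      have := prime_ne_of_coprime hp (hpl.trans (dvd_mul_left l k)) h6 (n := 2) (by norm_num)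
      exact_mod_cast this
    obtain ⟨-, -, -, hx4⟩ := (hs x hx).2
    obtain ⟨-, -, -, hy4⟩ := (hs y hy).2
    simp only [disc] at hx4 hy4
    left
    have h' : (p : ℤ) ∣ l := by exact_mod_cast hpl
    have := dvd_sub (h'.trans hy4) (h'.trans hx4)
    have e : (p : ℤ) ∣ 2 * (2 * (b * (b * (b * (x - y))))) := by exact dvd_eq this (by ring)
    have f1 := (hpp.dvd_or_dvd e).resolve_left hp2
    have f2 := (hpp.dvd_or_dvd f1).resolve_left hp2
    have f3 := (hpp.dvd_or_dvd f2).resolve_left hpb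
    have f4 := (hpp.dvd_or_dvd f3).resolve_left hpb
    exact (hpp.dvd_or_dvd f4).resolve_left hpb

/-- The arithmetic factor `2^ω(m) d(m)`. -/
def tau (m : ℕ) : ℝ := 2 ^ m.primeFactors.card * (m.divisors.card : ℝ)

lemma card_bcd {k l : ℕ} (hm : Squarefree (k * l)) (h6 : Nat.Coprime (k * l) 6) {C M : ℝ}
    (hC : 0 ≤ C) (a b : ℤ) (G : Finset (ℤ × ℤ)) (hM : 0 ≤ M)
    (hG : ∀ y ∈ G, |(y.1 : ℝ)| ≤ C ∧ Cond k l (a, b, y.1, y.2))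
    (hd : ∀ c, ((slice G c).card : ℝ) ≤ M) :
    (G.card : ℝ) ≤ (2 * C / k + 1) * M := by
  rw [card_slice G (G.image (fun y => y.1)) (fun x hx => Finset.mem_image_of_mem _ hx)]
  push_cast
  calc _ ≤ ∑ c ∈ G.image (fun y => y.1), M := Finset.sum_le_sum (fun c _ => hd c)
    _ = ((G.image (fun y => y.1)).card : ℝ) * M := by rw [Finset.sum_const, nsmul_eq_mul]
    _ ≤ _ := by
      refine mul_le_mul_of_nonneg_right ?_ hM
      refine card_c (l := l) (hm.squarefree_of_dvd (dvd_mul_right k l))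
        (h6.coprime_dvd_left (dvd_mul_right k l)) hC a b _ ?_
      intro c hc
      obtain ⟨y, hy, rfl⟩ := Finset.mem_image.1 hc
      exact ⟨(hG y hy).1, y.2, (hG y hy).2⟩

lemma count_ne {k l : ℕ} (hm : Squarefree (k * l)) (h6 : Nat.Coprime (k * l) 6)
    {A B C D : ℝ} (hA : 0 ≤ A) (hB : 0 ≤ B) (hC : 0 ≤ C) (hD : 0 ≤ D) (F : Finset BCF)
    (hF : ∀ f ∈ F, InBox A B C D f ∧ Cond k l f ∧ f.1 ≠ 0) :
    (F.card : ℝ) ≤ (2 * B + 1) * A * tau (k * l) *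
      ((2 * C / k + 1) * (4 * D / (k * l : ℕ) + 2)) := by
  have hm0 : 0 < k * l := Nat.pos_of_ne_zero hm.ne_zero
  obtain ⟨W, hW⟩ : ∃ W : ℝ, W = (2 : ℝ) ^ (k * l).primeFactors.card := ⟨_, rfl⟩
  have hW0 : 0 ≤ W := by rw [hW]; positivity
  have key : ∀ a b : ℤ, ((slice (slice F a) b).card : ℝ) ≤ (2 * C / k + 1) *
      (W * (2 * D / (k * l : ℕ) * (Int.gcd a (k * l : ℕ) : ℝ) + 1)) := by
    intro a b
    refine card_bcd hm h6 hC a b _ (by positivity) ?_ ?_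
    · rintro ⟨c, d⟩ hy
      rw [mem_slice, mem_slice] at hy
      obtain ⟨⟨-, -, h3, -⟩, h4, -⟩ := hF _ hy
      exact ⟨h3, h4⟩
    · intro c
      rw [hW]
      refine card_d hm h6 hD a b c _ ?_
      intro d hd
      rw [mem_slice, mem_slice, mem_slice] at hd
      obtain ⟨⟨-, -, -, h3⟩, h4, -⟩ := hF _ hd
      exact ⟨h3, h4⟩
  have key2 : ∀ a : ℤ, ((slice F a).card : ℝ) ≤ (2 * B + 1) * ((2 * C / k + 1) *
      (W * (2 * D / (k * l : ℕ) * (Int.gcd a (k * l : ℕ) : ℝ) + 1))) := by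
    intro a
    rw [card_slice (slice F a) (Finset.Icc (-⌊B⌋) ⌊B⌋) (by
      rintro ⟨b, y⟩ hy
      rw [mem_slice] at hy
      rw [mem_Icc_floor]
      exact (hF _ hy).1.2.1)]
    rw [Nat.cast_sum]
    refine (Finset.sum_le_sum (fun b _ => key a b)).trans ?_
    rw [Finset.sum_const, nsmul_eq_mul]
    refine mul_le_mul_of_nonneg_right ?_ ?_
    swap
    · positivity
    have := card_class (s := Finset.Icc (-⌊B⌋) ⌊B⌋) hB (n := 1) Nat.one_pos
      (fun x hx => mem_Icc_floor.1 hx) (by intro x _ y _; simp)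
    simpa using this
  rw [card_slice F (nz A) (by
      rintro ⟨a, y⟩ hy
      rw [mem_nz]
      exact ⟨(hF _ hy).2.2, (hF _ hy).1.1⟩)]
  push_cast
  refine (Finset.sum_le_sum (fun a _ => key2 a)).trans ?_
  obtain ⟨N, hN⟩ : ∃ N : ℝ, N = ((k * l : ℕ) : ℝ) := ⟨_, rfl⟩
  have e1 : (nz A).filter (fun a => ((1 : ℕ) : ℤ) ∣ a) = nz A := by
    apply Finset.filter_true_of_mem; simp
  have s1 := sum_gcd_nz hA one_pos hm0 (Nat.coprime_one_left _)
  have s2 := card_nz_dvd hA one_pos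
  rw [e1] at s1 s2
  have hd1 : (1 : ℝ) ≤ ((k * l).divisors.card : ℝ) := by
    exact_mod_cast Finset.card_pos.2 ⟨1, Nat.one_mem_divisors.2 hm0.ne'⟩
  have s3 : ((nz A).card : ℝ) ≤ 2 * A * ((k * l).divisors.card : ℝ) := by
    refine s2.trans ?_
    simp only [Nat.cast_one, div_one]
    nlinarith
  simp only [Nat.cast_one, div_one] at s1
  rw [← Finset.mul_sum, ← Finset.mul_sum, ← Finset.mul_sum, Finset.sum_add_distrib,
    ← Finset.mul_sum]
  simp only [Finset.sum_const, nsmul_eq_mul, mul_one]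
  rw [tau, ← hW]
  calc _ ≤ (2 * B + 1) * ((2 * C / k + 1) * (W * (2 * D / (k * l : ℕ) *
        (2 * A * ((k * l).divisors.card : ℝ)) + 2 * A * ((k * l).divisors.card : ℝ)))) := by
        gcongr
    _ = _ := by rw [Nat.cast_mul]; ring

lemma count_zero {k l : ℕ} (hm : Squarefree (k * l)) (h6 : Nat.Coprime (k * l) 6)
    {A B C D : ℝ} (hB : 0 ≤ B) (hC : 0 ≤ C) (hD : 0 ≤ D) (F : Finset BCF)
    (hF : ∀ f ∈ F, InBox A B C D f ∧ Cond k l f ∧ f.1 = 0 ∧ f.2.1 ≠ 0) :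
    (F.card : ℝ) ≤ B * tau (k * l) *
      ((2 * C / k + 1) * (4 * D / (k * l : ℕ) + 2)) := by
  have hm0 : 0 < k * l := Nat.pos_of_ne_zero hm.ne_zero
  have hk0 : 0 < k := Nat.pos_of_ne_zero (by rintro rfl; simp at hm0)
  have hl0 : 0 < l := Nat.pos_of_ne_zero (by rintro rfl; simp at hm0)
  have hk1 : (1 : ℝ) ≤ k := by exact_mod_cast hk0
  obtain ⟨W, hW⟩ : ∃ W : ℝ, W = (2 : ℝ) ^ (k * l).primeFactors.card := ⟨_, rfl⟩
  have hW0 : 0 ≤ W := by rw [hW]; positivity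
  have key : ∀ b : ℤ, ((slice (slice F 0) b).card : ℝ) ≤ (2 * C / k + 1) *
      (W * (2 * D / l * (Int.gcd b l : ℝ) + 1)) := by
    intro b
    refine card_bcd hm h6 hC 0 b _ (by positivity) ?_ ?_
    · rintro ⟨c, d⟩ hy
      rw [mem_slice, mem_slice] at hy
      obtain ⟨⟨-, -, h3, -⟩, h4, -⟩ := hF _ hy
      exact ⟨h3, h4⟩
    · intro c
      rw [hW]
      refine card_d0 hm h6 hD b c _ ?_
      intro d hd
      rw [mem_slice, mem_slice, mem_slice] at hd
      obtain ⟨⟨-, -, -, h3⟩, h4, -⟩ := hF _ hd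
      exact ⟨h3, h4⟩
  rw [card_slice F {0} (by
      intro f hf
      rw [Finset.mem_singleton]
      exact (hF _ hf).2.2.1), Finset.sum_singleton]
  rw [card_slice (slice F 0) ((nz B).filter (fun b => (k : ℤ) ∣ b)) (by
      rintro ⟨b, y⟩ hy
      rw [mem_slice] at hy
      rw [Finset.mem_filter, mem_nz]
      refine ⟨⟨(hF _ hy).2.2.2, (hF _ hy).1.2.1⟩, ?_⟩
      apply sqfree_dvd (hm.squarefree_of_dvd (dvd_mul_right k l))
      intro p hp hpk
      have h1 := (hF _ hy).2.1.1
      simp only [hP] at h1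
      have hpk' : (p : ℤ) ∣ k := by exact_mod_cast hpk
      have h2 := hpk'.trans h1
      have e : b ^ 2 - 3 * 0 * y.1 = b ^ 2 := by ring
      rw [e] at h2
      exact (Nat.prime_iff_prime_int.1 hp).dvd_of_dvd_pow h2)]
  push_cast
  refine (Finset.sum_le_sum (fun b _ => key b)).trans ?_
  have hcop : Nat.Coprime k l := Nat.coprime_of_squarefree_mul hm
  have s1 := sum_gcd_nz hB hk0 hl0 hcop
  have s2 := card_nz_dvd hB hk0
  have hd0 : (l.divisors.card : ℝ) ≤ ((k * l).divisors.card : ℝ) := by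
    exact_mod_cast Finset.card_le_card (Nat.divisors_subset_of_dvd hm0.ne' (dvd_mul_left l k))
  have hd1 : (1 : ℝ) ≤ ((k * l).divisors.card : ℝ) := by
    exact_mod_cast Finset.card_pos.2 ⟨1, Nat.one_mem_divisors.2 hm0.ne'⟩
  rw [← Finset.mul_sum, ← Finset.mul_sum, Finset.sum_add_distrib, ← Finset.mul_sum]
  simp only [Finset.sum_const, nsmul_eq_mul, mul_one]
  rw [tau, ← hW]
  obtain ⟨d, hd⟩ : ∃ d : ℝ, d = ((k * l).divisors.card : ℝ) := ⟨_, rfl⟩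
  rw [← hd] at hd0 hd1 ⊢
  have t1 : 2 * B * (l.divisors.card : ℝ) / k ≤ 2 * B * d / k := by gcongr
  have t2 : 2 * B / k ≤ 2 * B * d := by
    calc 2 * B / k ≤ 2 * B / 1 := by gcongr
      _ = 2 * B * 1 := by ring
      _ ≤ _ := by gcongr
  calc _ ≤ (2 * C / k + 1) * (W * (2 * D / l * (2 * B * d / k) + 2 * B * d)) := by
        gcongr
        · exact s1.trans t1
        · exact s2.trans t2
    _ = _ := by push_cast; field_simp; ring

end BCF

namespace BCF

lemma sum_two_pow_le (X : ℝ) (hX : 0 ≤ X) (J : ℕ) :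
    (∑ j ∈ Finset.range J, if (2 : ℝ) ^ j ≤ X then (2 : ℝ) ^ j else 0) ≤ 2 * X ∧
    (∑ j ∈ Finset.range J, if (2 : ℝ) ^ j ≤ X then (2 : ℝ) ^ j else 0) ≤ 2 ^ J - 1 := by
  induction J with
  | zero => simp [hX]
  | succ J ih =>
    obtain ⟨h1, h2⟩ := ih
    rw [Finset.sum_range_succ, pow_succ]
    have : (1 : ℝ) ≤ 2 ^ J := one_le_pow₀ (by norm_num)
    split_ifs with h
    · constructor <;> linarith
    · constructor <;> linarith

lemma sum_quarter_le (J : ℕ) : (∑ j ∈ Finset.range J, 1 / (4 : ℝ) ^ j) ≤ 2 := by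
  have : (∑ j ∈ Finset.range J, 1 / (4 : ℝ) ^ j) ≤ 2 - 2 * (1 / 4 ^ J) := by
    induction J with
    | zero => norm_num
    | succ J ih =>
      rw [Finset.sum_range_succ]
      have : (0 : ℝ) < 1 / 4 ^ J := by positivity
      have e : (1 : ℝ) / 4 ^ (J + 1) = 1 / 4 ^ J / 4 := by rw [pow_succ]; field_simp
      rw [e]
      linarith
  have h : (0 : ℝ) < 1 / 4 ^ J := by positivity
  linarith

lemma act_uni_inj {g : BCF} (hg : disc g ≠ 0) {n n' : ℤ} (h : act (uni n) g = act (uni n') g) :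
    n = n' := by
  obtain ⟨a, b, c, d⟩ := g
  rw [act_uni, act_uni] at h
  simp only [Prod.mk.injEq] at h
  obtain ⟨-, h2, h3, -⟩ := h
  by_cases ha : a = 0
  · subst ha
    by_cases hb : b = 0
    · subst hb
      simp [disc] at hg
    · have : b * (n - n') = 0 := by linarith
      rcases mul_eq_zero.1 this with h | h
      · exact absurd h hb
      · linarith
  · have : a * (n - n') = 0 := by linarith
    rcases mul_eq_zero.1 this with h | h
    · exact absurd h ha
    · linarith

lemma tau_nonneg (m : ℕ) : 0 ≤ tau m := by unfold tau; positivity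

/-- Counting classes with congruence conditions. -/
theorem count_classes {k l : ℕ} (hm : Squarefree (k * l)) (h6 : Nat.Coprime (k * l) 6)
    {lam rho : ℝ} (hlam : 0 < lam) (hrho : 0 ≤ rho)
    (hR : ∀ C D : ℝ, lam ≤ C → lam ≤ D →
      (2 * C / k + 1) * (4 * D / (k * l : ℕ) + 2) ≤ 18 * C * D * rho)
    (S : Finset BCF) (hS : ∀ f ∈ S, disc f ≠ 0 ∧ |(disc f : ℝ)| ≤ lam ^ 4 ∧ Cond k l f)
    (hinj : ∀ f ∈ S, ∀ g ∈ S, SLeq f g → f = g) :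
    (S.card : ℝ) ≤ 144 * 832 ^ 4 * tau (k * l) * lam ^ 4 * rho := by
  have hex : ∀ f : BCF, ∃ γ : Matrix (Fin 2) (Fin 2) ℤ, ∃ j : ℕ, f ∈ S → γ.det = 1 ∧
      ∀ n : ℕ, n < 4 ^ j → InBox (832 * lam / (2 ^ j) ^ 3) (832 * lam / 2 ^ j)
        (832 * lam * 2 ^ j) (832 * lam * (2 ^ j) ^ 3) (act (uni n) (act γ f)) := by
    intro f
    by_cases hf : f ∈ S
    · obtain ⟨γ, h1, j, h2⟩ := exists_dyadic f (hS f hf).1 lam hlam (hS f hf).2.1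
      exact ⟨γ, j, fun _ => ⟨h1, h2⟩⟩
    · exact ⟨1, 0, fun h => absurd h hf⟩
  choose γ j hγ using hex
  obtain ⟨K, hK⟩ : ∃ K : ℝ, K = 832 := ⟨_, rfl⟩
  have hK1 : 1 ≤ K := by rw [hK]; norm_num
  rw [← hK] at hγ ⊢
  obtain ⟨T, hT⟩ : ∃ T : ℝ, T = tau (k * l) := ⟨_, rfl⟩
  have hT0 : 0 ≤ T := by rw [hT]; exact tau_nonneg _
  rw [← hT]
  have hmain : ∀ i : ℕ, ((S.filter (fun f => j f = i)).card : ℝ) ≤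
      54 * K ^ 4 * lam ^ 4 * T * rho * (1 / 4 ^ i) +
      18 * K ^ 3 * lam ^ 3 * T * rho *
        (if (2 : ℝ) ^ i ≤ K * lam then (2 : ℝ) ^ i else 0) := by
    intro i
    obtain ⟨t, ht⟩ : ∃ t : ℝ, t = 2 ^ i := ⟨_, rfl⟩
    have ht1 : 1 ≤ t := by rw [ht]; exact one_le_pow₀ (by norm_num)
    have ht0 : 0 < t := by linarith
    have ht4 : (4 : ℝ) ^ i = t ^ 2 := by
      rw [ht, ← pow_mul, mul_comm, pow_mul]; norm_num
    obtain ⟨P, hPdef⟩ : ∃ P, P = (S.filter (fun f => j f = i)) ×ˢ (Finset.range (4 ^ i)) := ⟨_, rfl⟩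
    let φ : BCF × ℕ → BCF := fun q => act (uni q.2) (act (γ q.1) q.1)
    have hφinj : Set.InjOn φ P := by
      rintro ⟨f, n⟩ hf ⟨g, n'⟩ hg heq
      simp only [hPdef, Finset.coe_product, Set.mem_prod, Finset.mem_coe, Finset.mem_filter] at hf hg
      have hfS := hf.1.1
      have hgS := hg.1.1
      simp only [φ] at heq
      have e : f = g := by
        apply hinj f hfS g hgS
        have e1 : SLeq f (act (uni n) (act (γ f) f)) :=
          SLeq_trans ⟨γ f, (hγ f hfS).1, rfl⟩ ⟨uni n, uni_det _, rfl⟩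
        have e2 : SLeq g (act (uni n') (act (γ g) g)) :=
          SLeq_trans ⟨γ g, (hγ g hgS).1, rfl⟩ ⟨uni n', uni_det _, rfl⟩
        rw [heq] at e1
        exact SLeq_trans e1 (SLeq_symm e2)
      subst e
      have hd : disc (act (γ f) f) ≠ 0 := by
        rw [disc_act, (hγ f hfS).1]; simpa using (hS f hfS).1
      have := act_uni_inj hd heq
      rw [Prod.mk.injEq]
      exact ⟨rfl, by exact_mod_cast this⟩
    obtain ⟨F, hF⟩ : ∃ F, F = P.image φ := ⟨_, rfl⟩
    have hFcard : (F.card : ℝ) = ((S.filter (fun f => j f = i)).card : ℝ) * t ^ 2 := by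
      rw [hF, Finset.card_image_of_injOn hφinj, hPdef, Finset.card_product, Finset.card_range]
      push_cast
      rw [ht4]
    have hFp : ∀ f ∈ F, InBox (K * lam / t ^ 3) (K * lam / t) (K * lam * t) (K * lam * t ^ 3) f ∧
        Cond k l f ∧ disc f ≠ 0 := by
      intro f hf
      rw [hF] at hf
      obtain ⟨⟨g, n⟩, hq, rfl⟩ := Finset.mem_image.1 hf
      rw [hPdef, Finset.mem_product, Finset.mem_filter, Finset.mem_range] at hq
      obtain ⟨⟨hgS, hj⟩, hn⟩ := hq
      simp only at hgS hj hn
      have h2 := (hγ g hgS).2 n (by rw [hj]; exact hn)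
      rw [hj, ← ht] at h2
      refine ⟨h2, Cond_act _ (Cond_act _ (hS g hgS).2.2), ?_⟩
      simp only [φ]
      rw [disc_act, disc_act, uni_det, (hγ g hgS).1]
      simpa using (hS g hgS).1
    have hC : lam ≤ K * lam * t := by
      have : 1 * lam * 1 ≤ K * lam * t := by gcongr
      linarith
    have hD : lam ≤ K * lam * t ^ 3 := by
      have h3 : (1 : ℝ) ≤ t ^ 3 := one_le_pow₀ ht1
      have : 1 * lam * 1 ≤ K * lam * t ^ 3 := by gcongr
      linarith
    have hr := hR _ _ hC hD
    have c1 := count_ne hm h6 (A := K * lam / t ^ 3) (B := K * lam / t) (C := K * lam * t)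
      (D := K * lam * t ^ 3) (by positivity) (by positivity) (by positivity) (by positivity)
      (F.filter (fun f => f.1 ≠ 0)) (by
        intro f hf
        obtain ⟨h1, h2⟩ := Finset.mem_filter.1 hf
        exact ⟨(hFp f h1).1, (hFp f h1).2.1, h2⟩)
    have c2 := count_zero hm h6 (A := K * lam / t ^ 3) (B := K * lam / t) (C := K * lam * t)
      (D := K * lam * t ^ 3) (by positivity) (by positivity) (by positivity)
      (F.filter (fun f => ¬ f.1 ≠ 0)) (by
        intro f hf
        obtain ⟨h1, h2⟩ := Finset.mem_filter.1 hf
        push Not at h2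
        refine ⟨(hFp f h1).1, (hFp f h1).2.1, h2, ?_⟩
        intro h3
        apply (hFp f h1).2.2
        simp [disc, h2, h3])
    rw [← hT] at c1 c2
    have hsplit : (F.card : ℝ) = ((F.filter (fun f => f.1 ≠ 0)).card : ℝ) +
        ((F.filter (fun f => ¬ f.1 ≠ 0)).card : ℝ) := by
      exact_mod_cast (Finset.card_filter_add_card_filter_not (s := F) (fun f => f.1 ≠ 0)).symm
    have d1 : ((F.filter (fun f => f.1 ≠ 0)).card : ℝ) ≤ 54 * K ^ 4 * lam ^ 4 * T * rho := by
      rcases (F.filter (fun f => f.1 ≠ 0)).eq_empty_or_nonempty with h | ⟨f, hf⟩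
      · rw [h]; simp; positivity
      · obtain ⟨h1, h2⟩ := Finset.mem_filter.1 hf
        have hA : 1 ≤ K * lam / t ^ 3 := by
          refine le_trans ?_ (hFp f h1).1.1
          exact_mod_cast Int.one_le_abs h2
        have hAB : K * lam / t ^ 3 ≤ K * lam / t := by
          gcongr
          exact le_self_pow₀ ht1 (by norm_num)
        calc _ ≤ _ := c1
          _ ≤ (3 * (K * lam / t)) * (K * lam / t ^ 3) * T *
              (18 * (K * lam * t) * (K * lam * t ^ 3) * rho) := by
              gcongr
              linarith
          _ = _ := by field_simp; ring
    have d2 : ((F.filter (fun f => ¬ f.1 ≠ 0)).card : ℝ) ≤ 18 * K ^ 3 * lam ^ 3 * T * rho *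
        (t ^ 2 * (if t ≤ K * lam then t else 0)) := by
      rcases (F.filter (fun f => ¬ f.1 ≠ 0)).eq_empty_or_nonempty with h | ⟨f, hf⟩
      · rw [h]
        have : 0 ≤ (if t ≤ K * lam then t else 0) := by split_ifs <;> linarith
        simp only [Finset.card_empty, Nat.cast_zero]
        positivity
      · obtain ⟨h1, h2⟩ := Finset.mem_filter.1 hf
        push Not at h2
        have hb : f.2.1 ≠ 0 := by
          intro h3
          apply (hFp f h1).2.2
          simp [disc, h2, h3]
        have hB : 1 ≤ K * lam / t := by
          refine le_trans ?_ (hFp f h1).1.2.1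
          exact_mod_cast Int.one_le_abs hb
        have hB' : t ≤ K * lam := by
          rw [le_div_iff₀ ht0] at hB; linarith
        rw [if_pos hB']
        calc _ ≤ _ := c2
          _ ≤ (K * lam / t) * T *
              (18 * (K * lam * t) * (K * lam * t ^ 3) * rho) := by
              gcongr
          _ = _ := by field_simp
    rw [ht4, ← ht]
    have hfin : ((S.filter (fun f => j f = i)).card : ℝ) * t ^ 2 ≤
        (54 * K ^ 4 * lam ^ 4 * T * rho * (1 / t ^ 2) + 18 * K ^ 3 * lam ^ 3 * T * rho *
        (if t ≤ K * lam then t else 0)) * t ^ 2 := by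
      rw [← hFcard, hsplit]
      refine (add_le_add d1 d2).trans (le_of_eq ?_)
      field_simp
    exact le_of_mul_le_mul_right hfin (by positivity)
  obtain ⟨J, hJ⟩ : ∃ J : ℕ, ∀ f ∈ S, j f < J := by
    refine ⟨S.sup j + 1, fun f hf => Nat.lt_succ_of_le (Finset.le_sup hf)⟩
  rw [Finset.card_eq_sum_card_fiberwise (f := j) (t := Finset.range J)
    (fun f hf => by simpa using hJ f hf)]
  rw [Nat.cast_sum]
  refine (Finset.sum_le_sum (fun i _ => hmain i)).trans ?_
  rw [Finset.sum_add_distrib, ← Finset.mul_sum, ← Finset.mul_sum]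
  have s1 := sum_quarter_le J
  have s2 := (sum_two_pow_le (K * lam) (by positivity) J).1
  calc _ ≤ 54 * K ^ 4 * lam ^ 4 * T * rho * 2 + 18 * K ^ 3 * lam ^ 3 * T * rho * (2 * (K * lam)) := by
        gcongr
    _ = _ := by ring

/-- the absolute constant -/
def K0 : ℝ := 144 * 832 ^ 4

lemma Cond_sq {k l : ℕ} (h6 : Nat.Coprime k 6) {f : BCF} (h : Cond k l f) :
    ((k : ℤ) ^ 2) ∣ disc f := by
  obtain ⟨h1, h2, h3, -⟩ := h
  have : (k : ℤ) ^ 2 ∣ 3 * disc f := by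
    rw [← hess_disc]
    refine dvd_sub ?_ (pow_dvd_pow_of_dvd h2 2)
    rw [pow_two, mul_assoc]
    exact (mul_dvd_mul h1 h3).mul_left 4
  refine IsCoprime.dvd_of_dvd_mul_left ?_ this
  apply IsCoprime.pow_left
  have : Nat.Coprime k 3 := h6.coprime_dvd_right (by norm_num)
  exact_mod_cast Nat.isCoprime_iff_coprime.2 this

theorem count_M1 {k l : ℕ} (hm : Squarefree (k * l)) (h6 : Nat.Coprime (k * l) 6) {Y : ℝ}
    (S : Finset BCF) (hS : ∀ f ∈ S, disc f ≠ 0 ∧ |(disc f : ℝ)| ≤ Y ∧ Cond k l f)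
    (hinj : ∀ f ∈ S, ∀ g ∈ S, SLeq f g → f = g) (hY : 0 ≤ Y) :
    (S.card : ℝ) ≤ K0 * tau k * (Y / k) := by
  have hk : Squarefree k := hm.squarefree_of_dvd (dvd_mul_right k l)
  have h6k : Nat.Coprime k 6 := h6.coprime_dvd_left (dvd_mul_right k l)
  have hk0 : 0 < k := Nat.pos_of_ne_zero hk.ne_zero
  have hk1 : (1 : ℝ) ≤ k := by exact_mod_cast hk0
  rcases S.eq_empty_or_nonempty with rfl | ⟨f, hf⟩
  · simp only [Finset.card_empty, Nat.cast_zero]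
    have := tau_nonneg k
    unfold K0
    positivity
  have hYk : (k : ℝ) ^ 2 ≤ Y := by
    refine le_trans ?_ (hS f hf).2.1
    have := Int.le_of_dvd (abs_pos.2 (hS f hf).1) ((dvd_abs _ _).2 (Cond_sq h6k (hS f hf).2.2))
    exact_mod_cast this
  have hY0 : 0 < Y := by nlinarith
  obtain ⟨lam, hlam⟩ : ∃ lam : ℝ, lam = Real.sqrt (Real.sqrt Y) := ⟨_, rfl⟩
  have hl2 : lam ^ 2 = Real.sqrt Y := by rw [hlam, Real.sq_sqrt (Real.sqrt_nonneg _)]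
  have hl4 : lam ^ 4 = Y := by
    have : lam ^ 4 = (lam ^ 2) ^ 2 := by ring
    rw [this, hl2, Real.sq_sqrt hY]
  have hlk : (k : ℝ) ≤ lam ^ 2 := by
    rw [hl2]; exact Real.le_sqrt_of_sq_le hYk
  have hl0 : 0 < lam := by rw [hlam]; positivity
  have hl1 : 1 ≤ lam := by nlinarith
  have := count_classes (k := k) (l := 1) (lam := lam) (rho := 1 / k) (by simpa using hk)
    (by simpa using h6k) hl0 (by positivity) ?_ S ?_ hinj
  · rw [mul_one, hl4] at this
    refine this.trans (le_of_eq ?_)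
    unfold K0; ring
  · intro C D hC hD
    have hD1 : 1 ≤ D := hl1.trans hD
    have hC1 : 1 ≤ C := hl1.trans hC
    have hCD : (k : ℝ) ≤ C * D := by nlinarith
    rw [mul_one]
    have e : 18 * C * D * (1 / (k : ℝ)) - (2 * C / k + 1) * (4 * D / k + 2) =
      (8 * (C * D) * (k - 1) + 4 * C * (D - 1) * k + 4 * D * (C - 1) * k + 2 * (C * D - k) * k)
        / k ^ 2 := by
      field_simp; ring
    have : 0 ≤ (8 * (C * D) * (k - 1) + 4 * C * (D - 1) * k + 4 * D * (C - 1) * k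
        + 2 * (C * D - k) * k) / (k : ℝ) ^ 2 := by
      have q1 : 0 ≤ (k : ℝ) - 1 := by linarith
      have q2 : 0 ≤ D - 1 := by linarith
      have q3 : 0 ≤ C - 1 := by linarith
      have q4 : 0 ≤ C * D - k := by linarith
      positivity
    linarith
  · intro f hf
    obtain ⟨h1, h2, h3, h4, h5, -⟩ := hS f hf
    rw [hl4]
    exact ⟨h1, h2, h3, h4, h5, by simp⟩

theorem count_M2 {k l : ℕ} (hm : Squarefree (k * l)) (h6 : Nat.Coprime (k * l) 6) {Y : ℝ}
    (S : Finset BCF) (hS : ∀ f ∈ S, disc f ≠ 0 ∧ |(disc f : ℝ)| ≤ Y ∧ Cond k l f)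
    (hinj : ∀ f ∈ S, ∀ g ∈ S, SLeq f g → f = g) (hY : 0 ≤ Y) :
    (S.card : ℝ) ≤ K0 * tau (k * l) * (Y / (k ^ 2 * l) + k ^ 2 * l ^ 3) := by
  have hm0 : 0 < k * l := Nat.pos_of_ne_zero hm.ne_zero
  have hk0 : 0 < k := Nat.pos_of_ne_zero (by rintro rfl; simp at hm0)
  have hl0' : 0 < l := Nat.pos_of_ne_zero (by rintro rfl; simp at hm0)
  have hk1 : (1 : ℝ) ≤ k := by exact_mod_cast hk0
  have hll1 : (1 : ℝ) ≤ l := by exact_mod_cast hl0'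
  obtain ⟨Z, hZ⟩ : ∃ Z : ℝ, Z = Y + (k * l) ^ 4 := ⟨_, rfl⟩
  have hZ0 : 0 < Z := by rw [hZ]; positivity
  obtain ⟨lam, hlam⟩ : ∃ lam : ℝ, lam = Real.sqrt (Real.sqrt Z) := ⟨_, rfl⟩
  have hl2 : lam ^ 2 = Real.sqrt Z := by rw [hlam, Real.sq_sqrt (Real.sqrt_nonneg _)]
  have hl4 : lam ^ 4 = Z := by
    have : lam ^ 4 = (lam ^ 2) ^ 2 := by ring
    rw [this, hl2, Real.sq_sqrt hZ0.le]
  have hl0 : 0 < lam := by rw [hlam]; positivity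
  have hlk : (k : ℝ) * l ≤ lam := by
    by_contra hcon
    push Not at hcon
    have : lam ^ 4 < ((k : ℝ) * l) ^ 4 := by gcongr
    rw [hl4, hZ] at this
    linarith
  have := count_classes (k := k) (l := l) (lam := lam) (rho := 1 / (k ^ 2 * l)) hm h6 hl0
    (by positivity) ?_ S ?_ hinj
  · rw [hl4, hZ] at this
    refine this.trans (le_of_eq ?_)
    unfold K0; field_simp
  · intro C D hC hD
    have hCk : 1 ≤ C / k := by
      rw [le_div_iff₀ (by positivity)]; nlinarith
    have hDm : 1 ≤ D / (k * l : ℕ) := by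
      rw [le_div_iff₀ (by positivity)]; push_cast; linarith
    have hC0 : 0 < C := by linarith
    have hD0 : 0 < D := by linarith
    calc (2 * C / k + 1) * (4 * D / (k * l : ℕ) + 2)
        = (2 * (C / k) + 1) * (4 * (D / (k * l : ℕ)) + 2) := by ring
      _ ≤ (3 * (C / k)) * (6 * (D / (k * l : ℕ))) := by
          gcongr <;> linarith
      _ = _ := by push_cast; field_simp; ring
  · intro f hf
    obtain ⟨h1, h2, h3⟩ := hS f hf
    refine ⟨h1, ?_, h3⟩
    rw [hl4, hZ]
    refine h2.trans ?_
    have : (0 : ℝ) ≤ (k * l) ^ 4 := by positivity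
    linarith

end BCF

namespace BCF

/-- Scalar multiple of a form. -/
def smulF (c : ℤ) (f : BCF) : BCF := (c * f.1, c * f.2.1, c * f.2.2.1, c * f.2.2.2)

/-- The form `f(m u, v)`. -/
def stretch (m : ℤ) (f : BCF) : BCF := (m ^ 3 * f.1, m ^ 2 * f.2.1, m * f.2.2.1, f.2.2.2)

lemma act_smulF (γ : Matrix (Fin 2) (Fin 2) ℤ) (c : ℤ) (f : BCF) :
    act γ (smulF c f) = smulF c (act γ f) := by
  simp only [act, smulF, Prod.mk.injEq]
  refine ⟨?_, ?_, ?_, ?_⟩ <;> ring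

lemma smulF_inj {c : ℤ} (hc : c ≠ 0) {f g : BCF} (h : smulF c f = smulF c g) : f = g := by
  obtain ⟨a, b, c', d⟩ := f
  obtain ⟨a', b', c'', d'⟩ := g
  simp only [smulF, Prod.mk.injEq, mul_right_inj' hc] at h ⊢
  exact h

lemma act_stretch (m α g β δ : ℤ) (f : BCF) :
    act !![α, g * m; β, δ] (stretch m f) = stretch m (act !![α, g; m * β, δ] f) := by
  simp only [act, stretch, Matrix.det_fin_two, Matrix.of_apply, Matrix.cons_val', Matrix.cons_val_zero,
    Matrix.cons_val_one, Matrix.cons_val_fin_one, Prod.mk.injEq]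
  refine ⟨?_, ?_, ?_, ?_⟩ <;> ring

lemma disc_smulF (c : ℤ) (f : BCF) : disc (smulF c f) = c ^ 4 * disc f := by
  simp only [disc, smulF]; ring

lemma disc_stretch (c : ℤ) (f : BCF) : disc (stretch c f) = c ^ 6 * disc f := by
  simp only [disc, stretch]; ring

/-- The special root modulo `p` is preserved. -/
lemma root_preserved {p : ℕ} (hp : p.Prime) {a b a' b' c d c' d' : ℤ}
    {σ : Matrix (Fin 2) (Fin 2) ℤ} (hσ : σ.det = 1)
    (h : act σ (a, b, c, d) = (a', b', c', d'))
    (hc : (p : ℤ) ∣ c) (hd : (p : ℤ) ∣ d) (hc' : (p : ℤ) ∣ c') (hd' : (p : ℤ) ∣ d')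
    (hab : ¬ ((p : ℤ) ∣ a ∧ (p : ℤ) ∣ b)) : (p : ℤ) ∣ σ 1 0 := by
  have hpp : Prime (p : ℤ) := Nat.prime_iff_prime_int.1 hp
  simp only [act, hσ, one_mul, Prod.mk.injEq] at h
  rw [Matrix.det_fin_two] at hσ
  obtain ⟨-, -, h3, h4⟩ := h
  obtain ⟨α, hα⟩ : ∃ α, α = σ 0 0 := ⟨_, rfl⟩
  obtain ⟨g, hg⟩ : ∃ α, α = σ 0 1 := ⟨_, rfl⟩
  obtain ⟨β, hβ⟩ : ∃ α, α = σ 1 0 := ⟨_, rfl⟩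
  obtain ⟨δ, hδ⟩ : ∃ α, α = σ 1 1 := ⟨_, rfl⟩
  simp only [← hα, ← hg, ← hβ, ← hδ] at h3 h4 hσ
  rw [← hβ]
  by_contra hcon
  apply hab
  have e1 : (p : ℤ) ∣ β * (β * (a * β + b * δ)) := by
    refine dvd_eq (dvd_sub hd' (dvd_add (hc.mul_right (β * δ ^ 2)) (hd.mul_right (δ ^ 3)))) ?_
    rw [← h4]; ring
  have e2 := (hpp.dvd_or_dvd ((hpp.dvd_or_dvd e1).resolve_left hcon)).resolve_left hcon
  have e3 : (p : ℤ) ∣ β * (3 * a * α * β + b * (2 * α * δ + β * g)) := by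
    refine dvd_eq (dvd_sub hc' (dvd_add (hc.mul_right (α * δ ^ 2 + 2 * β * g * δ))
      (hd.mul_right (3 * g * δ ^ 2)))) ?_
    rw [← h3]; ring
  have e4 := (hpp.dvd_or_dvd e3).resolve_left hcon
  have e5 : (p : ℤ) ∣ b := by
    refine dvd_eq (dvd_sub (e2.mul_right (3 * α)) e4) ?_
    linear_combination (-b) * hσ
  refine ⟨?_, e5⟩
  have e6 : (p : ℤ) ∣ a * β := dvd_eq (dvd_sub e2 (e5.mul_right δ)) (by ring)
  exact (hpp.dvd_or_dvd e6).resolve_right hcon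

lemma tau_mono {m n : ℕ} (h : m ∣ n) (hn : n ≠ 0) : tau m ≤ tau n := by
  unfold tau
  have h1 := card_primeFactors_le h hn
  have h2 : (m.divisors.card : ℝ) ≤ n.divisors.card := by
    exact_mod_cast Finset.card_le_card (Nat.divisors_subset_of_dvd hn h)
  gcongr
  norm_num

/-- The shape attached to a tuple. -/
def Shape (A B C D E : ℕ) (x : BCF) : Prop :=
  ∃ γ : Matrix (Fin 2) (Fin 2) ℤ, γ.det = 1 ∧ ∃ a b c d : ℤ,
    act γ x = ((A ^ 2 * B : ℤ) * (C ^ 2 * D ^ 2 * E ^ 3 * a), (A ^ 2 * B : ℤ) * (C ^ 2 * D * E ^ 2 * b),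
      (A ^ 2 * B : ℤ) * (C * D * E * c), (A ^ 2 * B : ℤ) * d) ∧
    (∀ p : ℕ, p.Prime → p ∣ C → ¬ (p : ℤ) ∣ a) ∧
    (∀ p : ℕ, p.Prime → p ∣ D → ¬ ((p : ℤ) ∣ a ∧ (p : ℤ) ∣ b))

lemma tuple_fibre {A B C D E : ℕ} (hsq : Squarefree (A * B * C * D * E))
    {X : ℝ} (S : Finset BCF)
    (hS : ∀ x ∈ S, disc x ≠ 0 ∧ |(disc x : ℝ)| ≤ X ∧ Shape A B C D E x)
    (hinj : ∀ x ∈ S, ∀ y ∈ S, SLeq x y → x = y) :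
    ∃ T : Finset BCF, (∀ f ∈ T, disc f ≠ 0 ∧
        |(disc f : ℝ)| ≤ X / (A ^ 8 * B ^ 4 * C ^ 2 * D ^ 2 * E ^ 6) ∧ Cond C D f) ∧
      (∀ f ∈ T, ∀ g ∈ T, SLeq f g → f = g) ∧ S.card ≤ T.card * E ^ 2 := by
  have hne := hsq.ne_zero
  simp only [mul_ne_zero_iff] at hne
  obtain ⟨⟨⟨⟨hA, hB⟩, hC⟩, hD⟩, hE⟩ := hne
  have hAz : (A : ℤ) ≠ 0 := by exact_mod_cast hA
  have hBz : (B : ℤ) ≠ 0 := by exact_mod_cast hB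
  have hCz : (C : ℤ) ≠ 0 := by exact_mod_cast hC
  have hDz : (D : ℤ) ≠ 0 := by exact_mod_cast hD
  have hEz : (E : ℤ) ≠ 0 := by exact_mod_cast hE
  have hCDE : Squarefree (C * D * E) := hsq.squarefree_of_dvd ⟨A * B, by ring⟩
  have hCD : Nat.Coprime C D :=
    Nat.coprime_of_squarefree_mul (hCDE.squarefree_of_dvd (dvd_mul_right _ _))
  -- the auxiliary form
  have hex : ∀ x : BCF, ∃ γ : Matrix (Fin 2) (Fin 2) ℤ, ∃ f : BCF, x ∈ S → γ.det = 1 ∧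
      smulF (C * D) (act γ x) = smulF (A ^ 2 * B) (stretch (C * D * E) f) ∧ Cond C D f ∧
      (∀ p : ℕ, p.Prime → p ∣ C * D → (p : ℤ) ∣ f.2.2.1 ∧ (p : ℤ) ∣ f.2.2.2 ∧
        ¬ ((p : ℤ) ∣ f.1 ∧ (p : ℤ) ∣ f.2.1)) := by
    intro x
    by_cases hx : x ∈ S
    · obtain ⟨γ, hγ, a, b, c, d, h1, h2, h3⟩ := (hS x hx).2.2
      refine ⟨γ, (a, C * b, C * D * c, C * D * d), fun _ => ⟨hγ, ?_, ?_, ?_⟩⟩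
      · rw [h1]
        simp only [smulF, stretch, Prod.mk.injEq]
        refine ⟨?_, ?_, ?_, ?_⟩ <;> ring
      · simp only [Cond, hP, hQ, hR, disc]
        refine ⟨⟨C * b ^ 2 - 3 * a * (D * c), by ring⟩, ⟨C * b * D * c - 9 * a * D * d, by ring⟩,
          ⟨C * D ^ 2 * c ^ 2 - 3 * b * C * D * d, by ring⟩, ⟨C ^ 4 * b ^ 2 * D * c ^ 2
          - 4 * a * C ^ 3 * D ^ 2 * c ^ 3 - 4 * C ^ 4 * b ^ 3 * d - 27 * a ^ 2 * C ^ 2 * D * d ^ 2 +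
          18 * a * C ^ 3 * b * D * c * d, by ring⟩⟩
      · intro p hp hpCD
        have hz : (p : ℤ) ∣ C * D := by exact_mod_cast hpCD
        refine ⟨hz.mul_right _, hz.mul_right _, ?_⟩
        rintro ⟨ha, hb⟩
        rcases hp.dvd_mul.1 hpCD with h | h
        · exact h2 p hp h ha
        · refine h3 p hp h ⟨ha, ?_⟩
          rcases (Nat.prime_iff_prime_int.1 hp).dvd_or_dvd hb with h' | h'
          · exfalso
            have h'' : p ∣ C := by exact_mod_cast h'
            have := Nat.dvd_gcd h'' h
            rw [hCD] at this
            exact hp.one_lt.ne' (Nat.dvd_one.1 this)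
          · exact h'
    · exact ⟨1, 0, fun h => absurd h hx⟩
  choose γ f hf using hex
  have hσ : ∀ x, ∃ σ : Matrix (Fin 2) (Fin 2) ℤ, σ.det = 1 ∧ act σ (rep (f x)) = f x :=
    fun x => SLeq_rep (f x)
  choose σ hσ1 hσ2 using hσ
  -- discriminants
  have hdisc : ∀ x ∈ S, disc x = A ^ 8 * B ^ 4 * C ^ 2 * D ^ 2 * E ^ 6 * disc (f x) := by
    intro x hx
    obtain ⟨h1, h2, -⟩ := hf x hx
    have := congrArg disc h2
    rw [disc_smulF, disc_smulF, disc_stretch, disc_act, h1] at this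
    have h4 : ((C : ℤ) * D) ^ 4 ≠ 0 := pow_ne_zero _ (mul_ne_zero hCz hDz)
    apply mul_left_cancel₀ h4
    linear_combination this
  have hrepdisc : ∀ g : BCF, disc (rep g) = disc g := by
    intro g
    obtain ⟨τ, h1, h2⟩ := SLeq_rep g
    rw [← h2, disc_act, h1, h2]; ring
  have hrepcond : ∀ g : BCF, Cond C D g → Cond C D (rep g) := by
    intro g hg
    obtain ⟨τ, h1, h2⟩ := SLeq_symm (SLeq_rep g)
    rw [← h2]; exact Cond_act _ hg
  refine ⟨S.image (fun x => rep (f x)), ?_, ?_, ?_⟩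
  · intro g hg
    obtain ⟨x, hx, rfl⟩ := Finset.mem_image.1 hg
    have hd := hdisc x hx
    rw [hrepdisc]
    refine ⟨?_, ?_, hrepcond _ (hf x hx).2.2.1⟩
    · intro h
      rw [h, mul_zero] at hd
      exact (hS x hx).1 hd
    · rw [le_div_iff₀ (by positivity)]
      have h := (hS x hx).2.1
      rw [hd] at h
      push_cast at h
      rw [abs_mul, abs_of_nonneg (by positivity)] at h
      linarith
  · intro g hg g' hg' hgg
    obtain ⟨x, hx, rfl⟩ := Finset.mem_image.1 hg
    obtain ⟨y, hy, rfl⟩ := Finset.mem_image.1 hg'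
    apply rep_eq
    exact SLeq_trans (SLeq_symm (SLeq_rep _)) (SLeq_trans hgg (SLeq_rep _))
  · have hcard : ((S.image (fun x => rep (f x))) ×ˢ ((Finset.Ico (0 : ℤ) E) ×ˢ
        (Finset.Ico (0 : ℤ) E))).card = (S.image (fun x => rep (f x))).card * E ^ 2 := by
      rw [Finset.card_product, Finset.card_product, Int.card_Ico]
      simp [pow_two]
    rw [← hcard]
    refine Finset.card_le_card_of_injOn
      (fun x => (rep (f x), (σ x 1 0 % (E : ℤ), σ x 1 1 % (E : ℤ)))) ?_ ?_
    · intro x hx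
      have hE0 : (0 : ℤ) < E := by positivity
      simp only [Finset.coe_product, Set.mem_prod, Finset.mem_coe, Finset.mem_Ico]
      exact ⟨Finset.mem_image_of_mem (fun x => rep (f x)) hx,
        ⟨Int.emod_nonneg _ hEz, Int.emod_lt_of_pos _ hE0⟩,
        Int.emod_nonneg _ hEz, Int.emod_lt_of_pos _ hE0⟩
    · intro x hx y hy hxy
      simp only [Prod.mk.injEq] at hxy
      obtain ⟨hr, h10, h11⟩ := hxy
      obtain ⟨hx1, hx2, -, hx4⟩ := hf x hx
      obtain ⟨hy1, hy2, -, hy4⟩ := hf y hy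
      obtain ⟨s, hs⟩ : ∃ s, s = σ y * (σ x).adjugate := ⟨_, rfl⟩
      have hsdet : s.det = 1 := by
        rw [hs, Matrix.det_mul, hσ1, det_adj (hσ1 x)]; norm_num
      have hact : act s (f x) = f y := by
        rw [hs, act_mul, ← hσ2 x, act_adj (hσ1 x), hr, hσ2]
      have hs10 : s 1 0 = σ y 1 0 * σ x 1 1 - σ y 1 1 * σ x 1 0 := by
        rw [hs, Matrix.mul_apply, Fin.sum_univ_two, Matrix.adjugate_fin_two]
        simp; ring
      have hdE : (E : ℤ) ∣ s 1 0 := by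
        have e1 : (E : ℤ) ∣ σ y 1 0 - σ x 1 0 := Int.ModEq.dvd h10
        have e2 : (E : ℤ) ∣ σ y 1 1 - σ x 1 1 := Int.ModEq.dvd h11
        rw [hs10]
        exact dvd_eq (dvd_sub (e1.mul_right (σ x 1 1)) (e2.mul_right (σ x 1 0))) (by ring)
      have hdm : ((C * D * E : ℕ) : ℤ) ∣ s 1 0 := by
        apply sqfree_dvd hCDE
        intro p hp hpm
        rcases hp.dvd_mul.1 hpm with h | h
        · obtain ⟨u1, u2, u3⟩ := hx4 p hp h
          obtain ⟨v1, v2, -⟩ := hy4 p hp h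
          exact root_preserved hp hsdet (a := (f x).1) (b := (f x).2.1) (c := (f x).2.2.1)
            (d := (f x).2.2.2) (a' := (f y).1) (b' := (f y).2.1) (c' := (f y).2.2.1)
            (d' := (f y).2.2.2) hact u1 u2 v1 v2 u3
        · exact dvd_trans (by exact_mod_cast h) hdE
      obtain ⟨β, hβ⟩ := hdm
      push_cast at hβ
      have hsform : s = !![s 0 0, s 0 1; (C * D * E : ℤ) * β, s 1 1] := by
        rw [← hβ]; exact Matrix.eta_fin_two s
      have hst := act_stretch (C * D * E) (s 0 0) (s 0 1) β (s 1 1) (f x)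
      rw [← hsform, hact] at hst
      obtain ⟨τ, hτ⟩ : ∃ τ, τ = !![s 0 0, s 0 1 * (C * D * E : ℤ); β, s 1 1] := ⟨_, rfl⟩
      have hτdet : τ.det = 1 := by
        rw [hτ, Matrix.det_fin_two_of, ← hsdet, Matrix.det_fin_two s, hβ]; ring
      rw [← hτ] at hst
      have hfin : smulF (C * D) (act τ (act (γ x) x)) = smulF (C * D) (act (γ y) y) := by
        rw [← act_smulF, hx2, act_smulF, hst, hy2]
      have hfin2 := smulF_inj (mul_ne_zero hCz hDz) hfin
      apply hinj x hx y hy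
      exact SLeq_trans (SLeq_trans ⟨γ x, hx1, rfl⟩ ⟨τ, hτdet, hfin2⟩)
        (SLeq_symm ⟨γ y, hy1, rfl⟩)

theorem tuple_count {A B C D E : ℕ} (hsq : Squarefree (A * B * C * D * E))
    (h6 : Nat.Coprime (A * B * C * D * E) 6)
    {X : ℝ} (hX : 0 ≤ X) (S : Finset BCF)
    (hS : ∀ x ∈ S, disc x ≠ 0 ∧ |(disc x : ℝ)| ≤ X ∧ Shape A B C D E x)
    (hinj : ∀ x ∈ S, ∀ y ∈ S, SLeq x y → x = y) (Q : ℕ) (hQ : Q = A * B * C * D * E) :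
    (S.card : ℝ) * (A ^ 2 * B ^ 3 * C ^ 3 * D ^ 4 * E ^ 3 : ℝ)⁻¹ ≤
      K0 * tau Q * (X / (Q : ℝ) ^ 6) ∧
    (S.card : ℝ) * (A ^ 2 * B ^ 3 * C ^ 3 * D ^ 4 * E ^ 3 : ℝ)⁻¹ ≤
      K0 * tau Q * (X / (Q : ℝ) ^ 7 + 1 / Q) := by
  obtain ⟨T, hT1, hT2, hT3⟩ := tuple_fibre hsq S hS hinj
  have hsqCD : Squarefree (C * D) := hsq.squarefree_of_dvd ⟨A * B * E, by ring⟩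
  have h6CD : Nat.Coprime (C * D) 6 := h6.coprime_dvd_left ⟨A * B * E, by ring⟩
  have hne := hsq.ne_zero
  have hQ0 : Q ≠ 0 := by rw [hQ]; exact hne
  have t1 : tau C ≤ tau Q := tau_mono ⟨A * B * D * E, by rw [hQ]; ring⟩ hQ0
  have t2 : tau (C * D) ≤ tau Q := tau_mono ⟨A * B * E, by rw [hQ]; ring⟩ hQ0
  have t0 := tau_nonneg Q
  have hK : 0 ≤ K0 := by unfold K0; norm_num
  simp only [mul_ne_zero_iff] at hne
  obtain ⟨⟨⟨⟨hA, hB⟩, hC⟩, hD⟩, hE⟩ := hne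
  have hQr : (Q : ℝ) = A * B * C * D * E := by rw [hQ]; push_cast; ring
  have a1 : (1 : ℝ) ≤ A := by exact_mod_cast Nat.pos_of_ne_zero hA
  have b1 : (1 : ℝ) ≤ B := by exact_mod_cast Nat.pos_of_ne_zero hB
  have c1 : (1 : ℝ) ≤ C := by exact_mod_cast Nat.pos_of_ne_zero hC
  have d1 : (1 : ℝ) ≤ D := by exact_mod_cast Nat.pos_of_ne_zero hD
  have e1 : (1 : ℝ) ≤ E := by exact_mod_cast Nat.pos_of_ne_zero hE
  have hT3' : (S.card : ℝ) ≤ T.card * E ^ 2 := by exact_mod_cast hT3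
  have hY : 0 ≤ X / ((A : ℝ) ^ 8 * B ^ 4 * C ^ 2 * D ^ 2 * E ^ 6) := by positivity
  have m1 := count_M1 hsqCD h6CD T hT1 hT2 hY
  have m2 := count_M2 hsqCD h6CD T hT1 hT2 hY
  constructor
  · calc (S.card : ℝ) * (A ^ 2 * B ^ 3 * C ^ 3 * D ^ 4 * E ^ 3 : ℝ)⁻¹
        ≤ ((K0 * tau Q * (X / (A ^ 8 * B ^ 4 * C ^ 2 * D ^ 2 * E ^ 6) / C)) * E ^ 2) *
          (A ^ 2 * B ^ 3 * C ^ 3 * D ^ 4 * E ^ 3 : ℝ)⁻¹ := by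
          gcongr
          refine hT3'.trans ?_
          gcongr
          refine m1.trans ?_
          gcongr
      _ = K0 * tau Q * (X / (A ^ 10 * B ^ 7 * C ^ 6 * D ^ 6 * E ^ 7)) := by
          field_simp
      _ ≤ K0 * tau Q * (X / (A ^ 6 * B ^ 6 * C ^ 6 * D ^ 6 * E ^ 6)) := by
          gcongr <;> first | assumption | norm_num
      _ = _ := by rw [hQr]; ring
  · calc (S.card : ℝ) * (A ^ 2 * B ^ 3 * C ^ 3 * D ^ 4 * E ^ 3 : ℝ)⁻¹
        ≤ ((K0 * tau Q * (X / (A ^ 8 * B ^ 4 * C ^ 2 * D ^ 2 * E ^ 6) / (C ^ 2 * D) + C ^ 2 * D ^ 3))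
          * E ^ 2) * (A ^ 2 * B ^ 3 * C ^ 3 * D ^ 4 * E ^ 3 : ℝ)⁻¹ := by
          gcongr
          refine hT3'.trans ?_
          gcongr
          refine m2.trans ?_
          gcongr
      _ = K0 * tau Q * (X / (A ^ 10 * B ^ 7 * C ^ 7 * D ^ 7 * E ^ 7) +
            1 / (A ^ 2 * B ^ 3 * C ^ 1 * D ^ 1 * E ^ 1)) := by
          field_simp
      _ ≤ K0 * tau Q * (X / (A ^ 7 * B ^ 7 * C ^ 7 * D ^ 7 * E ^ 7) +
            1 / (A ^ 1 * B ^ 1 * C ^ 1 * D ^ 1 * E ^ 1)) := by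
          gcongr <;> first | assumption | norm_num
      _ = _ := by rw [hQr]; ring

end BCF

namespace BCF

/-! ### Fourier side: generalities -/

/-- The pairing as an integer. -/
def pairZ (x y : BCF) : ℤ :=
  x.2.2.2 * y.1 - (x.2.2.1 / 3) * y.2.1 + (x.2.1 / 3) * y.2.2.1 - x.1 * y.2.2.2

/-- Sum of forms. -/
def addF (x y : BCF) : BCF := (x.1 + y.1, x.2.1 + y.2.1, x.2.2.1 + y.2.2.1, x.2.2.2 + y.2.2.2)

lemma pairZ_three {x : BCF} (hx : inDual x) (y : BCF) : 3 * pairZ x y =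
    3 * (x.2.2.2 * y.1) - x.2.2.1 * y.2.1 + x.2.1 * y.2.2.1 - 3 * (x.1 * y.2.2.2) := by
  obtain ⟨⟨b, hb⟩, ⟨c, hc⟩⟩ := hx
  simp only [pairZ]
  rw [hb, hc, Int.mul_ediv_cancel_left _ (by norm_num), Int.mul_ediv_cancel_left _ (by norm_num)]
  ring

lemma pairQ_eq {x : BCF} (hx : inDual x) (y : BCF) : pairQ x y = (pairZ x y : ℚ) := by
  have h := congrArg (fun z : ℤ => (z : ℚ)) (pairZ_three hx y)
  push_cast at h
  simp only [pairQ]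
  push_cast
  linarith

lemma pairZ_add (x y z : BCF) : pairZ x (addF y z) = pairZ x y + pairZ x z := by
  simp only [pairZ, addF]; ring

lemma pairZ_smul (x y : BCF) (c : ℤ) : pairZ x (smulF c y) = c * pairZ x y := by
  simp only [pairZ, smulF]; ring

lemma inDual_act {x : BCF} (hx : inDual x) (γ : Matrix (Fin 2) (Fin 2) ℤ) : inDual (act γ x) := by
  obtain ⟨a, b, c, d⟩ := x
  obtain ⟨⟨b', hb⟩, ⟨c', hc⟩⟩ := hx
  simp only at hb hc
  subst hb; subst hc
  constructor
  · simp only [act]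
    exact ⟨γ.det * (a * γ 0 0 ^ 2 * γ 1 0 + b' * (γ 0 0 ^ 2 * γ 1 1 + 2 * γ 0 0 * γ 1 0 * γ 0 1)
      + c' * (2 * γ 0 0 * γ 0 1 * γ 1 1 + γ 1 0 * γ 0 1 ^ 2) + d * γ 0 1 ^ 2 * γ 1 1), by ring⟩
  · simp only [act]
    exact ⟨γ.det * (a * γ 0 0 * γ 1 0 ^ 2 + b' * (2 * γ 0 0 * γ 1 0 * γ 1 1 + γ 1 0 ^ 2 * γ 0 1)
      + c' * (γ 0 0 * γ 1 1 ^ 2 + 2 * γ 1 0 * γ 0 1 * γ 1 1) + d * γ 0 1 * γ 1 1 ^ 2), by ring⟩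

lemma pairZ_act {x : BCF} (hx : inDual x) (y : BCF) {γ : Matrix (Fin 2) (Fin 2) ℤ}
    (hγ : γ.det = 1) : pairZ (act γ x) (act γ y) = pairZ x y := by
  have h1 := pairZ_three (inDual_act hx γ) (act γ y)
  have h2 := pairZ_three hx y
  have h3 : 3 * pairZ (act γ x) (act γ y) = γ.det ^ 5 * (3 * pairZ x y) := by
    rw [h1, h2]
    simp only [act, Matrix.det_fin_two]
    ring
  rw [hγ] at h3
  linarith

/-- The additive character modulo `N`. -/
def chi (N : ℕ) (t : ℤ) : ℂ := Complex.exp (2 * Real.pi * Complex.I * (t : ℂ) / (N : ℂ))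

lemma chi_add (N : ℕ) (s t : ℤ) : chi N (s + t) = chi N s * chi N t := by
  unfold chi
  rw [← Complex.exp_add]
  congr 1
  push_cast
  ring

lemma norm_chi (N : ℕ) (t : ℤ) : ‖chi N t‖ = 1 := by
  unfold chi
  have : (2 * Real.pi * Complex.I * (t : ℂ) / (N : ℂ)) =
      ((2 * Real.pi * t / N : ℝ) : ℂ) * Complex.I := by
    push_cast; ring
  rw [this, Complex.norm_exp_ofReal_mul_I]

lemma chi_mul_right {M N : ℕ} (hN : N ≠ 0) (t : ℤ) : chi (M * N) (N * t) = chi M t := by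
  unfold chi
  congr 1
  have : (N : ℂ) ≠ 0 := by exact_mod_cast hN
  push_cast
  field_simp

lemma chi_eq_one_iff {N : ℕ} (hN : N ≠ 0) (t : ℤ) : chi N t = 1 ↔ (N : ℤ) ∣ t := by
  unfold chi
  have hNc : (N : ℂ) ≠ 0 := by exact_mod_cast hN
  have hpi : (2 * Real.pi * Complex.I : ℂ) ≠ 0 := Complex.two_pi_I_ne_zero
  rw [Complex.exp_eq_one_iff]
  constructor
  · rintro ⟨n, hn⟩
    refine ⟨n, ?_⟩
    have : (t : ℂ) = N * n := by
      rw [div_eq_iff hNc] at hn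
      apply mul_left_cancel₀ hpi
      rw [hn]; ring
    exact_mod_cast this
  · rintro ⟨n, rfl⟩
    refine ⟨n, ?_⟩
    push_cast
    field_simp

/-- The box of forms with coefficients in `[0, N)`. -/
def box (N : ℕ) : Finset BCF :=
  (Finset.Ico (0 : ℤ) N) ×ˢ (Finset.Ico (0 : ℤ) N) ×ˢ (Finset.Ico (0 : ℤ) N) ×ˢ
    (Finset.Ico (0 : ℤ) N)

lemma card_box (N : ℕ) : (box N).card = N ^ 4 := by
  simp only [box, Finset.card_product, Int.card_Ico]
  simp
  ring

/-- Congruence modulo `N`. -/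
def CongF (N : ℕ) (x y : BCF) : Prop :=
  (N : ℤ) ∣ x.1 - y.1 ∧ (N : ℤ) ∣ x.2.1 - y.2.1 ∧ (N : ℤ) ∣ x.2.2.1 - y.2.2.1 ∧
    (N : ℤ) ∣ x.2.2.2 - y.2.2.2

lemma Ico_eq_of_dvd {N : ℕ} {a b : ℤ} (ha : a ∈ Finset.Ico (0 : ℤ) N)
    (hb : b ∈ Finset.Ico (0 : ℤ) N) (h : (N : ℤ) ∣ a - b) : a = b := by
  rw [Finset.mem_Ico] at ha hb
  have := Int.eq_zero_of_abs_lt_dvd h (by rw [abs_lt]; constructor <;> linarith)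
  linarith

lemma box_eq {N : ℕ} {x y : BCF} (hx : x ∈ box N) (hy : y ∈ box N) (h : CongF N x y) : x = y := by
  simp only [box, Finset.mem_product] at hx hy
  obtain ⟨a1, a2, a3, a4⟩ := hx
  obtain ⟨b1, b2, b3, b4⟩ := hy
  obtain ⟨h1, h2, h3, h4⟩ := h
  exact Prod.ext (Ico_eq_of_dvd a1 b1 h1) (Prod.ext (Ico_eq_of_dvd a2 b2 h2)
    (Prod.ext (Ico_eq_of_dvd a3 b3 h3) (Ico_eq_of_dvd a4 b4 h4)))

/-- Reduction modulo `N`. -/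
def redF (N : ℕ) (x : BCF) : BCF := (x.1 % N, x.2.1 % N, x.2.2.1 % N, x.2.2.2 % N)

lemma redF_mem {N : ℕ} (hN : N ≠ 0) (x : BCF) : redF N x ∈ box N := by
  have h0 : (N : ℤ) ≠ 0 := by exact_mod_cast hN
  have h1 : (0 : ℤ) < N := by positivity
  simp only [box, redF, Finset.mem_product, Finset.mem_Ico]
  exact ⟨⟨Int.emod_nonneg _ h0, Int.emod_lt_of_pos _ h1⟩,
    ⟨Int.emod_nonneg _ h0, Int.emod_lt_of_pos _ h1⟩,
    ⟨Int.emod_nonneg _ h0, Int.emod_lt_of_pos _ h1⟩,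
    ⟨Int.emod_nonneg _ h0, Int.emod_lt_of_pos _ h1⟩⟩

lemma redF_cong (N : ℕ) (x : BCF) : CongF N x (redF N x) :=
  ⟨Int.dvd_self_sub_emod, Int.dvd_self_sub_emod, Int.dvd_self_sub_emod, Int.dvd_self_sub_emod⟩

lemma CongF_symm {N : ℕ} {x y : BCF} (h : CongF N x y) : CongF N y x := by
  obtain ⟨h1, h2, h3, h4⟩ := h
  exact ⟨(dvd_sub_comm).1 h1, (dvd_sub_comm).1 h2, (dvd_sub_comm).1 h3, (dvd_sub_comm).1 h4⟩

lemma CongF_trans {N : ℕ} {x y z : BCF} (h : CongF N x y) (h' : CongF N y z) : CongF N x z := by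
  obtain ⟨h1, h2, h3, h4⟩ := h
  obtain ⟨g1, g2, g3, g4⟩ := h'
  exact ⟨dvd_eq (dvd_add h1 g1) (by ring), dvd_eq (dvd_add h2 g2) (by ring),
    dvd_eq (dvd_add h3 g3) (by ring), dvd_eq (dvd_add h4 g4) (by ring)⟩

lemma sum_box {ι : Type} {N : ℕ} (hN : N ≠ 0) (s : Finset ι) (φ : ι → BCF) (h : BCF → ℂ)
    (hper : ∀ x y, CongF N x y → h x = h y)
    (hinj : ∀ i ∈ s, ∀ j ∈ s, CongF N (φ i) (φ j) → i = j) (hcard : s.card = N ^ 4) :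
    ∑ i ∈ s, h (φ i) = ∑ y ∈ box N, h y := by
  have hi : Set.InjOn (fun i => redF N (φ i)) s := by
    intro i hi j hj hij
    apply hinj i hi j hj
    have e : redF N (φ i) = redF N (φ j) := hij
    exact CongF_trans (redF_cong N _) (e ▸ CongF_symm (redF_cong N _))
  have himg : s.image (fun i => redF N (φ i)) = box N := by
    apply Finset.eq_of_subset_of_card_le
    · intro y hy
      obtain ⟨i, -, rfl⟩ := Finset.mem_image.1 hy
      exact redF_mem hN _
    · rw [Finset.card_image_of_injOn hi, hcard, card_box]
  rw [← himg, Finset.sum_image hi]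
  exact Finset.sum_congr rfl (fun i _ => hper _ _ (redF_cong N _))

lemma pairZ_cong {N : ℕ} {x y y' : BCF} (h : CongF N y y') : (N : ℤ) ∣ pairZ x y - pairZ x y' := by
  obtain ⟨h1, h2, h3, h4⟩ := h
  refine dvd_eq (dvd_add (dvd_sub (h1.mul_right x.2.2.2) (h2.mul_right (x.2.2.1 / 3)))
    (dvd_sub (h3.mul_right (x.2.1 / 3)) (h4.mul_right x.1))) ?_
  simp only [pairZ]; ring

lemma chi_cong {N : ℕ} (hN : N ≠ 0) {x y y' : BCF} (h : CongF N y y') :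
    chi N (pairZ x y) = chi N (pairZ x y') := by
  have := (chi_eq_one_iff hN _).2 (pairZ_cong (x := x) h)
  have e : pairZ x y = pairZ x y - pairZ x y' + pairZ x y' := by ring
  rw [e, chi_add, this, one_mul]

/-- The Fourier sum over the box. -/
def four (N : ℕ) (P : BCF → Prop) (x : BCF) : ℂ :=
  ∑ y ∈ box N, (if P y then 1 else 0) * chi N (pairZ x y)

lemma sum_range_Ico (N : ℕ) (g : ℤ → ℂ) :
    ∑ i ∈ Finset.range N, g i = ∑ i ∈ Finset.Ico (0 : ℤ) N, g i := by
  refine Finset.sum_bij (fun i _ => (i : ℤ)) ?_ ?_ ?_ ?_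
  · intro i hi
    rw [Finset.mem_range] at hi
    rw [Finset.mem_Ico]; omega
  · intro i _ j _ h; exact_mod_cast h
  · intro b hb
    rw [Finset.mem_Ico] at hb
    refine ⟨b.toNat, ?_, ?_⟩
    · rw [Finset.mem_range]; omega
    · omega
  · intro i _; rfl

lemma PhiHat'_eq {x : BCF} (hx : inDual x) (q : ℕ) :
    PhiHat' q x = ((q : ℂ) ^ 8)⁻¹ * four (q ^ 2) (outVpAll q) x := by
  unfold PhiHat' four
  congr 1
  simp only [box, Finset.sum_product]
  have key : ∀ y : BCF, (if outVpAll q y then (1 : ℂ) else 0) *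
        Complex.exp (2 * Real.pi * Complex.I * ((pairQ x y : ℚ) : ℂ) / (q : ℂ) ^ 2) =
      (if outVpAll q y then 1 else 0) * chi (q ^ 2) (pairZ x y) := by
    intro y
    rw [pairQ_eq hx y]
    unfold chi
    push_cast
    rfl
  simp only [key]
  rw [← sum_range_Ico]
  refine Finset.sum_congr rfl fun y1 _ => ?_
  rw [← sum_range_Ico]
  refine Finset.sum_congr rfl fun y2 _ => ?_
  rw [← sum_range_Ico]
  refine Finset.sum_congr rfl fun y3 _ => ?_
  rw [← sum_range_Ico]

/-! ### Periodicity and scaling -/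

lemma act_cong {N : ℕ} {x y : BCF} (h : CongF N x y) (γ : Matrix (Fin 2) (Fin 2) ℤ) :
    CongF N (act γ x) (act γ y) := by
  obtain ⟨⟨a, h1⟩, ⟨b, h2⟩, ⟨c, h3⟩, ⟨d, h4⟩⟩ := h
  have h1' : x.1 = y.1 + N * a := by linarith
  have h2' : x.2.1 = y.2.1 + N * b := by linarith
  have h3' : x.2.2.1 = y.2.2.1 + N * c := by linarith
  have h4' : x.2.2.2 = y.2.2.2 + N * d := by linarith
  refine ⟨⟨(act γ (a, b, c, d)).1, ?_⟩, ⟨(act γ (a, b, c, d)).2.1, ?_⟩,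
    ⟨(act γ (a, b, c, d)).2.2.1, ?_⟩, ⟨(act γ (a, b, c, d)).2.2.2, ?_⟩⟩ <;>
  · simp only [act, h1', h2', h3', h4']
    ring

lemma dvd_cong {N : ℕ} {d : ℤ} (hd : d ∣ N) {a b : ℤ} (h : (N : ℤ) ∣ a - b) : d ∣ a ↔ d ∣ b :=
  (dvd_iff_dvd_of_dvd_sub (hd.trans h))

lemma inVp_cong {p N : ℕ} (hN : p ^ 2 ∣ N) {x y : BCF} (h : CongF N x y)
    (hx : inVp p x) : inVp p y := by
  have hN2 : ((p : ℤ) ^ 2) ∣ N := by exact_mod_cast hN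
  have hN1 : (p : ℤ) ∣ N := dvd_trans (dvd_pow_self _ (by norm_num)) hN2
  obtain ⟨⟨hx1, hx2⟩, hx3⟩ := hx
  refine ⟨⟨?_, ?_⟩, ?_⟩
  · rintro ⟨g1, g2, g3, g4⟩
    exact hx1 ⟨(dvd_cong hN1 h.1).2 g1, (dvd_cong hN1 h.2.1).2 g2, (dvd_cong hN1 h.2.2.1).2 g3,
      (dvd_cong hN1 h.2.2.2).2 g4⟩
  · intro γ hγ
    rintro ⟨g1, g2⟩
    have hc := act_cong h γ
    exact hx2 γ hγ ⟨(dvd_cong hN2 hc.1).2 g1, (dvd_cong hN1 hc.2.1).2 g2⟩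
  · rintro ⟨s, l1, l2, g1, g2, g3, g4⟩
    have cast_eq : ∀ a b : ℤ, (N : ℤ) ∣ a - b → (a : ZMod p) = (b : ZMod p) := by
      intro a b hab
      exact ((ZMod.intCast_eq_intCast_iff_dvd_sub b a p).2 (hN1.trans hab)).symm
    exact hx3 ⟨s, l1, l2, (cast_eq _ _ h.1).trans g1, (cast_eq _ _ h.2.1).trans g2,
      (cast_eq _ _ h.2.2.1).trans g3, (cast_eq _ _ h.2.2.2).trans g4⟩

lemma inVp_smul {p : ℕ} (hp : p.Prime) {c : ℤ} (hc : IsCoprime (p : ℤ) c) {x : BCF}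
    (hx : inVp p x) : inVp p (smulF c x) := by
  obtain ⟨⟨hx1, hx2⟩, hx3⟩ := hx
  refine ⟨⟨?_, ?_⟩, ?_⟩
  · rintro ⟨g1, g2, g3, g4⟩
    exact hx1 ⟨hc.dvd_of_dvd_mul_left g1, hc.dvd_of_dvd_mul_left g2, hc.dvd_of_dvd_mul_left g3,
      hc.dvd_of_dvd_mul_left g4⟩
  · intro γ hγ
    rw [act_smulF]
    rintro ⟨g1, g2⟩
    exact hx2 γ hγ ⟨hc.pow_left.dvd_of_dvd_mul_left g1, hc.dvd_of_dvd_mul_left g2⟩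
  · rintro ⟨s, l1, l2, g1, g2, g3, g4⟩
    obtain ⟨u, v, huv⟩ := hc
    have hv : (v : ZMod p) * (c : ZMod p) = 1 := by
      have := congrArg (fun z : ℤ => (z : ZMod p)) huv
      simpa using this
    simp only [smulF, Int.cast_mul] at g1 g2 g3 g4
    refine hx3 ⟨v * s, l1, l2, ?_, ?_, ?_, ?_⟩
    · linear_combination (v : ZMod p) * g1 - (x.1 : ZMod p) * hv
    · linear_combination (v : ZMod p) * g2 - (x.2.1 : ZMod p) * hv
    · linear_combination (v : ZMod p) * g3 - (x.2.2.1 : ZMod p) * hv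
    · linear_combination (v : ZMod p) * g4 - (x.2.2.2 : ZMod p) * hv

lemma inVp_smul_iff {p : ℕ} (hp : p.Prime) {c : ℤ} (hc : IsCoprime (p : ℤ) c) (x : BCF) :
    inVp p (smulF c x) ↔ inVp p x := by
  refine ⟨fun h => ?_, inVp_smul hp hc⟩
  have hc' : IsCoprime ((p ^ 2 : ℕ) : ℤ) c := by push_cast; exact hc.pow_left
  obtain ⟨u, v, huv⟩ := hc'
  have hv : IsCoprime (p : ℤ) v := ⟨u * p, c, by push_cast at huv; linear_combination huv⟩
  have h2 := inVp_smul hp hv h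
  refine inVp_cong (N := p ^ 2) dvd_rfl ?_ h2
  refine ⟨⟨-u * x.1, ?_⟩, ⟨-u * x.2.1, ?_⟩, ⟨-u * x.2.2.1, ?_⟩, ⟨-u * x.2.2.2, ?_⟩⟩
  · simp only [smulF]; linear_combination x.1 * huv
  · simp only [smulF]; linear_combination x.2.1 * huv
  · simp only [smulF]; linear_combination x.2.2.1 * huv
  · simp only [smulF]; linear_combination x.2.2.2 * huv

lemma outVpAll_cong {q N : ℕ} (hN : q ^ 2 ∣ N) {x y : BCF} (h : CongF N x y) :
    outVpAll q x ↔ outVpAll q y := by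
  constructor
  · intro hx p hp hpq hy
    exact hx p hp hpq (inVp_cong ((pow_dvd_pow_of_dvd hpq 2).trans hN) (CongF_symm h) hy)
  · intro hx p hp hpq hy
    exact hx p hp hpq (inVp_cong ((pow_dvd_pow_of_dvd hpq 2).trans hN) h hy)

lemma outVpAll_smul {q : ℕ} {c : ℤ} (hc : IsCoprime (q : ℤ) c) (x : BCF) :
    outVpAll q (smulF c x) ↔ outVpAll q x := by
  have : ∀ p : ℕ, p.Prime → p ∣ q → (inVp p (smulF c x) ↔ inVp p x) := by
    intro p hp hpq
    exact inVp_smul_iff hp (hc.of_isCoprime_of_dvd_left (by exact_mod_cast hpq)) x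
  constructor
  · intro h p hp hpq; rw [← this p hp hpq]; exact h p hp hpq
  · intro h p hp hpq; rw [this p hp hpq]; exact h p hp hpq

lemma outVpAll_mul {a b : ℕ} (x : BCF) : outVpAll (a * b) x ↔ outVpAll a x ∧ outVpAll b x := by
  constructor
  · intro h
    exact ⟨fun p hp hpa => h p hp (hpa.mul_right b), fun p hp hpa => h p hp (hpa.mul_left a)⟩
  · rintro ⟨h1, h2⟩ p hp hpab
    rcases hp.dvd_mul.1 hpab with h | h
    · exact h1 p hp h
    · exact h2 p hp h

lemma four_mul {a b : ℕ} (ha : a ≠ 0) (hb : b ≠ 0) (hab : Nat.Coprime a b) (x : BCF) :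
    four ((a * b) ^ 2) (outVpAll (a * b)) x =
      four (a ^ 2) (outVpAll a) x * four (b ^ 2) (outVpAll b) x := by
  have hN : (a * b) ^ 2 ≠ 0 := pow_ne_zero _ (mul_ne_zero ha hb)
  have hcop : IsCoprime (a : ℤ) (b : ℤ) := Nat.isCoprime_iff_coprime.2 hab
  have hcop2 : IsCoprime ((a : ℤ) ^ 2) ((b : ℤ) ^ 2) := hcop.pow
  unfold four
  rw [Finset.sum_mul_sum, ← Finset.sum_product']
  rw [← sum_box hN (box (a ^ 2) ×ˢ box (b ^ 2))
    (fun z => addF (smulF ((b : ℤ) ^ 2) z.1) (smulF ((a : ℤ) ^ 2) z.2))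
    (fun y => (if outVpAll (a * b) y then (1 : ℂ) else 0) * chi ((a * b) ^ 2) (pairZ x y)) ?_ ?_ ?_]
  · refine Finset.sum_congr rfl ?_
    rintro ⟨y, z⟩ -
    simp only
    have e1 : outVpAll a (addF (smulF ((b : ℤ) ^ 2) y) (smulF ((a : ℤ) ^ 2) z)) ↔ outVpAll a y := by
      rw [outVpAll_cong (N := a ^ 2) dvd_rfl (y := smulF ((b : ℤ) ^ 2) y),
        outVpAll_smul hcop.pow_right]
      refine ⟨⟨z.1, ?_⟩, ⟨z.2.1, ?_⟩, ⟨z.2.2.1, ?_⟩, ⟨z.2.2.2, ?_⟩⟩ <;>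
      · simp only [addF, smulF]; push_cast; ring
    have e2 : outVpAll b (addF (smulF ((b : ℤ) ^ 2) y) (smulF ((a : ℤ) ^ 2) z)) ↔ outVpAll b z := by
      rw [outVpAll_cong (N := b ^ 2) dvd_rfl (y := smulF ((a : ℤ) ^ 2) z),
        outVpAll_smul hcop.symm.pow_right]
      refine ⟨⟨y.1, ?_⟩, ⟨y.2.1, ?_⟩, ⟨y.2.2.1, ?_⟩, ⟨y.2.2.2, ?_⟩⟩ <;>
      · simp only [addF, smulF]; push_cast; ring
    rw [pairZ_add, pairZ_smul, pairZ_smul, chi_add]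
    have f1 : chi ((a * b) ^ 2) ((b : ℤ) ^ 2 * pairZ x y) = chi (a ^ 2) (pairZ x y) := by
      have := chi_mul_right (M := a ^ 2) (N := b ^ 2) (pow_ne_zero _ hb) (pairZ x y)
      rw [← this]; push_cast; congr 1; ring
    have f2 : chi ((a * b) ^ 2) ((a : ℤ) ^ 2 * pairZ x z) = chi (b ^ 2) (pairZ x z) := by
      have := chi_mul_right (M := b ^ 2) (N := a ^ 2) (pow_ne_zero _ ha) (pairZ x z)
      rw [← this]; push_cast; congr 1; ring
    rw [f1, f2]
    simp only [outVpAll_mul, e1, e2]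
    by_cases h1 : outVpAll a y <;> by_cases h2 : outVpAll b z <;> simp [h1, h2]
  · intro u v huv
    simp only [outVpAll_cong dvd_rfl huv, chi_cong hN huv]
  · rintro ⟨y, z⟩ hi ⟨y', z'⟩ hj h
    rw [Finset.mem_product] at hi hj
    have aux : ∀ s t s' t' : ℤ, (((a * b) ^ 2 : ℕ) : ℤ) ∣
        ((b : ℤ) ^ 2 * s + (a : ℤ) ^ 2 * t) - ((b : ℤ) ^ 2 * s' + (a : ℤ) ^ 2 * t') →
        ((a ^ 2 : ℕ) : ℤ) ∣ s - s' ∧ ((b ^ 2 : ℕ) : ℤ) ∣ t - t' := by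
      intro s t s' t' hd
      push_cast at hd ⊢
      constructor
      · refine hcop2.dvd_of_dvd_mul_left ?_
        have h1 : (a : ℤ) ^ 2 ∣ _ := dvd_trans ⟨(b : ℤ) ^ 2, by ring⟩ hd
        exact dvd_eq (dvd_sub h1 (dvd_mul_right _ (t - t'))) (by ring)
      · refine hcop2.symm.dvd_of_dvd_mul_left ?_
        have h1 : (b : ℤ) ^ 2 ∣ _ := dvd_trans ⟨(a : ℤ) ^ 2, by ring⟩ hd
        exact dvd_eq (dvd_sub h1 (dvd_mul_right _ (s - s'))) (by ring)
    obtain ⟨h1, h2, h3, h4⟩ := h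
    simp only [addF, smulF] at h1 h2 h3 h4
    have g1 := aux _ _ _ _ h1
    have g2 := aux _ _ _ _ h2
    have g3 := aux _ _ _ _ h3
    have g4 := aux _ _ _ _ h4
    rw [Prod.mk.injEq]
    exact ⟨box_eq hi.1 hj.1 ⟨g1.1, g2.1, g3.1, g4.1⟩, box_eq hi.2 hj.2 ⟨g1.2, g2.2, g3.2, g4.2⟩⟩
  · rw [Finset.card_product, card_box, card_box]; ring

lemma PhiHat'_mul {a b : ℕ} (ha : a ≠ 0) (hb : b ≠ 0) (hab : Nat.Coprime a b) {x : BCF}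
    (hx : inDual x) : PhiHat' (a * b) x = PhiHat' a x * PhiHat' b x := by
  rw [PhiHat'_eq hx, PhiHat'_eq hx, PhiHat'_eq hx, four_mul ha hb hab]
  push_cast
  rw [mul_pow, mul_inv]
  ring

lemma PhiHat'_one {x : BCF} (hx : inDual x) : PhiHat' 1 x = 1 := by
  unfold PhiHat'
  have : outVpAll 1 (0, 0, 0, 0) := by
    intro p hp h
    exact absurd (Nat.dvd_one.1 h) hp.one_lt.ne'
  simp [this, pairQ]

lemma norm_PhiHat'_le_one {x : BCF} (hx : inDual x) {q : ℕ} (hq : q ≠ 0) : ‖PhiHat' q x‖ ≤ 1 := by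
  rw [PhiHat'_eq hx, norm_mul]
  have : ‖four (q ^ 2) (outVpAll q) x‖ ≤ (q : ℝ) ^ 8 := by
    unfold four
    refine (norm_sum_le _ _).trans ?_
    calc _ ≤ ∑ y ∈ box (q ^ 2), (1 : ℝ) := by
          refine Finset.sum_le_sum fun y _ => ?_
          rw [norm_mul, norm_chi, mul_one]
          split_ifs <;> simp
      _ = _ := by rw [Finset.sum_const, card_box]; simp; ring
  have hq0 : (0 : ℝ) < (q : ℝ) ^ 8 := by positivity
  rw [norm_inv, norm_pow, Complex.norm_natCast]
  calc _ ≤ ((q : ℝ) ^ 8)⁻¹ * (q : ℝ) ^ 8 := by gcongr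
    _ = 1 := by field_simp

lemma norm_PhiHat'_prod {x : BCF} (hx : inDual x) {q : ℕ} (hq : Squarefree q) :
    ‖PhiHat' q x‖ = ∏ p ∈ q.primeFactors, ‖PhiHat' p x‖ := by
  induction q using Nat.strong_induction_on with
  | _ q ih =>
    by_cases h1 : q = 1
    · subst h1; simp [PhiHat'_one hx]
    · have hp := Nat.minFac_prime h1
      obtain ⟨n, hn⟩ := Nat.minFac_dvd q
      obtain ⟨p, hpe⟩ : ∃ p, p = q.minFac := ⟨_, rfl⟩
      rw [← hpe] at hp hn
      have hn0 : n ≠ 0 := by rintro rfl; rw [mul_zero] at hn; exact hq.ne_zero hn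
      rw [hn] at hq
      have hcop : Nat.Coprime p n := Nat.coprime_of_squarefree_mul hq
      have hnsq : Squarefree n := hq.squarefree_of_dvd (dvd_mul_left _ _)
      have hlt : n < q := by rw [hn]; exact lt_mul_left (Nat.pos_of_ne_zero hn0) hp.one_lt
      rw [hn, PhiHat'_mul hp.ne_zero hn0 hcop hx, norm_mul, ih n hlt hnsq,
        Nat.primeFactors_mul hp.ne_zero hn0, hp.primeFactors,
        Finset.prod_union (by
          rw [Finset.disjoint_singleton_left]
          intro h
          have := Nat.dvd_gcd dvd_rfl (Nat.dvd_of_mem_primeFactors h)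
          rw [hcop] at this
          exact hp.one_lt.ne' (Nat.dvd_one.1 this)), Finset.prod_singleton]

end BCF

namespace BCF

/-! ### Weighted divisibility shapes -/

/-- Weighted divisibility of the first three coefficients. -/
def W (p i j k : ℕ) (y : BCF) : Prop :=
  (p : ℤ) ^ i ∣ y.1 ∧ (p : ℤ) ^ j ∣ y.2.1 ∧ (p : ℤ) ^ k ∣ y.2.2.1

/-- All coefficients divisible by `p`. -/
def AllD (n : ℤ) (y : BCF) : Prop := n ∣ y.1 ∧ n ∣ y.2.1 ∧ n ∣ y.2.2.1 ∧ n ∣ y.2.2.2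

lemma AllD_act {n : ℤ} {y : BCF} (h : AllD n y) (γ : Matrix (Fin 2) (Fin 2) ℤ) :
    AllD n (act γ y) := by
  obtain ⟨⟨a, h1⟩, ⟨b, h2⟩, ⟨c, h3⟩, ⟨d, h4⟩⟩ := h
  refine ⟨⟨(act γ (a, b, c, d)).1, ?_⟩, ⟨(act γ (a, b, c, d)).2.1, ?_⟩,
    ⟨(act γ (a, b, c, d)).2.2.1, ?_⟩, ⟨(act γ (a, b, c, d)).2.2.2, ?_⟩⟩ <;>
  · simp only [act, h1, h2, h3, h4]
    ring

lemma AllD_act_iff {n : ℤ} {y : BCF} {γ : Matrix (Fin 2) (Fin 2) ℤ} (hγ : γ.det = 1) :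
    AllD n (act γ y) ↔ AllD n y := by
  constructor
  · intro h
    have := AllD_act h γ.adjugate
    rwa [act_adj hγ] at this
  · intro h; exact AllD_act h γ

lemma pow_mul_dvd {p a g : ℤ} {i j m : ℕ} (hij : i ≤ j + m) (ha : p ^ j ∣ a) (hg : p ∣ g) :
    p ^ i ∣ a * g ^ m :=
  (pow_dvd_pow p hij).trans (by rw [pow_add]; exact mul_dvd_mul ha (pow_dvd_pow_of_dvd hg m))

/-- Allowed exponents. -/
def WOK (i j k : ℕ) : Prop :=
  i ≤ j + 1 ∧ i ≤ k + 2 ∧ i ≤ 3 ∧ j ≤ i ∧ j ≤ k + 1 ∧ j ≤ 2 ∧ k ≤ i ∧ k ≤ j ∧ k ≤ 1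

lemma W_pres {p i j k : ℕ} (hw : WOK i j k) {σ : Matrix (Fin 2) (Fin 2) ℤ}
    (hσ : (p : ℤ) ∣ σ 0 1) {y : BCF} (h : W p i j k y) : W p i j k (act σ y) := by
  obtain ⟨w1, w2, w3, w4, w5, w6, w7, w8, w9⟩ := hw
  obtain ⟨ha, hb, hc⟩ := h
  obtain ⟨a, b, c, d⟩ := y
  simp only at ha hb hc
  have hd : (p : ℤ) ^ 0 ∣ d := by simp
  have g0 : ∀ {i j : ℕ} {a : ℤ}, i ≤ j → (p : ℤ) ^ j ∣ a → (p : ℤ) ^ i ∣ a :=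
    fun h h' => (pow_dvd_pow _ h).trans h'
  refine ⟨?_, ?_, ?_⟩
  · refine dvd_eq (dvd_add (dvd_add (ha.mul_right (σ.det * σ 0 0 ^ 3))
      ((pow_mul_dvd (m := 1) w1 hb hσ).mul_right (σ.det * σ 0 0 ^ 2)))
      (dvd_add ((pow_mul_dvd (m := 2) w2 hc hσ).mul_right (σ.det * σ 0 0))
      ((pow_mul_dvd (m := 3) (i := i) (by omega) hd hσ).mul_right σ.det))) ?_
    simp only [act]; ring
  · refine dvd_eq (dvd_add (dvd_add ((g0 w4 ha).mul_right (σ.det * 3 * σ 0 0 ^ 2 * σ 1 0))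
      (hb.mul_right (σ.det * (σ 0 0 ^ 2 * σ 1 1 + 2 * σ 0 0 * σ 1 0 * σ 0 1))))
      (dvd_add ((pow_mul_dvd (m := 1) w5 hc hσ).mul_right
        (σ.det * (2 * σ 0 0 * σ 1 1 + σ 1 0 * σ 0 1)))
      ((pow_mul_dvd (m := 2) (i := j) (by omega) hd hσ).mul_right (σ.det * 3 * σ 1 1)))) ?_
    simp only [act]; ring
  · refine dvd_eq (dvd_add (dvd_add ((g0 w7 ha).mul_right (σ.det * 3 * σ 0 0 * σ 1 0 ^ 2))
      ((g0 w8 hb).mul_right (σ.det * (2 * σ 0 0 * σ 1 0 * σ 1 1 + σ 1 0 ^ 2 * σ 0 1))))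
      (dvd_add (hc.mul_right
        (σ.det * (σ 0 0 * σ 1 1 ^ 2 + 2 * σ 1 0 * σ 0 1 * σ 1 1)))
      ((pow_mul_dvd (m := 1) (i := k) (by omega) hd hσ).mul_right (σ.det * 3 * σ 1 1 ^ 2)))) ?_
    simp only [act]; ring

/-! ### Coset representatives -/

/-- Representatives of the projective line over the field with `p` elements. -/
def gam (p r : ℕ) : Matrix (Fin 2) (Fin 2) ℤ :=
  if r < p then !![1, (r : ℤ); 0, 1] else !![0, 1; -1, 0]

lemma gam_det (p r : ℕ) : (gam p r).det = 1 := by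
  unfold gam; split_ifs <;> simp [Matrix.det_fin_two]

lemma exists_slot {p : ℕ} (hp : p.Prime) {γ : Matrix (Fin 2) (Fin 2) ℤ} (hγ : γ.det = 1) :
    ∃ r ∈ Finset.range (p + 1), ∃ σ : Matrix (Fin 2) (Fin 2) ℤ, σ.det = 1 ∧ (p : ℤ) ∣ σ 0 1 ∧
      gam p r = σ * γ := by
  have key : ∀ r, (p : ℤ) ∣ (gam p r * γ.adjugate) 0 1 → ∃ σ : Matrix (Fin 2) (Fin 2) ℤ,
      σ.det = 1 ∧ (p : ℤ) ∣ σ 0 1 ∧ gam p r = σ * γ := fun r h =>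
    ⟨gam p r * γ.adjugate, by rw [Matrix.det_mul, gam_det, det_adj hγ, one_mul], h, by
      rw [Matrix.mul_assoc, adj_mul hγ, Matrix.mul_one]⟩
  by_cases hα : (p : ℤ) ∣ γ 0 0
  · refine ⟨p, by simp, key p ?_⟩
    have : (gam p p * γ.adjugate) 0 1 = γ 0 0 := by
      simp [gam, Matrix.adjugate_fin_two, Matrix.mul_apply, Fin.sum_univ_two]
    rwa [this]
  · haveI : Fact p.Prime := ⟨hp⟩
    have h0 : ((γ 0 0 : ℤ) : ZMod p) ≠ 0 := by rwa [Ne, ZMod.intCast_zmod_eq_zero_iff_dvd]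
    obtain ⟨k, hk⟩ : ∃ k : ZMod p, k = (γ 0 1 : ZMod p) * (γ 0 0 : ZMod p)⁻¹ := ⟨_, rfl⟩
    refine ⟨k.val, by simpa using (ZMod.val_lt k).le.trans (by omega), key _ ?_⟩
    have : (gam p k.val * γ.adjugate) 0 1 = (k.val : ℤ) * γ 0 0 - γ 0 1 := by
      simp [gam, ZMod.val_lt k, Matrix.adjugate_fin_two, Matrix.mul_apply, Fin.sum_univ_two]
      ring
    rw [this, ← ZMod.intCast_zmod_eq_zero_iff_dvd]
    push_cast
    rw [ZMod.natCast_zmod_val, hk]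
    field_simp
    ring

lemma slot_unique {p r s : ℕ} (hr : r ∈ Finset.range (p + 1))
    (hs : s ∈ Finset.range (p + 1)) (hrs : r ≠ s) (hp : p.Prime) :
    ∃ σ : Matrix (Fin 2) (Fin 2) ℤ, σ.det = 1 ∧ ¬ (p : ℤ) ∣ σ 0 1 ∧ gam p s = σ * gam p r := by
  refine ⟨gam p s * (gam p r).adjugate, by
    rw [Matrix.det_mul, gam_det, det_adj (gam_det _ _), one_mul], ?_, by
    rw [Matrix.mul_assoc, adj_mul (gam_det _ _), Matrix.mul_one]⟩
  rw [Finset.mem_range] at hr hs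
  have h1 : ¬ (p : ℤ) ∣ 1 := by
    intro h; exact hp.one_lt.ne' (by exact_mod_cast Int.eq_one_of_dvd_one (by positivity) h)
  by_cases h2 : r < p <;> by_cases h3 : s < p
  · have : (gam p s * (gam p r).adjugate) 0 1 = (s : ℤ) - r := by
      simp [gam, h2, h3, Matrix.adjugate_fin_two, Matrix.mul_apply, Fin.sum_univ_two]
      ring
    rw [this]
    intro h
    have := Int.eq_zero_of_abs_lt_dvd h (by rw [abs_lt]; constructor <;> linarith)
    omega
  · have : (gam p s * (gam p r).adjugate) 0 1 = 1 := by
      simp [gam, h2, h3, Matrix.adjugate_fin_two, Matrix.mul_apply, Fin.sum_univ_two]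
    rwa [this]
  · have : (gam p s * (gam p r).adjugate) 0 1 = -1 := by
      simp [gam, h2, h3, Matrix.adjugate_fin_two, Matrix.mul_apply, Fin.sum_univ_two]
    rwa [this, dvd_neg]
  · omega

/-! ### The pointwise identity -/

/-- The union of the two local conditions. -/
def LT (p : ℕ) (y : BCF) : Prop := W p 2 1 0 y ∨ W p 1 1 1 y

lemma LT_ab {p : ℕ} {y : BCF} (h : LT p y) : (p : ℤ) ∣ y.1 ∧ (p : ℤ) ∣ y.2.1 := by
  rcases h with ⟨h1, h2, -⟩ | ⟨h1, h2, -⟩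
  · exact ⟨(dvd_pow_self _ (by norm_num)).trans h1, by simpa using h2⟩
  · exact ⟨by simpa using h1, by simpa using h2⟩

lemma LT_unique {p : ℕ} (hp : p.Prime) {y : BCF} (hy : ¬ AllD p y) {r s : ℕ}
    (hr : r ∈ Finset.range (p + 1)) (hs : s ∈ Finset.range (p + 1))
    (h1 : LT p (act (gam p r) y)) (h2 : LT p (act (gam p s) y)) : r = s := by
  by_contra hrs
  obtain ⟨σ, hσ1, hσ, he⟩ := slot_unique hr hs hrs hp
  rw [he, act_mul] at h2
  apply hy
  rw [← AllD_act_iff (gam_det p r)]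
  obtain ⟨ha, hb⟩ := LT_ab h1
  obtain ⟨ha', hb'⟩ := LT_ab h2
  obtain ⟨⟨a, b, c, d⟩, hz⟩ : ∃ z, z = act (gam p r) y := ⟨_, rfl⟩
  rw [← hz] at ha hb ha' hb' ⊢
  simp only at ha hb
  have hpp : Prime (p : ℤ) := Nat.prime_iff_prime_int.1 hp
  have hdet : σ 0 0 * σ 1 1 - σ 0 1 * σ 1 0 = 1 := by rw [← Matrix.det_fin_two, hσ1]
  simp only [act, hσ1] at ha' hb'
  have e1 : (p : ℤ) ∣ σ 0 1 ^ 2 * (c * σ 0 0 + d * σ 0 1) := by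
    refine dvd_eq (dvd_sub ha' (dvd_add (ha.mul_right (σ 0 0 ^ 3))
      (hb.mul_right (σ 0 0 ^ 2 * σ 0 1)))) ?_
    ring
  have e2 : (p : ℤ) ∣ c * σ 0 0 + d * σ 0 1 :=
    (hpp.dvd_or_dvd e1).resolve_left (fun h => hσ (hpp.dvd_of_dvd_pow h))
  have e3 : (p : ℤ) ∣ σ 0 1 * c := by
    refine dvd_eq (dvd_sub (dvd_sub (e2.mul_right (3 * σ 0 1 * σ 1 1)) hb')
      (dvd_neg.2 (dvd_add (ha.mul_right (3 * σ 0 0 ^ 2 * σ 1 0))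
        (hb.mul_right (σ 0 0 ^ 2 * σ 1 1 + 2 * σ 0 0 * σ 1 0 * σ 0 1))))) ?_
    linear_combination (- c * σ 0 1) * hdet
  have hc := (hpp.dvd_or_dvd e3).resolve_left hσ
  have hd : (p : ℤ) ∣ σ 0 1 * d :=
    dvd_eq (dvd_sub e2 (hc.mul_right (σ 0 0))) (by ring)
  exact ⟨ha, hb, hc, (hpp.dvd_or_dvd hd).resolve_left hσ⟩

lemma W10_iff {p : ℕ} {y : BCF} : W p 2 1 0 y ↔ ((p:ℤ) ^ 2 ∣ y.1 ∧ (p:ℤ) ∣ y.2.1) := by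
  simp [W]

lemma cube_slot {p : ℕ} (hp : p.Prime) {y : BCF}
    (h : ∃ s l₁ l₂ : ZMod p,
    (y.1 : ZMod p) = s * l₁ ^ 3 ∧ (y.2.1 : ZMod p) = 3 * s * l₁ ^ 2 * l₂ ∧
    (y.2.2.1 : ZMod p) = 3 * s * l₁ * l₂ ^ 2 ∧ (y.2.2.2 : ZMod p) = s * l₂ ^ 3) :
    ∃ r ∈ Finset.range (p + 1), W p 1 1 1 (act (gam p r) y) := by
  haveI : Fact p.Prime := ⟨hp⟩
  obtain ⟨a, b, c, d⟩ := y
  obtain ⟨s, l1, l2, h1, h2, h3, h4⟩ := h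
  simp only at h1 h2 h3 h4
  by_cases hl : l2 = 0
  · refine ⟨p, by simp, ?_⟩
    simp only [W, pow_one, ← ZMod.intCast_zmod_eq_zero_iff_dvd]
    simp [act, gam, Matrix.det_fin_two, h2, h3, h4, hl]
  · obtain ⟨k, hk⟩ : ∃ k : ZMod p, k = -l1 * l2⁻¹ := ⟨_, rfl⟩
    have hk' : l1 + l2 * k = 0 := by rw [hk]; field_simp; ring
    refine ⟨k.val, by simpa using (ZMod.val_lt k).le.trans (by omega), ?_⟩
    simp only [W, pow_one, ← ZMod.intCast_zmod_eq_zero_iff_dvd]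
    simp only [act, gam, ZMod.val_lt k, if_true, Matrix.det_fin_two, Matrix.of_apply,
      Matrix.cons_val', Matrix.cons_val_zero, Matrix.cons_val_one, Matrix.cons_val_fin_one]
    push_cast
    rw [ZMod.natCast_zmod_val, h1, h2, h3, h4]
    refine ⟨?_, ?_, ?_⟩
    · linear_combination (s * (l1 + l2 * k) ^ 2) * hk'
    · linear_combination (3 * s * l2 * (l1 + l2 * k)) * hk'
    · linear_combination (3 * s * l2 ^ 2) * hk'

lemma slot_cube {p : ℕ} (hp : p.Prime) {y : BCF} {r : ℕ}
    (h : W p 1 1 1 (act (gam p r) y)) : ∃ s l₁ l₂ : ZMod p,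
    (y.1 : ZMod p) = s * l₁ ^ 3 ∧ (y.2.1 : ZMod p) = 3 * s * l₁ ^ 2 * l₂ ∧
    (y.2.2.1 : ZMod p) = 3 * s * l₁ * l₂ ^ 2 ∧ (y.2.2.2 : ZMod p) = s * l₂ ^ 3 := by
  haveI : Fact p.Prime := ⟨hp⟩
  obtain ⟨a, b, c, d⟩ := y
  simp only [W, pow_one, ← ZMod.intCast_zmod_eq_zero_iff_dvd] at h
  by_cases hr : r < p
  · simp only [act, gam, hr, if_true, Matrix.det_fin_two, Matrix.of_apply,
      Matrix.cons_val', Matrix.cons_val_zero, Matrix.cons_val_one, Matrix.cons_val_fin_one] at h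
    push_cast at h
    obtain ⟨h1, h2, h3⟩ := h
    have e3 : (c : ZMod p) = -3 * d * r := by linear_combination h3
    have e2 : (b : ZMod p) = 3 * d * r ^ 2 := by linear_combination h2 - 2 * r * e3
    have e1 : (a : ZMod p) = - d * r ^ 3 := by linear_combination h1 - r * e2 - r ^ 2 * e3
    refine ⟨d, -r, 1, ?_, ?_, ?_, ?_⟩
    · rw [e1]; ring
    · rw [e2]; ring
    · rw [e3]; ring
    · ring
  · simp [act, gam, hr, Matrix.det_fin_two] at h
    obtain ⟨h1, h2, h3⟩ := h
    exact ⟨a, 1, 0, by simp, by simp [h3], by simp [h2], by simp [h1]⟩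

lemma inVp_iff_slot {p : ℕ} (hp : p.Prime) {y : BCF} (hy : ¬ AllD p y) :
    ¬ inVp p y ↔ ∃ r ∈ Finset.range (p + 1), LT p (act (gam p r) y) := by
  constructor
  · intro h
    unfold inVp at h
    by_cases hU : inUp p y
    · have h' : ∃ s l₁ l₂ : ZMod p,
          (y.1 : ZMod p) = s * l₁ ^ 3 ∧ (y.2.1 : ZMod p) = 3 * s * l₁ ^ 2 * l₂ ∧
          (y.2.2.1 : ZMod p) = 3 * s * l₁ * l₂ ^ 2 ∧ (y.2.2.2 : ZMod p) = s * l₂ ^ 3 := by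
        by_contra h'; exact h ⟨hU, h'⟩
      obtain ⟨r, hr, h2⟩ := cube_slot hp h'
      exact ⟨r, hr, Or.inr h2⟩
    · have h1 : ∃ γ : Matrix (Fin 2) (Fin 2) ℤ, (γ.det = 1 ∨ γ.det = -1) ∧
          W p 2 1 0 (act γ y) := by
        by_contra h1
        push Not at h1
        exact hU ⟨hy, fun γ hγ h => h1 γ hγ (W10_iff.2 h)⟩
      have h2 : ∃ γ : Matrix (Fin 2) (Fin 2) ℤ, γ.det = 1 ∧ W p 2 1 0 (act γ y) := by
        obtain ⟨γ, hγ | hγ, h⟩ := h1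
        · exact ⟨γ, hγ, h⟩
        · refine ⟨!![1, 0; 0, -1] * γ, by rw [Matrix.det_mul, hγ]; simp [Matrix.det_fin_two], ?_⟩
          rw [act_mul]
          exact W_pres (by simp [WOK]) (by simp) h
      obtain ⟨γ, hγ, h⟩ := h2
      obtain ⟨r, hr, σ, hσ1, hσ, he⟩ := exists_slot hp hγ
      refine ⟨r, hr, Or.inl ?_⟩
      rw [he, act_mul]
      exact W_pres (by simp [WOK]) hσ h
  · rintro ⟨r, hr, h | h⟩ hV
    · exact hV.1.2 (gam p r) (Or.inl (gam_det _ _)) (W10_iff.1 h)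
    · exact hV.2 (slot_cube hp h)

lemma pointwise {p : ℕ} (hp : p.Prime) (y : BCF) :
    (if outVpAll p y then 1 else 0 : ℂ) =
      ∑ r ∈ Finset.range (p + 1), (if LT p (act (gam p r) y) then 1 else 0) -
        p * (if AllD p y then 1 else 0) := by
  have h0 : outVpAll p y ↔ ¬ inVp p y := by
    constructor
    · intro h; exact h p hp dvd_rfl
    · intro h l hl hd; rw [(Nat.prime_dvd_prime_iff_eq hl hp).1 hd]; exact h
  rw [h0]
  by_cases hy : AllD p y
  · have h1 : ¬ inVp p y := fun h => h.1.1 hy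
    have h2 : ∀ r, LT p (act (gam p r) y) := fun r => by
      obtain ⟨a1, a2, a3, -⟩ := AllD_act hy (gam p r)
      exact Or.inr ⟨by simpa using a1, by simpa using a2, by simpa using a3⟩
    simp [h1, h2, hy]
  · rw [inVp_iff_slot hp hy]
    simp only [hy, if_false, mul_zero, sub_zero]
    split_ifs with h
    · obtain ⟨r, hr, h⟩ := h
      rw [Finset.sum_eq_single r, if_pos h]
      · intro s hs hsr
        rw [if_neg]
        intro h'
        exact hsr (LT_unique hp hy hs hr h' h)
      · intro h'; exact absurd hr h'
    · push Not at h
      rw [Finset.sum_eq_zero]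
      intro r hr
      rw [if_neg (h r hr)]

end BCF

namespace BCF

/-! ### Fourier transforms of lattices -/

/-- `N`-periodic predicates. -/
def Per (N : ℕ) (H : BCF → Prop) : Prop := ∀ x y, CongF N x y → (H x ↔ H y)

lemma four_sub {N : ℕ} (hN : N ≠ 0) {H : BCF → Prop} (hper : Per N H)
    (hadd : ∀ y h, H h → (H (addF y h) ↔ H y)) (x : BCF) :
    four N H x = 0 ∨ ∀ h, H h → (N : ℤ) ∣ pairZ x h := by
  by_cases hc : ∀ h, H h → (N : ℤ) ∣ pairZ x h
  · exact Or.inr hc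
  · left
    push Not at hc
    obtain ⟨h, hh, hd⟩ := hc
    have h1 : chi N (pairZ x h) ≠ 1 := fun e => hd ((chi_eq_one_iff hN _).1 e)
    have h2 : four N H x = four N H x * chi N (pairZ x h) := by
      have e := sum_box hN (box N) (fun y => addF y h)
        (fun y => (if H y then 1 else 0) * chi N (pairZ x y))
        (fun y y' hy => by rw [chi_cong hN hy, if_congr (hper _ _ hy) rfl rfl])
        (fun i hi j hj hij => box_eq hi hj (by
          obtain ⟨a1, a2, a3, a4⟩ := hij
          simp only [addF, add_sub_add_right_eq_sub] at a1 a2 a3 a4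
          exact ⟨a1, a2, a3, a4⟩)) (card_box N)
      unfold four
      refine e.symm.trans ?_
      rw [Finset.sum_mul]
      refine Finset.sum_congr rfl fun y _ => ?_
      simp only [pairZ_add, chi_add]
      rw [if_congr (hadd y h hh) rfl rfl]
      ring
    have h3 : four N H x * (chi N (pairZ x h) - 1) = 0 := by linear_combination -h2
    exact (mul_eq_zero.1 h3).resolve_right (sub_ne_zero.2 h1)

lemma four_norm (N : ℕ) (H : BCF → Prop) (x : BCF) :
    ‖four N H x‖ ≤ (((box N).filter H).card : ℝ) := by
  unfold four
  refine (norm_sum_le _ _).trans ?_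
  rw [Finset.card_filter]
  push_cast
  refine Finset.sum_le_sum fun y _ => ?_
  rw [norm_mul, norm_chi, mul_one]
  split_ifs <;> simp

lemma four_act {N : ℕ} (hN : N ≠ 0) {P : BCF → Prop} (hper : Per N P) {x : BCF} (hx : inDual x)
    {γ : Matrix (Fin 2) (Fin 2) ℤ} (hγ : γ.det = 1) :
    four N (fun y => P (act γ y)) x = four N P (act γ x) := by
  have e := sum_box hN (box N) (fun y => act γ y)
    (fun y => (if P y then 1 else 0) * chi N (pairZ (act γ x) y))
    (fun y y' hy => by rw [chi_cong hN hy, if_congr (hper _ _ hy) rfl rfl])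
    (fun i hi j hj hij => box_eq hi hj (by
      have := act_cong hij γ.adjugate
      rwa [act_adj hγ, act_adj hγ] at this)) (card_box N)
  unfold four
  rw [← e]
  refine Finset.sum_congr rfl fun y _ => ?_
  rw [pairZ_act hx y hγ]

lemma W_per {p i j k : ℕ} (hi : i ≤ 2) (hj : j ≤ 2) (hk : k ≤ 2) : Per (p ^ 2) (W p i j k) := by
  intro x y h
  obtain ⟨h1, h2, h3, -⟩ := h
  have hd : ∀ {i : ℕ}, i ≤ 2 → (p : ℤ) ^ i ∣ ((p ^ 2 : ℕ) : ℤ) := fun h => by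
    push_cast; exact pow_dvd_pow _ h
  unfold W
  rw [dvd_cong (hd hi) h1, dvd_cong (hd hj) h2, dvd_cong (hd hk) h3]

lemma AllD_per {p : ℕ} : Per (p ^ 2) (AllD p) := by
  intro x y h
  obtain ⟨h1, h2, h3, h4⟩ := h
  have hd : (p : ℤ) ∣ ((p ^ 2 : ℕ) : ℤ) := by
    push_cast; exact dvd_pow_self _ (by norm_num)
  unfold AllD
  rw [dvd_cong hd h1, dvd_cong hd h2, dvd_cong hd h3, dvd_cong hd h4]

lemma W_add {p i j k : ℕ} (y h : BCF) (hh : W p i j k h) : W p i j k (addF y h) ↔ W p i j k y := by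
  obtain ⟨h1, h2, h3⟩ := hh
  simp only [W, addF]
  rw [dvd_add_left h1, dvd_add_left h2, dvd_add_left h3]

lemma AllD_add {n : ℤ} (y h : BCF) (hh : AllD n h) : AllD n (addF y h) ↔ AllD n y := by
  obtain ⟨h1, h2, h3, h4⟩ := hh
  simp only [AllD, addF]
  rw [dvd_add_left h1, dvd_add_left h2, dvd_add_left h3, dvd_add_left h4]

lemma card_dvd {p i m : ℕ} (hp : 0 < p) :
    ((Finset.Ico (0 : ℤ) ((p ^ (i + m) : ℕ) : ℤ)).filter (fun a => (p : ℤ) ^ i ∣ a)).card ≤ p ^ m := by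
  have hp' : (0 : ℤ) < (p : ℤ) ^ i := by positivity
  have : (Finset.Ico (0 : ℤ) ((p ^ (i + m) : ℕ) : ℤ)).filter (fun a => (p : ℤ) ^ i ∣ a) ⊆
      (Finset.Ico (0 : ℤ) ((p ^ m : ℕ) : ℤ)).image (fun t => (p : ℤ) ^ i * t) := by
    intro a ha
    rw [Finset.mem_filter, Finset.mem_Ico] at ha
    obtain ⟨⟨h1, h2⟩, t, rfl⟩ := ha
    rw [Finset.mem_image]
    refine ⟨t, ?_, rfl⟩
    rw [Finset.mem_Ico]
    constructor
    · by_contra h; push Not at h; nlinarith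
    · push_cast at h2 ⊢
      rw [pow_add] at h2
      exact lt_of_mul_lt_mul_left h2 hp'.le
  refine (Finset.card_le_card this).trans (Finset.card_image_le.trans ?_)
  simp

lemma card_W {p i j k i' j' k' : ℕ} (hp : 0 < p) (hi : i + i' = 2) (hj : j + j' = 2)
    (hk : k + k' = 2) :
    ((box (p ^ 2)).filter (W p i j k)).card ≤ p ^ (i' + j' + k' + 2) := by
  have hsub : (box (p ^ 2)).filter (W p i j k) ⊆
      ((Finset.Ico (0 : ℤ) ((p ^ 2 : ℕ) : ℤ)).filter (fun a => (p : ℤ) ^ i ∣ a)) ×ˢ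
      ((Finset.Ico (0 : ℤ) ((p ^ 2 : ℕ) : ℤ)).filter (fun a => (p : ℤ) ^ j ∣ a)) ×ˢ
      ((Finset.Ico (0 : ℤ) ((p ^ 2 : ℕ) : ℤ)).filter (fun a => (p : ℤ) ^ k ∣ a)) ×ˢ
      (Finset.Ico (0 : ℤ) ((p ^ 2 : ℕ) : ℤ)) := by
    intro y hy
    rw [Finset.mem_filter] at hy
    obtain ⟨h1, h2⟩ := hy
    simp only [box, Finset.mem_product] at h1
    simp only [Finset.mem_product, Finset.mem_filter]
    exact ⟨⟨h1.1, h2.1⟩, ⟨h1.2.1, h2.2.1⟩, ⟨h1.2.2.1, h2.2.2⟩, h1.2.2.2⟩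
  refine (Finset.card_le_card hsub).trans ?_
  rw [Finset.card_product, Finset.card_product, Finset.card_product]
  have c1 := card_dvd (p := p) (i := i) (m := i') hp
  have c2 := card_dvd (p := p) (i := j) (m := j') hp
  have c3 := card_dvd (p := p) (i := k) (m := k') hp
  rw [hi] at c1; rw [hj] at c2; rw [hk] at c3
  have c4 : (Finset.Ico (0 : ℤ) ((p ^ 2 : ℕ) : ℤ)).card ≤ p ^ 2 := by simp
  calc _ ≤ p ^ i' * (p ^ j' * (p ^ k' * p ^ 2)) :=
        Nat.mul_le_mul c1 (Nat.mul_le_mul c2 (Nat.mul_le_mul c3 c4))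
    _ = _ := by ring

lemma card_AllD {p : ℕ} (hp : 0 < p) : ((box (p ^ 2)).filter (AllD p)).card ≤ p ^ 4 := by
  have hsub : (box (p ^ 2)).filter (AllD p) ⊆
      ((Finset.Ico (0 : ℤ) ((p ^ 2 : ℕ) : ℤ)).filter (fun a => (p : ℤ) ^ 1 ∣ a)) ×ˢ
      ((Finset.Ico (0 : ℤ) ((p ^ 2 : ℕ) : ℤ)).filter (fun a => (p : ℤ) ^ 1 ∣ a)) ×ˢ
      ((Finset.Ico (0 : ℤ) ((p ^ 2 : ℕ) : ℤ)).filter (fun a => (p : ℤ) ^ 1 ∣ a)) ×ˢ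
      ((Finset.Ico (0 : ℤ) ((p ^ 2 : ℕ) : ℤ)).filter (fun a => (p : ℤ) ^ 1 ∣ a)) := by
    intro y hy
    rw [Finset.mem_filter] at hy
    obtain ⟨h1, h2⟩ := hy
    simp only [box, Finset.mem_product] at h1
    simp only [Finset.mem_product, Finset.mem_filter, pow_one]
    exact ⟨⟨h1.1, h2.1⟩, ⟨h1.2.1, h2.2.1⟩, ⟨h1.2.2.1, h2.2.2.1⟩, h1.2.2.2, h2.2.2.2⟩
  refine (Finset.card_le_card hsub).trans ?_
  rw [Finset.card_product, Finset.card_product, Finset.card_product]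
  have c1 := card_dvd (p := p) (i := 1) (m := 1) hp
  norm_num at c1
  norm_num
  calc _ ≤ p * (p * (p * p)) :=
        Nat.mul_le_mul c1 (Nat.mul_le_mul c1 (Nat.mul_le_mul c1 c1))
    _ = _ := by ring

lemma dvd_third {n x : ℤ} (hx : (3 : ℤ) ∣ x) (h : n ∣ x / 3) : n ∣ x := by
  rw [← Int.mul_ediv_cancel' hx]; exact h.mul_left 3

lemma dvd_cancel_p {p : ℕ} (hp : p ≠ 0) {t : ℤ} (h : ((p ^ 2 : ℕ) : ℤ) ∣ t * p) : (p : ℤ) ∣ t := by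
  have h0 : (p : ℤ) ≠ 0 := by exact_mod_cast hp
  push_cast at h
  rw [pow_two] at h
  exact Int.dvd_of_mul_dvd_mul_right h0 h

lemma perp1 {p : ℕ} {x : BCF} (h : ((p ^ 2 : ℕ) : ℤ) ∣ pairZ x (0, 0, 0, 1)) :
    (p : ℤ) ^ 2 ∣ x.1 := by
  simp only [pairZ] at h
  push_cast at h
  exact (dvd_neg.1 (dvd_eq h (by ring)))

lemma perp2 {p : ℕ} (hp : p ≠ 0) {x : BCF} (hx : inDual x)
    (h : ((p ^ 2 : ℕ) : ℤ) ∣ pairZ x (0, 0, (p : ℤ), 0)) : (p : ℤ) ∣ x.2.1 := by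
  simp only [pairZ] at h
  exact dvd_third hx.1 (dvd_cancel_p hp (dvd_eq h (by ring)))

lemma perp3 {p : ℕ} (hp : p ≠ 0) {x : BCF} (hx : inDual x)
    (h : ((p ^ 2 : ℕ) : ℤ) ∣ pairZ x (0, (p : ℤ), 0, 0)) : (p : ℤ) ∣ x.2.2.1 := by
  simp only [pairZ] at h
  exact dvd_third hx.2 (dvd_cancel_p hp (dvd_eq (dvd_neg.2 h) (by ring)))

lemma perp4 {p : ℕ} (hp : p ≠ 0) {x : BCF}
    (h : ((p ^ 2 : ℕ) : ℤ) ∣ pairZ x ((p : ℤ), 0, 0, 0)) : (p : ℤ) ∣ x.2.2.2 := by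
  simp only [pairZ] at h
  exact (dvd_cancel_p hp (dvd_eq h (by ring)))

lemma four_L {p : ℕ} (hp : p ≠ 0) {x : BCF} (hx : inDual x) :
    ‖four (p ^ 2) (W p 2 1 0) x‖ ≤ (p : ℝ) ^ 5 * (if W p 2 2 1 x then 1 else 0) := by
  rcases four_sub (pow_ne_zero 2 hp) (W_per (p := p) (i := 2) (j := 1) (k := 0) (by norm_num)
    (by norm_num) (by norm_num)) W_add x with h | h
  · rw [h, norm_zero]; positivity
  · rw [if_pos, mul_one]
    · refine (four_norm _ _ _).trans ?_
      exact_mod_cast card_W (p := p) (i := 2) (j := 1) (k := 0) (i' := 0) (j' := 1) (k' := 2)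
        (Nat.pos_of_ne_zero hp) (by norm_num) (by norm_num) (by norm_num)
    · refine ⟨perp1 (h _ (by simp [W])), ?_, by simpa using perp3 hp hx (h _ (by simp [W]))⟩
      have h2 := h (0, 0, 1, 0) (by simp [W])
      simp only [pairZ] at h2
      push_cast at h2
      exact dvd_third hx.1 (dvd_eq h2 (by ring))

lemma four_T {p : ℕ} (hp : p ≠ 0) {x : BCF} (hx : inDual x) :
    ‖four (p ^ 2) (W p 1 1 1) x‖ ≤
      (p : ℝ) ^ 5 * (if AllD p x ∧ (p : ℤ) ^ 2 ∣ x.1 then 1 else 0) := by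
  rcases four_sub (pow_ne_zero 2 hp) (W_per (p := p) (i := 1) (j := 1) (k := 1) (by norm_num)
    (by norm_num) (by norm_num)) W_add x with h | h
  · rw [h, norm_zero]; positivity
  · rw [if_pos, mul_one]
    · refine (four_norm _ _ _).trans ?_
      exact_mod_cast card_W (p := p) (i := 1) (j := 1) (k := 1) (i' := 1) (j' := 1) (k' := 1)
        (Nat.pos_of_ne_zero hp) (by norm_num) (by norm_num) (by norm_num)
    · have h1 := perp1 (h _ (by simp [W]))
      exact ⟨⟨(dvd_pow_self _ (by norm_num)).trans h1, perp2 hp hx (h _ (by simp [W])),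
        perp3 hp hx (h _ (by simp [W])), perp4 hp (h _ (by simp [W]))⟩, h1⟩

lemma four_LT {p : ℕ} (hp : p ≠ 0) {x : BCF} (hx : inDual x) :
    ‖four (p ^ 2) (W p 2 1 1) x‖ ≤ (p : ℝ) ^ 4 * (if W p 2 1 1 x then 1 else 0) := by
  rcases four_sub (pow_ne_zero 2 hp) (W_per (p := p) (i := 2) (j := 1) (k := 1) (by norm_num)
    (by norm_num) (by norm_num)) W_add x with h | h
  · rw [h, norm_zero]; positivity
  · rw [if_pos, mul_one]
    · refine (four_norm _ _ _).trans ?_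
      exact_mod_cast card_W (p := p) (i := 2) (j := 1) (k := 1) (i' := 0) (j' := 1) (k' := 1)
        (Nat.pos_of_ne_zero hp) (by norm_num) (by norm_num) (by norm_num)
    · exact ⟨perp1 (h _ (by simp [W])), by simpa using perp2 hp hx (h _ (by simp [W])),
        by simpa using perp3 hp hx (h _ (by simp [W]))⟩

lemma four_p {p : ℕ} (hp : p ≠ 0) {x : BCF} (hx : inDual x) :
    ‖four (p ^ 2) (AllD p) x‖ ≤ (p : ℝ) ^ 4 * (if AllD p x then 1 else 0) := by
  rcases four_sub (pow_ne_zero 2 hp) AllD_per AllD_add x with h | h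
  · rw [h, norm_zero]; positivity
  · rw [if_pos, mul_one]
    · refine (four_norm _ _ _).trans ?_
      exact_mod_cast card_AllD (Nat.pos_of_ne_zero hp)
    · refine ⟨?_, perp2 hp hx (h _ (by simp [AllD])),
        perp3 hp hx (h _ (by simp [AllD])), perp4 hp (h _ (by simp [AllD]))⟩
      have h1 := h (0, 0, 0, p) (by simp [AllD])
      simp only [pairZ] at h1
      exact dvd_neg.1 (dvd_cancel_p hp (dvd_eq h1 (by ring)))

lemma LT_per {p : ℕ} : Per (p ^ 2) (LT p) := by
  intro x y h
  unfold LT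
  rw [W_per (by norm_num) (by norm_num) (by norm_num) x y h,
    W_per (by norm_num) (by norm_num) (by norm_num) x y h]

lemma four_split {p : ℕ} (x : BCF) : four (p ^ 2) (LT p) x =
    four (p ^ 2) (W p 2 1 0) x + four (p ^ 2) (W p 1 1 1) x - four (p ^ 2) (W p 2 1 1) x := by
  unfold four
  rw [← Finset.sum_add_distrib, ← Finset.sum_sub_distrib]
  refine Finset.sum_congr rfl fun y _ => ?_
  have h : W p 2 1 1 y ↔ W p 2 1 0 y ∧ W p 1 1 1 y := by
    simp only [W, pow_one, pow_zero, one_dvd]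
    have : (p : ℤ) ^ 2 ∣ y.1 → (p : ℤ) ∣ y.1 := (dvd_pow_self _ (by norm_num)).trans
    tauto
  simp only [LT, h]
  by_cases h1 : W p 2 1 0 y <;> by_cases h2 : W p 1 1 1 y <;> simp [h1, h2]

lemma four_main {p : ℕ} (hp : p.Prime) {x : BCF} (hx : inDual x) :
    ‖four (p ^ 2) (outVpAll p) x‖ ≤ ∑ r ∈ Finset.range (p + 1),
      ((p : ℝ) ^ 5 * (if W p 2 2 1 (act (gam p r) x) then 1 else 0) +
       (p : ℝ) ^ 5 * (if AllD p x ∧ (p : ℤ) ^ 2 ∣ (act (gam p r) x).1 then 1 else 0) +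
       (p : ℝ) ^ 4 * (if W p 2 1 1 (act (gam p r) x) then 1 else 0)) +
      (p : ℝ) ^ 5 * (if AllD p x then 1 else 0) := by
  have hp0 := hp.ne_zero
  have e : four (p ^ 2) (outVpAll p) x =
      ∑ r ∈ Finset.range (p + 1), four (p ^ 2) (LT p) (act (gam p r) x) -
        p * four (p ^ 2) (AllD p) x := by
    have e1 : ∀ r, four (p ^ 2) (LT p) (act (gam p r) x) =
        four (p ^ 2) (fun y => LT p (act (gam p r) y)) x := fun r =>
      (four_act (pow_ne_zero 2 hp0) LT_per hx (gam_det p r)).symm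
    simp only [e1]
    unfold four
    rw [Finset.sum_comm, Finset.mul_sum, ← Finset.sum_sub_distrib]
    refine Finset.sum_congr rfl fun y _ => ?_
    rw [pointwise hp, sub_mul, Finset.sum_mul, mul_assoc]
  rw [e]
  refine (norm_sub_le _ _).trans (add_le_add ((norm_sum_le _ _).trans
    (Finset.sum_le_sum fun r _ => ?_)) ?_)
  · rw [four_split]
    have hx' := inDual_act hx (gam p r)
    refine (norm_sub_le _ _).trans (add_le_add ((norm_add_le _ _).trans
      (add_le_add (four_L hp0 hx') ?_)) (four_LT hp0 hx'))
    have := four_T hp0 hx'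
    rwa [AllD_act_iff (gam_det p r)] at this
  · rw [norm_mul, Complex.norm_natCast]
    calc _ ≤ (p : ℝ) * ((p : ℝ) ^ 4 * (if AllD p x then 1 else 0)) := by
          gcongr; exact four_p hp0 hx
      _ = _ := by ring

end BCF

namespace BCF

/-! ### Local bounds -/

lemma W221_211 {p : ℕ} {x : BCF} (h : W p 2 2 1 x) : W p 2 1 1 x :=
  ⟨h.1, (pow_dvd_pow _ (by norm_num)).trans h.2.1, h.2.2⟩

lemma norm_loc {p : ℕ} (hp : p.Prime) {x : BCF} (hx : inDual x) {B : ℝ} {k m : ℕ} (hkm : m + k = 8)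
    (h : ‖four (p ^ 2) (outVpAll p) x‖ ≤ B * (p : ℝ) ^ m) :
    ‖PhiHat' p x‖ ≤ B / (p : ℝ) ^ k := by
  have h0 : (0 : ℝ) < p := by exact_mod_cast hp.pos
  rw [PhiHat'_eq hx, norm_mul, norm_inv, norm_pow, Complex.norm_natCast]
  calc _ ≤ ((p : ℝ) ^ 8)⁻¹ * (B * (p : ℝ) ^ m) := by gcongr
    _ = _ := by rw [← hkm, pow_add]; field_simp

lemma loc_A {p : ℕ} (hp : p.Prime) {x : BCF} (hx : inDual x) :
    ‖PhiHat' p x‖ ≤ 20 / (p : ℝ) ^ 2 := by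
  refine norm_loc hp hx (m := 6) (by norm_num) ((four_main hp hx).trans ?_)
  have h1 : (1 : ℝ) ≤ p := by exact_mod_cast hp.one_lt.le
  have hi : ∀ (P : Prop) [Decidable P], (if P then (1 : ℝ) else 0) ≤ 1 := fun P _ => by split_ifs <;> norm_num
  calc _ ≤ ∑ r ∈ Finset.range (p + 1), ((p : ℝ) ^ 5 * 1 + (p : ℝ) ^ 5 * 1 + (p : ℝ) ^ 4 * 1)
        + (p : ℝ) ^ 5 * 1 := by
        gcongr <;> exact hi _
    _ = (p + 1) * (2 * (p : ℝ) ^ 5 + (p : ℝ) ^ 4) + (p : ℝ) ^ 5 := by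
        rw [Finset.sum_const, Finset.card_range, nsmul_eq_mul]; push_cast; ring
    _ ≤ (p + p) * (2 * (p : ℝ) ^ 5 + (p : ℝ) ^ 4 * p) + (p : ℝ) ^ 5 * p := by
        have := mul_le_mul_of_nonneg_left h1 (by positivity : (0:ℝ) ≤ (p : ℝ) ^ 5)
        have := mul_le_mul_of_nonneg_left h1 (by positivity : (0:ℝ) ≤ (p : ℝ) ^ 4)
        gcongr <;> linarith
    _ = 7 * (p : ℝ) ^ 6 := by ring
    _ ≤ _ := by gcongr; norm_num

lemma roots_le {p : ℕ} (hp : p.Prime) {z : BCF} (hz : ¬ AllD p z) :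
    ((Finset.range (p + 1)).filter (fun r => (p : ℤ) ∣ (act (gam p r) z).1)).card ≤ 4 := by
  have : Fact p.Prime := ⟨hp⟩
  obtain ⟨a, b, c, d⟩ := z
  obtain ⟨f, hf⟩ : ∃ f : Polynomial (ZMod p), f = Polynomial.C (d : ZMod p) * Polynomial.X ^ 3 +
    Polynomial.C (c : ZMod p) * Polynomial.X ^ 2 + Polynomial.C (b : ZMod p) * Polynomial.X +
    Polynomial.C (a : ZMod p) := ⟨_, rfl⟩
  have hf0 : f ≠ 0 := by
    intro h0
    apply hz
    simp only [AllD, ← ZMod.intCast_zmod_eq_zero_iff_dvd]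
    have h : ∀ n, f.coeff n = 0 := fun n => by rw [h0]; simp
    have c0 := h 0
    have c1 := h 1
    have c2 := h 2
    have c3 := h 3
    rw [hf] at c0 c1 c2 c3
    clear hf
    generalize (a : ZMod p) = a' at *
    generalize (b : ZMod p) = b' at *
    generalize (c : ZMod p) = c' at *
    generalize (d : ZMod p) = d' at *
    simp [Polynomial.coeff_X, Polynomial.coeff_C, Polynomial.coeff_X_pow,
      Polynomial.coeff_C_mul] at c0 c1 c2 c3
    exact ⟨c0, c1, c2, c3⟩
  have hdeg : f.natDegree ≤ 3 := by rw [hf]; compute_degree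
  rw [Finset.range_add_one, Finset.filter_insert]
  have h3 : ((Finset.range p).filter (fun r => (p : ℤ) ∣ (act (gam p r) (a, b, c, d)).1)).card
      ≤ 3 := by
    have hinj : Set.InjOn (fun r : ℕ => (r : ZMod p)) ((Finset.range p).filter
        (fun r => (p : ℤ) ∣ (act (gam p r) (a, b, c, d)).1)) := by
      intro r hr s hs hrs
      simp only [Finset.coe_filter, Finset.mem_range] at hr hs
      have := (ZMod.natCast_eq_natCast_iff' r s p).1 hrs
      rwa [Nat.mod_eq_of_lt hr.1, Nat.mod_eq_of_lt hs.1] at this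
    rw [← Finset.card_image_of_injOn hinj]
    have hsub : ((Finset.range p).filter
        (fun r => (p : ℤ) ∣ (act (gam p r) (a, b, c, d)).1)).image (fun r : ℕ => (r : ZMod p)) ⊆
        f.roots.toFinset := by
      intro t ht
      rw [Finset.mem_image] at ht
      obtain ⟨r, hr, rfl⟩ := ht
      rw [Finset.mem_filter, Finset.mem_range] at hr
      obtain ⟨hr, hd⟩ := hr
      rw [Multiset.mem_toFinset, Polynomial.mem_roots hf0, Polynomial.IsRoot.def, hf]
      rw [← ZMod.intCast_zmod_eq_zero_iff_dvd] at hd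
      simp only [act, gam, hr, if_true, Matrix.det_fin_two, Matrix.of_apply,
        Matrix.cons_val', Matrix.cons_val_zero, Matrix.cons_val_one, Matrix.cons_val_fin_one] at hd
      push_cast at hd
      simp
      linear_combination hd
    calc _ ≤ f.roots.toFinset.card := Finset.card_le_card hsub
      _ ≤ f.roots.card := Multiset.toFinset_card_le _
      _ ≤ f.natDegree := Polynomial.card_roots' _
      _ ≤ 3 := hdeg
  split_ifs
  · exact (Finset.card_insert_le _ _).trans (by omega)
  · omega

lemma loc_B {p : ℕ} (hp : p.Prime) {x : BCF} (hx : inDual x) (h1 : AllD p x)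
    (h2 : ¬ AllD ((p : ℤ) ^ 2) x) : ‖PhiHat' p x‖ ≤ 20 / (p : ℝ) ^ 3 := by
  refine norm_loc hp hx (m := 5) (by norm_num) ((four_main hp hx).trans ?_)
  have hp1 : (1 : ℝ) ≤ p := by exact_mod_cast hp.one_lt.le
  have hp0 : (p : ℤ) ≠ 0 := by exact_mod_cast hp.ne_zero
  obtain ⟨z, hz⟩ : ∃ z, x = smulF p z := by
    obtain ⟨⟨a, h1⟩, ⟨b, h2⟩, ⟨c, h3⟩, ⟨d, h4⟩⟩ := h1
    exact ⟨(a, b, c, d), Prod.ext h1 (Prod.ext h2 (Prod.ext h3 h4))⟩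
  have hz0 : ¬ AllD p z := by
    rintro ⟨a1, a2, a3, a4⟩
    apply h2
    rw [hz, pow_two]
    exact ⟨mul_dvd_mul_left _ a1, mul_dvd_mul_left _ a2, mul_dvd_mul_left _ a3,
      mul_dvd_mul_left _ a4⟩
  have hroot : ∀ r, (p : ℤ) ^ 2 ∣ (act (gam p r) x).1 → (p : ℤ) ∣ (act (gam p r) z).1 := by
    intro r h
    rw [hz, act_smulF, pow_two] at h
    exact Int.dvd_of_mul_dvd_mul_left hp0 h
  have hcard := roots_le hp hz0
  have hi : ∀ (P Q : Prop) [Decidable P] [Decidable Q], (P → Q) → (if P then (1 : ℝ) else 0) ≤ if Q then 1 else 0 :=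
    fun P Q _ _ h => by
      by_cases hP : P
      · simp [hP, h hP]
      · simp only [hP, if_false]; split_ifs <;> norm_num
  calc _ ≤ ∑ r ∈ Finset.range (p + 1),
        ((p : ℝ) ^ 5 * (if (p : ℤ) ∣ (act (gam p r) z).1 then 1 else 0) +
         (p : ℝ) ^ 5 * (if (p : ℤ) ∣ (act (gam p r) z).1 then 1 else 0) +
         (p : ℝ) ^ 4 * (if (p : ℤ) ∣ (act (gam p r) z).1 then 1 else 0)) + (p : ℝ) ^ 5 * 1 := by
        gcongr with r _
        · exact hi _ _ fun h => hroot r h.1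
        · exact hi _ _ fun h => hroot r h.2
        · exact hi _ _ fun h => hroot r h.1
        · split_ifs; norm_num
    _ = (2 * (p : ℝ) ^ 5 + (p : ℝ) ^ 4) * (((Finset.range (p + 1)).filter
          (fun r => (p : ℤ) ∣ (act (gam p r) z).1)).card : ℝ) + (p : ℝ) ^ 5 := by
        rw [Finset.card_filter]
        push_cast
        rw [Finset.mul_sum, mul_one]
        congr 1
        refine Finset.sum_congr rfl fun r _ => ?_
        ring
    _ ≤ (2 * (p : ℝ) ^ 5 + (p : ℝ) ^ 4 * p) * 4 + (p : ℝ) ^ 5 := by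
        gcongr
        · exact le_mul_of_one_le_right (by positivity) hp1
        · exact_mod_cast hcard
    _ = 13 * (p : ℝ) ^ 5 := by ring
    _ ≤ _ := by gcongr; norm_num

lemma D_unique {p : ℕ} (hp : p.Prime) {x : BCF} (hx : ¬ AllD p x) {r s : ℕ}
    (hr : r ∈ Finset.range (p + 1)) (hs : s ∈ Finset.range (p + 1))
    (h1 : W p 2 1 1 (act (gam p r) x)) (h2 : W p 2 1 1 (act (gam p s) x)) : r = s := by
  refine LT_unique hp hx hr hs (Or.inl ?_) (Or.inl ?_)
  · exact ⟨h1.1, h1.2.1, by simp⟩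
  · exact ⟨h2.1, h2.2.1, by simp⟩

lemma four_main' {p : ℕ} (hp : p.Prime) {x : BCF} (hx : inDual x) (h0 : ¬ AllD p x) :
    ‖four (p ^ 2) (outVpAll p) x‖ ≤ ∑ r ∈ Finset.range (p + 1),
      ((p : ℝ) ^ 5 * (if W p 2 2 1 (act (gam p r) x) then 1 else 0) +
       (p : ℝ) ^ 4 * (if W p 2 1 1 (act (gam p r) x) then 1 else 0)) := by
  have := four_main hp hx
  simp only [h0, false_and, if_false, mul_zero, add_zero] at this
  exact this

lemma loc_0 {p : ℕ} (hp : p.Prime) {x : BCF} (hx : inDual x) (h0 : ¬ AllD p x)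
    (hD : ∀ γ : Matrix (Fin 2) (Fin 2) ℤ, γ.det = 1 → ¬ W p 2 1 1 (act γ x)) :
    ‖PhiHat' p x‖ = 0 := by
  have h := norm_loc hp hx (B := 0) (k := 4) (m := 4) (by norm_num) ((four_main' hp hx h0).trans (by
    refine le_of_eq ?_
    rw [zero_mul]
    refine Finset.sum_eq_zero fun r _ => ?_
    rw [if_neg (fun h => hD _ (gam_det p r) (W221_211 h)), if_neg (hD _ (gam_det p r))]
    ring))
  rw [zero_div] at h
  exact le_antisymm h (norm_nonneg _)

lemma sum_single_le {s : Finset ℕ} {f : ℕ → ℝ} {B : ℝ} (hB : 0 ≤ B) (hle : ∀ r ∈ s, f r ≤ B)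
    {P : ℕ → Prop} (h0 : ∀ r ∈ s, ¬ P r → f r = 0)
    (hu : ∀ r ∈ s, ∀ t ∈ s, P r → P t → r = t) : ∑ r ∈ s, f r ≤ B := by
  by_cases h : ∃ r ∈ s, P r
  · obtain ⟨r, hr, hP⟩ := h
    rw [Finset.sum_eq_single r]
    · exact hle r hr
    · intro t ht htr
      exact h0 t ht (fun hPt => htr (hu t ht r hr hPt hP))
    · intro h; exact absurd hr h
  · push Not at h
    rw [Finset.sum_eq_zero (fun r hr => h0 r hr (h r hr))]
    exact hB

lemma loc_C {p : ℕ} (hp : p.Prime) {x : BCF} (hx : inDual x) (h0 : ¬ AllD p x) :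
    ‖PhiHat' p x‖ ≤ 20 / (p : ℝ) ^ 3 := by
  refine norm_loc hp hx (m := 5) (by norm_num) ((four_main' hp hx h0).trans ?_)
  have hp1 : (1 : ℝ) ≤ p := by exact_mod_cast hp.one_lt.le
  refine sum_single_le (P := fun r => W p 2 1 1 (act (gam p r) x)) (by positivity) ?_ ?_
    (fun r hr s hs h1 h2 => D_unique hp h0 hr hs h1 h2)
  · intro r _
    have hi : ∀ (P : Prop) [Decidable P], (if P then (1 : ℝ) else 0) ≤ 1 := fun P _ => by split_ifs <;> norm_num
    calc _ ≤ (p : ℝ) ^ 5 * 1 + (p : ℝ) ^ 4 * 1 := by gcongr <;> exact hi _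
      _ ≤ (p : ℝ) ^ 5 * 1 + (p : ℝ) ^ 4 * p := by gcongr
      _ = 2 * (p : ℝ) ^ 5 := by ring
      _ ≤ _ := by gcongr; norm_num
  · intro r _ h
    rw [if_neg (fun h' => h (W221_211 h')), if_neg h]
    ring

lemma loc_D {p : ℕ} (hp : p.Prime) {x : BCF} (hx : inDual x) (h0 : ¬ AllD p x)
    (hC : ∀ γ : Matrix (Fin 2) (Fin 2) ℤ, γ.det = 1 → ¬ W p 2 2 1 (act γ x)) :
    ‖PhiHat' p x‖ ≤ 20 / (p : ℝ) ^ 4 := by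
  refine norm_loc hp hx (m := 4) (by norm_num) ((four_main' hp hx h0).trans ?_)
  refine sum_single_le (P := fun r => W p 2 1 1 (act (gam p r) x)) (by positivity) ?_ ?_
    (fun r hr s hs h1 h2 => D_unique hp h0 hr hs h1 h2)
  · intro r _
    have hi : ∀ (P : Prop) [Decidable P], (if P then (1 : ℝ) else 0) ≤ 1 := fun P _ => by split_ifs <;> norm_num
    rw [if_neg (hC _ (gam_det p r)), mul_zero, zero_add]
    calc _ ≤ (p : ℝ) ^ 4 * 1 := by gcongr; exact hi _
      _ = 1 * (p : ℝ) ^ 4 := by ring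
      _ ≤ _ := by gcongr; norm_num
  · intro r _ h
    rw [if_neg (fun h' => h (W221_211 h')), if_neg h]
    ring

end BCF

namespace BCF

/-! ### Gluing local transformations -/

lemma glue_step {p m : ℕ} (hp : p.Prime) (hpm : Nat.Coprime p m) {τ : Matrix (Fin 2) (Fin 2) ℤ}
    (hτ : τ.det = 1) : ∃ σ : Matrix (Fin 2) (Fin 2) ℤ, σ.det = 1 ∧ (m : ℤ) ∣ σ 0 1 ∧
      (p : ℤ) ∣ (σ * τ) 0 1 := by
  have hcop : IsCoprime (p : ℤ) (m : ℤ) := Nat.isCoprime_iff_coprime.2 hpm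
  have hpp : Prime (p : ℤ) := Nat.prime_iff_prime_int.1 hp
  by_cases h : (p : ℤ) ∣ τ 1 1
  · obtain ⟨u, v, huv⟩ := hcop
    refine ⟨!![(p : ℤ), (m : ℤ); -v, u], ?_, by simp, ?_⟩
    · simp [Matrix.det_fin_two]; linarith
    · have : (!![(p : ℤ), (m : ℤ); -v, u] * τ) 0 1 = p * τ 0 1 + m * τ 1 1 := by
        simp [Matrix.mul_apply, Fin.sum_univ_two]
      rw [this]
      exact dvd_add (dvd_mul_right _ _) (h.mul_left _)
  · have h2 : IsCoprime (p : ℤ) (m * τ 1 1) := by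
      refine IsCoprime.mul_right hcop ?_
      rw [Int.isCoprime_iff_gcd_eq_one, ← Int.natAbs_natCast p]
      exact (Nat.Prime.coprime_iff_not_dvd (by simpa using hp)).2
        (by simpa [Int.natCast_dvd] using h)
    obtain ⟨u, v, huv⟩ := h2
    refine ⟨!![1, (m : ℤ) * (-(v * τ 0 1)); 0, 1], by simp [Matrix.det_fin_two], by simp, ?_⟩
    have : (!![1, (m : ℤ) * (-(v * τ 0 1)); 0, 1] * τ) 0 1 = p * (u * τ 0 1) := by
      simp [Matrix.mul_apply, Fin.sum_univ_two]
      linear_combination (-τ 0 1) * huv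
    rw [this]
    exact dvd_mul_right _ _

lemma glue (s : Finset ℕ) (hs : ∀ p ∈ s, p.Prime) (g : ℕ → Matrix (Fin 2) (Fin 2) ℤ)
    (hg : ∀ p ∈ s, (g p).det = 1) : ∃ γ : Matrix (Fin 2) (Fin 2) ℤ, γ.det = 1 ∧
      ∀ p ∈ s, ∃ σ : Matrix (Fin 2) (Fin 2) ℤ, (p : ℤ) ∣ σ 0 1 ∧ γ = σ * g p := by
  induction s using Finset.induction_on with
  | empty => exact ⟨1, by simp, by simp⟩
  | insert p s hps ih =>
    obtain ⟨γ, h1, h2⟩ := ih (fun l hl => hs l (Finset.mem_insert_of_mem hl))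
      (fun l hl => hg l (Finset.mem_insert_of_mem hl))
    have hp := hs p (Finset.mem_insert_self _ _)
    have hgp := hg p (Finset.mem_insert_self _ _)
    have hcop : Nat.Coprime p (∏ l ∈ s, l) := by
      refine Nat.Coprime.prod_right fun l hl => ?_
      exact (Nat.coprime_primes hp (hs l (Finset.mem_insert_of_mem hl))).2
        (fun e => hps (e ▸ hl))
    obtain ⟨σ, hσ1, hσ2, hσ3⟩ := glue_step hp hcop (τ := γ * (g p).adjugate)
      (by rw [Matrix.det_mul, h1, det_adj hgp, one_mul])
    refine ⟨σ * γ, by rw [Matrix.det_mul, hσ1, h1, one_mul], ?_⟩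
    intro l hl
    rw [Finset.mem_insert] at hl
    rcases hl with rfl | hl
    · refine ⟨_, hσ3, ?_⟩
      rw [Matrix.mul_assoc, Matrix.mul_assoc, adj_mul hgp, Matrix.mul_one]
    · obtain ⟨σ', h3, h4⟩ := h2 l hl
      refine ⟨σ * σ', ?_, by rw [h4, Matrix.mul_assoc]⟩
      rw [Matrix.mul_apply, Fin.sum_univ_two]
      refine dvd_add (h3.mul_left _) (Dvd.dvd.mul_right ?_ _)
      refine dvd_trans ?_ hσ2
      exact_mod_cast Finset.dvd_prod_of_mem (fun l => l) hl

/-! ### Local types -/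

/-- Local shape of type `t`. -/
def Loc (p : ℕ) (t : Fin 5) (y : BCF) : Prop :=
  ![AllD ((p : ℤ) ^ 2) y, AllD p y, W p 2 2 1 y, W p 2 1 1 y, W p 3 2 1 y] t

/-- Negative local condition of type `t`. -/
def Neg (p : ℕ) (t : Fin 5) (x : BCF) : Prop :=
  ∀ γ : Matrix (Fin 2) (Fin 2) ℤ, γ.det = 1 →
    (t = 2 → ¬ W p 3 2 1 (act γ x)) ∧ (t = 3 → ¬ W p 2 2 1 (act γ x))

/-- Local weights. -/
def wt (t : Fin 5) : ℕ := ![2, 3, 3, 4, 3] t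

lemma Loc_pres {p : ℕ} {t : Fin 5} {y : BCF} {σ : Matrix (Fin 2) (Fin 2) ℤ}
    (hσ : (p : ℤ) ∣ σ 0 1) (h : Loc p t y) : Loc p t (act σ y) := by
  fin_cases t
  · exact AllD_act (n := (p : ℤ) ^ 2) h σ
  · exact AllD_act (n := (p : ℤ)) h σ
  · exact W_pres (i := 2) (j := 2) (k := 1) (by simp [WOK]) hσ h
  · exact W_pres (i := 2) (j := 1) (k := 1) (by simp [WOK]) hσ h
  · exact W_pres (i := 3) (j := 2) (k := 1) (by simp [WOK]) hσ h

lemma exists_type {p : ℕ} (hp : p.Prime) {x : BCF} (hx : inDual x) (h0 : ‖PhiHat' p x‖ ≠ 0) :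
    ∃ t : Fin 5, (∃ γ : Matrix (Fin 2) (Fin 2) ℤ, γ.det = 1 ∧ Loc p t (act γ x)) ∧ Neg p t x ∧
      ‖PhiHat' p x‖ ≤ 20 / (p : ℝ) ^ (wt t) := by
  by_cases hA : AllD ((p : ℤ) ^ 2) x
  · exact ⟨0, ⟨1, by simp, by rw [act_one]; exact hA⟩, fun γ _ => by simp, loc_A hp hx⟩
  by_cases hB : AllD p x
  · exact ⟨1, ⟨1, by simp, by rw [act_one]; exact hB⟩, fun γ _ => by simp, loc_B hp hx hB hA⟩
  by_cases hE : ∃ γ : Matrix (Fin 2) (Fin 2) ℤ, γ.det = 1 ∧ W p 3 2 1 (act γ x)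
  · exact ⟨4, hE, fun γ _ => by simp, loc_C hp hx hB⟩
  by_cases hC : ∃ γ : Matrix (Fin 2) (Fin 2) ℤ, γ.det = 1 ∧ W p 2 2 1 (act γ x)
  · exact ⟨2, hC, fun γ hγ => ⟨fun _ h => hE ⟨γ, hγ, h⟩, by simp⟩, loc_C hp hx hB⟩
  by_cases hD : ∃ γ : Matrix (Fin 2) (Fin 2) ℤ, γ.det = 1 ∧ W p 2 1 1 (act γ x)
  · exact ⟨3, hD, fun γ hγ => ⟨by simp, fun _ h => hC ⟨γ, hγ, h⟩⟩,
      loc_D hp hx hB (fun γ hγ h => hC ⟨γ, hγ, h⟩)⟩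
  · exact absurd (loc_0 hp hx hB (fun γ hγ h => hD ⟨γ, hγ, h⟩)) h0

end BCF

namespace BCF

/-- The prime factors of `q` not dividing `6`. -/
def goodP (q : ℕ) : Finset ℕ := q.primeFactors.filter (fun p => ¬ p ∣ 6)

/-- The part of `q` prime to `6`. -/
def core (q : ℕ) : ℕ := ∏ p ∈ goodP q, p

lemma goodP_prime {q p : ℕ} (h : p ∈ goodP q) : p.Prime :=
  Nat.prime_of_mem_primeFactors (Finset.mem_filter.1 h).1

lemma core_dvd {q : ℕ} (hq : Squarefree q) : core q ∣ q := by
  conv_rhs => rw [← Nat.prod_primeFactors_of_squarefree hq]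
  exact Finset.prod_dvd_prod_of_subset _ _ _ (Finset.filter_subset _ _)

lemma core_coprime (q : ℕ) : Nat.Coprime (core q) 6 := by
  refine Nat.Coprime.prod_left fun p hp => ?_
  exact (Nat.Prime.coprime_iff_not_dvd (goodP_prime hp)).2 (Finset.mem_filter.1 hp).2

lemma le_core {q : ℕ} (hq : Squarefree q) : q ≤ 6 * core q := by
  have h := Nat.prod_primeFactors_of_squarefree hq
  rw [← Finset.prod_filter_mul_prod_filter_not q.primeFactors (fun p => p ∣ 6)] at h
  have h2 : ∏ p ∈ q.primeFactors.filter (fun p => p ∣ 6), p ≤ 6 := by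
    refine Nat.le_of_dvd (by norm_num) ?_
    refine Finset.prod_primes_dvd _ (fun p hp => ?_) (fun p hp => (Finset.mem_filter.1 hp).2)
    exact (Nat.prime_of_mem_primeFactors (Finset.mem_filter.1 hp).1).prime
  calc q = _ := h.symm
    _ ≤ 6 * core q := Nat.mul_le_mul_right _ h2

/-- The part of the product of a given type. -/
def part (P : Finset ℕ) (ty : ℕ → Fin 5) (j : Fin 5) : ℕ := ∏ p ∈ P.filter (fun p => ty p = j), p

lemma part_prod (P : Finset ℕ) (ty : ℕ → Fin 5) : part P ty 0 * part P ty 1 * part P ty 2 *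
    part P ty 3 * part P ty 4 = ∏ p ∈ P, p := by
  rw [← Finset.prod_fiberwise P ty (fun p => p), Fin.prod_univ_five]
  rfl

lemma part_coprime {P : Finset ℕ} (hP : ∀ p ∈ P, p.Prime) (ty : ℕ → Fin 5) {i j : Fin 5}
    (hij : i ≠ j) : Nat.Coprime (part P ty i) (part P ty j) := by
  refine Nat.Coprime.prod_left fun p hp => Nat.Coprime.prod_right fun l hl => ?_
  rw [Finset.mem_filter] at hp hl
  refine (Nat.coprime_primes (hP p hp.1) (hP l hl.1)).2 ?_
  rintro rfl
  exact hij (hp.2.symm.trans hl.2)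

lemma part_pow_dvd {P : Finset ℕ} (hP : ∀ p ∈ P, p.Prime) {ty : ℕ → Fin 5} {j : Fin 5} {i : ℕ}
    {z : ℤ} (h : ∀ p ∈ P, ty p = j → (p : ℤ) ^ i ∣ z) : ((part P ty j : ℕ) : ℤ) ^ i ∣ z := by
  unfold part
  rw [Nat.cast_prod, ← Finset.prod_pow]
  refine Finset.prod_dvd_of_coprime ?_ fun p hp => h p (Finset.mem_filter.1 hp).1
    (Finset.mem_filter.1 hp).2
  intro p hp l hl hpl
  simp only [Finset.coe_filter] at hp hl
  refine IsCoprime.pow ?_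
  rw [Nat.isCoprime_iff_coprime]
  exact (Nat.coprime_primes (hP p hp.1) (hP l hl.1)).2 hpl

lemma all_dvd {P : Finset ℕ} (hP : ∀ p ∈ P, p.Prime) {ty : ℕ → Fin 5} (e : Fin 5 → ℕ)
    {z : ℤ} (h : ∀ p ∈ P, (p : ℤ) ^ (e (ty p)) ∣ z) :
    ((part P ty 0 : ℕ) : ℤ) ^ e 0 * (part P ty 1 : ℕ) ^ e 1 * (part P ty 2 : ℕ) ^ e 2 *
      (part P ty 3 : ℕ) ^ e 3 * (part P ty 4 : ℕ) ^ e 4 ∣ z := by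
  have := Finset.prod_dvd_of_coprime (t := (Finset.univ : Finset (Fin 5)))
    (s := fun j => ((part P ty j : ℕ) : ℤ) ^ e j) (z := z) ?_ ?_
  · rwa [Fin.prod_univ_five] at this
  · intro i _ j _ hij
    exact IsCoprime.pow (Nat.isCoprime_iff_coprime.2 (part_coprime hP ty hij))
  · intro j _
    exact part_pow_dvd hP fun p hp hj => hj ▸ h p hp

lemma mem_of_dvd_part {P : Finset ℕ} (hP : ∀ p ∈ P, p.Prime) {ty : ℕ → Fin 5} {j : Fin 5} {l : ℕ}
    (hl : l.Prime) (h : l ∣ part P ty j) : l ∈ P ∧ ty l = j := by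
  unfold part at h
  obtain ⟨p, hp, hd⟩ := (hl.prime.dvd_finsetProd_iff _).1 h
  rw [Finset.mem_filter] at hp
  rw [(Nat.prime_dvd_prime_iff_eq hl (hP p hp.1)).1 hd]
  exact hp

lemma Loc_e1 {p : ℕ} {t : Fin 5} {y : BCF} (h : Loc p t y) :
    (p : ℤ) ^ ((![2, 1, 2, 2, 3] : Fin 5 → ℕ) t) ∣ y.1 ∧
    (p : ℤ) ^ ((![2, 1, 2, 1, 2] : Fin 5 → ℕ) t) ∣ y.2.1 ∧
    (p : ℤ) ^ ((![2, 1, 1, 1, 1] : Fin 5 → ℕ) t) ∣ y.2.2.1 ∧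
    (p : ℤ) ^ ((![2, 1, 0, 0, 0] : Fin 5 → ℕ) t) ∣ y.2.2.2 := by
  fin_cases t
  · exact h
  · have h' : AllD p y := h
    simpa [AllD] using h'
  · have h' : W p 2 2 1 y := h
    simpa [W] using h'
  · have h' : W p 2 1 1 y := h
    simpa [W] using h'
  · have h' : W p 3 2 1 y := h
    simpa [W] using h'

lemma exists_tuple {q : ℕ} (hq : Squarefree q) {x : BCF} (hx : inDual x)
    (h0 : ‖PhiHat' q x‖ ≠ 0) : ∃ A B C D E : ℕ, A * B * C * D * E = core q ∧
      Shape A B C D E x ∧ ‖PhiHat' q x‖ ≤ 20 ^ q.primeFactors.card *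
        (A ^ 2 * B ^ 3 * C ^ 3 * D ^ 4 * E ^ 3 : ℝ)⁻¹ := by
  rw [norm_PhiHat'_prod hx hq] at h0 ⊢
  rw [Finset.prod_ne_zero_iff] at h0
  have hP : ∀ p ∈ goodP q, p.Prime := fun p hp => goodP_prime hp
  have key : ∀ p : ℕ, ∃ t : Fin 5, ∃ γ : Matrix (Fin 2) (Fin 2) ℤ, p ∈ goodP q →
      (γ.det = 1 ∧ Loc p t (act γ x) ∧ Neg p t x ∧ ‖PhiHat' p x‖ ≤ 20 / (p : ℝ) ^ (wt t)) := by
    intro p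
    by_cases hp : p ∈ goodP q
    · obtain ⟨t, ⟨γ, h1, h2⟩, h3, h4⟩ := exists_type (hP p hp) hx (h0 p (Finset.mem_filter.1 hp).1)
      exact ⟨t, γ, fun _ => ⟨h1, h2, h3, h4⟩⟩
    · exact ⟨0, 1, fun h => absurd h hp⟩
  choose ty g hg using key
  obtain ⟨γ, hγ, hglue⟩ := glue (goodP q) hP g (fun p hp => (hg p hp).1)
  have hloc : ∀ p ∈ goodP q, Loc p (ty p) (act γ x) := by
    intro p hp
    obtain ⟨σ, hσ, he⟩ := hglue p hp
    rw [he, act_mul]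
    exact Loc_pres hσ (hg p hp).2.1
  have d1 := all_dvd hP (ty := ty) ![2, 1, 2, 2, 3] (fun p hp => (Loc_e1 (hloc p hp)).1)
  have d2 := all_dvd hP (ty := ty) ![2, 1, 2, 1, 2] (fun p hp => (Loc_e1 (hloc p hp)).2.1)
  have d3 := all_dvd hP (ty := ty) ![2, 1, 1, 1, 1] (fun p hp => (Loc_e1 (hloc p hp)).2.2.1)
  have d4 := all_dvd hP (ty := ty) ![2, 1, 0, 0, 0] (fun p hp => (Loc_e1 (hloc p hp)).2.2.2)
  have hbound : ∏ p ∈ q.primeFactors, ‖PhiHat' p x‖ ≤ 20 ^ q.primeFactors.card *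
      ∏ j : Fin 5, (((part (goodP q) ty j : ℕ) : ℝ) ^ wt j)⁻¹ := by
    rw [← Finset.prod_filter_mul_prod_filter_not q.primeFactors (fun p => p ∣ 6)]
    have b1 : ∏ p ∈ q.primeFactors.filter (fun p => p ∣ 6), ‖PhiHat' p x‖ ≤ 1 := by
      refine Finset.prod_le_one (fun _ _ => norm_nonneg _) fun p hp => ?_
      exact norm_PhiHat'_le_one hx (Nat.prime_of_mem_primeFactors (Finset.mem_filter.1 hp).1).ne_zero
    have b2 : ∏ p ∈ goodP q, ‖PhiHat' p x‖ ≤ 20 ^ (goodP q).card *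
        ∏ j : Fin 5, (((part (goodP q) ty j : ℕ) : ℝ) ^ wt j)⁻¹ := by
      calc _ ≤ ∏ p ∈ goodP q, (20 * ((p : ℝ) ^ wt (ty p))⁻¹) := by
            refine Finset.prod_le_prod (fun _ _ => norm_nonneg _) fun p hp => ?_
            rw [← div_eq_mul_inv]
            exact (hg p hp).2.2.2
        _ = _ := by
            rw [Finset.prod_mul_distrib, Finset.prod_const, ← Finset.prod_fiberwise (goodP q) ty]
            congr 1
            refine Finset.prod_congr rfl fun j _ => ?_
            unfold part
            rw [Nat.cast_prod, ← Finset.prod_pow, ← Finset.prod_inv_distrib]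
            refine Finset.prod_congr rfl fun p hp => ?_
            rw [(Finset.mem_filter.1 hp).2]
    calc _ ≤ 1 * (20 ^ (goodP q).card *
        ∏ j : Fin 5, (((part (goodP q) ty j : ℕ) : ℝ) ^ wt j)⁻¹) :=
          mul_le_mul b1 b2 (Finset.prod_nonneg fun _ _ => norm_nonneg _) zero_le_one
      _ ≤ _ := by
          rw [one_mul]
          refine mul_le_mul_of_nonneg_right ?_ (Finset.prod_nonneg fun _ _ => by positivity)
          exact pow_le_pow_right₀ (by norm_num) (Finset.card_le_card (Finset.filter_subset _ _))
  have hprod := part_prod (goodP q) ty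
  have hC := fun l hl => mem_of_dvd_part hP (ty := ty) (j := 2) (l := l) hl
  have hD := fun l hl => mem_of_dvd_part hP (ty := ty) (j := 3) (l := l) hl
  rw [Fin.prod_univ_five] at hbound
  generalize part (goodP q) ty 0 = A at *
  generalize part (goodP q) ty 1 = B at *
  generalize part (goodP q) ty 2 = C at *
  generalize part (goodP q) ty 3 = D at *
  generalize part (goodP q) ty 4 = E at *
  refine ⟨A, B, C, D, E, hprod, ⟨γ, hγ, ?_⟩, ?_⟩
  · obtain ⟨a, ha⟩ := d1
    obtain ⟨b, hb⟩ := d2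
    obtain ⟨c, hc⟩ := d3
    obtain ⟨d, hd⟩ := d4
    simp at ha hb hc hd
    refine ⟨a, b, c, d, ?_, ?_, ?_⟩
    · refine Prod.ext ?_ (Prod.ext ?_ (Prod.ext ?_ ?_))
      · simp only [ha]; ring
      · simp only [hb]; ring
      · simp only [hc]; ring
      · simp only [hd]
    · intro l hl hlC hla
      obtain ⟨hlP, hlt⟩ := hC l hl hlC
      have hlC' : (l : ℤ) ∣ C := by exact_mod_cast hlC
      have hW : W l 2 2 1 (act γ x) := by have := hloc l hlP; rw [hlt] at this; exact this
      refine ((hg l hlP).2.2.1 γ hγ).1 hlt ⟨?_, hW.2.1, hW.2.2⟩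
      rw [ha]
      exact dvd_eq ((mul_dvd_mul (pow_dvd_pow_of_dvd hlC' 2) hla).mul_left
        ((A : ℤ) ^ 2 * B * D ^ 2 * E ^ 3)) (by ring) |> dvd_trans (dvd_of_eq (by ring))
    · rintro l hl hlD ⟨hla, hlb⟩
      obtain ⟨hlP, hlt⟩ := hD l hl hlD
      have hlD' : (l : ℤ) ∣ D := by exact_mod_cast hlD
      have hW : W l 2 1 1 (act γ x) := by have := hloc l hlP; rw [hlt] at this; exact this
      refine ((hg l hlP).2.2.1 γ hγ).2 hlt ⟨hW.1, ?_, hW.2.2⟩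
      rw [hb]
      exact dvd_eq ((mul_dvd_mul hlD' hlb).mul_left
        ((A : ℤ) ^ 2 * B * C ^ 2 * E ^ 2)) (by ring) |> dvd_trans (dvd_of_eq (by ring))
  · refine hbound.trans (le_of_eq ?_)
    simp [wt]
    ring

end BCF

namespace BCF

/-! ### Assembly of the counting bound -/

lemma card_div_le {q : ℕ} (hq : Squarefree q) : q.divisors.card ≤ 2 ^ q.primeFactors.card := by
  rw [Nat.card_divisors hq.ne_zero, ← Finset.prod_const]
  refine Finset.prod_le_prod' fun p _ => ?_
  have := hq.natFactorization_le_one p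
  omega

lemma K0_nonneg : 0 ≤ K0 := by unfold K0; norm_num

/-- Auxiliary: bound in terms of a common majorant. -/
lemma sum_core {q : ℕ} (hq : Squarefree q) {X R : ℝ} (S : Finset BCF)
    (hS : ∀ x ∈ S, inDual x ∧ disc x ≠ 0 ∧ |(disc x : ℝ)| ≤ X)
    (hinj : ∀ x ∈ S, ∀ y ∈ S, SLeq x y → x = y) (hR : 0 ≤ R)
    (hcount : ∀ A B C D E : ℕ, A * B * C * D * E = core q → ∀ S' : Finset BCF, S' ⊆ S →
      (∀ x ∈ S', Shape A B C D E x) →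
      (S'.card : ℝ) * (A ^ 2 * B ^ 3 * C ^ 3 * D ^ 4 * E ^ 3 : ℝ)⁻¹ ≤ R) :
    ∑ x ∈ S, ‖PhiHat' q x‖ ≤ 640 ^ q.primeFactors.card * R := by
  have key : ∀ x : BCF, ∃ t : ℕ × ℕ × ℕ × ℕ × ℕ, x ∈ S → ‖PhiHat' q x‖ ≠ 0 →
      t.1 * t.2.1 * t.2.2.1 * t.2.2.2.1 * t.2.2.2.2 = core q ∧
      Shape t.1 t.2.1 t.2.2.1 t.2.2.2.1 t.2.2.2.2 x ∧
      ‖PhiHat' q x‖ ≤ 20 ^ q.primeFactors.card *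
        (t.1 ^ 2 * t.2.1 ^ 3 * t.2.2.1 ^ 3 * t.2.2.2.1 ^ 4 * t.2.2.2.2 ^ 3 : ℝ)⁻¹ := by
    intro x
    by_cases hx : x ∈ S
    · by_cases h0 : ‖PhiHat' q x‖ = 0
      · exact ⟨0, fun _ h => absurd h0 h⟩
      · obtain ⟨A, B, C, D, E, h⟩ := exists_tuple hq (hS x hx).1 h0
        exact ⟨(A, B, C, D, E), fun _ _ => h⟩
    · exact ⟨0, fun h => absurd h hx⟩
  choose t ht using key
  obtain ⟨S0, hS0⟩ : ∃ S0, S0 = S.filter (fun x => ‖PhiHat' q x‖ ≠ 0) := ⟨_, rfl⟩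
  have hS0' : ∀ x ∈ S0, x ∈ S ∧ ‖PhiHat' q x‖ ≠ 0 := fun x hx => by
    rw [hS0] at hx; exact Finset.mem_filter.1 hx
  have e1 : ∑ x ∈ S, ‖PhiHat' q x‖ = ∑ x ∈ S0, ‖PhiHat' q x‖ := by
    rw [hS0, Finset.sum_filter_ne_zero]
  obtain ⟨T, hT⟩ : ∃ T : Finset (ℕ × ℕ × ℕ × ℕ × ℕ), T = q.divisors ×ˢ q.divisors ×ˢ
    q.divisors ×ˢ q.divisors ×ˢ q.divisors := ⟨_, rfl⟩
  have hmaps : ∀ x ∈ S0, t x ∈ T := by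
    intro x hx
    obtain ⟨h1, -, -⟩ := ht x (hS0' x hx).1 (hS0' x hx).2
    have hd : ∀ n, n ∣ core q → n ∈ q.divisors := fun n hn =>
      Nat.mem_divisors.2 ⟨hn.trans (core_dvd hq), hq.ne_zero⟩
    rw [hT]
    simp only [Finset.mem_product]
    generalize t x = u at *
    obtain ⟨A, B, C, D, E⟩ := u
    simp only at h1 ⊢
    exact ⟨hd _ ⟨B * C * D * E, by rw [← h1]; ring⟩, hd _ ⟨A * C * D * E, by rw [← h1]; ring⟩,
      hd _ ⟨A * B * D * E, by rw [← h1]; ring⟩, hd _ ⟨A * B * C * E, by rw [← h1]; ring⟩,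
      hd _ ⟨A * B * C * D, by rw [← h1]; ring⟩⟩
  have hcardT : (T.card : ℝ) ≤ 32 ^ q.primeFactors.card := by
    have h := card_div_le hq
    have : T.card ≤ 32 ^ q.primeFactors.card := by
      rw [hT]
      simp only [Finset.card_product]
      calc _ ≤ 2 ^ q.primeFactors.card * (2 ^ q.primeFactors.card * (2 ^ q.primeFactors.card *
          (2 ^ q.primeFactors.card * 2 ^ q.primeFactors.card))) := by gcongr
        _ = _ := by rw [← mul_pow, ← mul_pow, ← mul_pow, ← mul_pow]; norm_num
    exact_mod_cast this
  rw [e1, ← Finset.sum_fiberwise_of_maps_to hmaps]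
  calc _ ≤ ∑ u ∈ T, 20 ^ q.primeFactors.card * R := by
        refine Finset.sum_le_sum fun u hu => ?_
        by_cases hne : (S0.filter (fun x => t x = u)).Nonempty
        · obtain ⟨x0, hx0⟩ := hne
          rw [Finset.mem_filter] at hx0
          have hc := (ht x0 (hS0' x0 hx0.1).1 (hS0' x0 hx0.1).2).1
          rw [hx0.2] at hc
          have hcnt := hcount _ _ _ _ _ hc (S0.filter (fun x => t x = u)) (fun x hx =>
            (hS0' x (Finset.mem_filter.1 hx).1).1) (fun x hx => by
              rw [Finset.mem_filter] at hx
              have := (ht x (hS0' x hx.1).1 (hS0' x hx.1).2).2.1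
              rwa [hx.2] at this)
          calc _ ≤ ∑ x ∈ S0.filter (fun x => t x = u), (20 ^ q.primeFactors.card *
                (u.1 ^ 2 * u.2.1 ^ 3 * u.2.2.1 ^ 3 * u.2.2.2.1 ^ 4 * u.2.2.2.2 ^ 3 : ℝ)⁻¹) := by
                refine Finset.sum_le_sum fun x hx => ?_
                rw [Finset.mem_filter] at hx
                have := (ht x (hS0' x hx.1).1 (hS0' x hx.1).2).2.2
                rwa [hx.2] at this
            _ = 20 ^ q.primeFactors.card * (((S0.filter (fun x => t x = u)).card : ℝ) *
                (u.1 ^ 2 * u.2.1 ^ 3 * u.2.2.1 ^ 3 * u.2.2.2.1 ^ 4 * u.2.2.2.2 ^ 3 : ℝ)⁻¹) := by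
                rw [Finset.sum_const, nsmul_eq_mul]; ring
            _ ≤ _ := mul_le_mul_of_nonneg_left hcnt (by positivity)
        · rw [Finset.not_nonempty_iff_eq_empty] at hne
          rw [hne, Finset.sum_empty]
          positivity
    _ = (T.card : ℝ) * (20 ^ q.primeFactors.card * R) := by
        rw [Finset.sum_const, nsmul_eq_mul]
    _ ≤ 32 ^ q.primeFactors.card * (20 ^ q.primeFactors.card * R) := by gcongr
    _ = _ := by rw [← mul_assoc, ← mul_pow]; norm_num

/-- The absolute constant. -/
def K1 : ℝ := K0 * 6 ^ 7

lemma K1_nonneg : 0 ≤ K1 := by unfold K1; have := K0_nonneg; positivity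

lemma sum_bound {q : ℕ} (hq : Squarefree q) {X : ℝ} (hX : 0 ≤ X) (S : Finset BCF)
    (hS : ∀ x ∈ S, inDual x ∧ disc x ≠ 0 ∧ |(disc x : ℝ)| ≤ X)
    (hinj : ∀ x ∈ S, ∀ y ∈ S, SLeq x y → x = y) :
    ∑ x ∈ S, ‖PhiHat' q x‖ ≤ K1 * 2560 ^ q.primeFactors.card * (X / (q : ℝ) ^ 6) ∧
    ∑ x ∈ S, ‖PhiHat' q x‖ ≤ K1 * 2560 ^ q.primeFactors.card * (X / (q : ℝ) ^ 7 + 1 / q) := by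
  have hdvd := core_dvd hq
  have hsq : Squarefree (core q) := hq.squarefree_of_dvd hdvd
  have hq0 : (0 : ℝ) < q := by exact_mod_cast Nat.pos_of_ne_zero hq.ne_zero
  have hc0 : (0 : ℝ) < core q := by exact_mod_cast Nat.pos_of_ne_zero hsq.ne_zero
  have hle : (q : ℝ) / 6 ≤ core q := by
    have : (q : ℝ) ≤ 6 * core q := by exact_mod_cast le_core hq
    linarith
  have hK := K0_nonneg
  have ht : tau (core q) ≤ 4 ^ q.primeFactors.card := by
    refine (tau_mono hdvd hq.ne_zero).trans ?_
    unfold tau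
    have : (q.divisors.card : ℝ) ≤ 2 ^ q.primeFactors.card := by exact_mod_cast card_div_le hq
    calc _ ≤ (2 : ℝ) ^ q.primeFactors.card * 2 ^ q.primeFactors.card := by gcongr
      _ = _ := by rw [← mul_pow]; norm_num
  have ht0 := tau_nonneg (core q)
  have hcount : ∀ A B C D E : ℕ, A * B * C * D * E = core q → ∀ S' : Finset BCF, S' ⊆ S →
      (∀ x ∈ S', Shape A B C D E x) → _ := fun A B C D E h S' hs hsh =>
    tuple_count (by rw [h]; exact hsq) (by rw [h]; exact core_coprime q) hX S'
      (fun x hx => ⟨(hS x (hs hx)).2.1, (hS x (hs hx)).2.2, hsh x hx⟩)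
      (fun x hx y hy => hinj x (hs hx) y (hs hy)) (core q) h.symm
  have fin : ∀ R R' : ℝ, 0 ≤ R → R ≤ 6 ^ 7 * R' →
      640 ^ q.primeFactors.card * (K0 * tau (core q) * R) ≤
        K1 * 2560 ^ q.primeFactors.card * R' := by
    intro R R' h0 h
    calc _ ≤ 640 ^ q.primeFactors.card * (K0 * 4 ^ q.primeFactors.card * (6 ^ 7 * R')) := by gcongr
      _ = K0 * 6 ^ 7 * (640 ^ q.primeFactors.card * 4 ^ q.primeFactors.card) * R' := by ring
      _ = _ := by rw [← mul_pow]; unfold K1; norm_num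
  have p1 : ∀ n : ℕ, X / (core q : ℝ) ^ n ≤ 6 ^ n * (X / (q : ℝ) ^ n) := by
    intro n
    calc _ ≤ X / ((q : ℝ) / 6) ^ n := by gcongr
      _ = _ := by rw [div_pow]; field_simp
  constructor
  · refine (sum_core hq S hS hinj (R := K0 * tau (core q) * (X / (core q : ℝ) ^ 6)) (by positivity)
      (fun A B C D E h S' hs hsh => (hcount A B C D E h S' hs hsh).1)).trans (fin _ _ (by positivity) ?_)
    refine (p1 6).trans ?_
    gcongr <;> norm_num
  · refine (sum_core hq S hS hinj (R := K0 * tau (core q) * (X / (core q : ℝ) ^ 7 + 1 / core q))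
      (by positivity)
      (fun A B C D E h S' hs hsh => (hcount A B C D E h S' hs hsh).2)).trans (fin _ _ (by positivity) ?_)
    rw [mul_add]
    refine add_le_add (p1 7) ?_
    calc _ ≤ 1 / ((q : ℝ) / 6) := by gcongr
      _ = 6 * (1 / q) := by field_simp
      _ ≤ _ := by gcongr; norm_num

/-! ### The divisor-type bound -/

lemma omega_bound (K ε : ℝ) (hK : 1 ≤ K) (hε : 0 < ε) : ∃ C : ℝ, 0 ≤ C ∧ ∀ q : ℕ, Squarefree q →
    K ^ q.primeFactors.card ≤ C * (q : ℝ) ^ ε := by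
  obtain ⟨N, hN⟩ := exists_nat_gt (K ^ (1 / ε))
  refine ⟨K ^ N, by positivity, fun q hq => ?_⟩
  have h1 : ∀ p ∈ q.primeFactors, K ≤ (if p < N then K else 1) * (p : ℝ) ^ ε := by
    intro p hp
    have hp1 : (1 : ℝ) ≤ p := by exact_mod_cast (Nat.prime_of_mem_primeFactors hp).one_lt.le
    split_ifs with h
    · exact le_mul_of_one_le_right (by positivity) (Real.one_le_rpow hp1 hε.le)
    · push Not at h
      have h2 : K ^ (1 / ε) ≤ p := hN.le.trans (by exact_mod_cast h)
      rw [one_mul]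
      calc K = (K ^ (1 / ε)) ^ ε := by
            rw [← Real.rpow_mul (by positivity)]; field_simp; rw [Real.rpow_one]
        _ ≤ _ := Real.rpow_le_rpow (by positivity) h2 hε.le
  calc K ^ q.primeFactors.card = ∏ p ∈ q.primeFactors, K := by rw [Finset.prod_const]
    _ ≤ ∏ p ∈ q.primeFactors, ((if p < N then K else 1) * (p : ℝ) ^ ε) :=
        Finset.prod_le_prod (fun _ _ => by positivity) h1
    _ = (∏ p ∈ q.primeFactors, if p < N then K else 1) * (q : ℝ) ^ ε := by
        rw [Finset.prod_mul_distrib, Real.finsetProd_rpow _ _ (fun _ _ => by positivity),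
          ← Nat.cast_prod, Nat.prod_primeFactors_of_squarefree hq]
    _ ≤ _ := by
        refine mul_le_mul_of_nonneg_right ?_ (by positivity)
        rw [← Finset.prod_filter, Finset.prod_const]
        refine pow_le_pow_right₀ hK ?_
        calc _ ≤ (Finset.range N).card := Finset.card_le_card (fun p hp => by
              rw [Finset.mem_range]; exact (Finset.mem_filter.1 hp).2)
          _ = N := Finset.card_range N

end BCF

namespace BCF

theorem sum_filter_split {ι : Type*} (S : Finset ι) (g : ι → ℝ) (hg : ∀ x ∈ S, 0 ≤ g x)
    (P Q R : ι → Prop) [DecidablePred P] [DecidablePred Q] [DecidablePred R] (h : ∀ x ∈ S, P x → Q x ∨ R x) :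
    ∑ x ∈ S.filter P, g x ≤ ∑ x ∈ S.filter Q, g x + ∑ x ∈ S.filter R, g x := by
  have h1 : S.filter P ⊆ S.filter Q ∪ S.filter R := by
    intro x hx
    rw [Finset.mem_filter] at hx
    rw [Finset.mem_union, Finset.mem_filter, Finset.mem_filter]
    rcases h x hx.1 hx.2 with h | h
    · exact Or.inl ⟨hx.1, h⟩
    · exact Or.inr ⟨hx.1, h⟩
  have hpos : ∀ x ∈ S.filter Q ∪ S.filter R, 0 ≤ g x := by
    intro x hx
    rw [Finset.mem_union, Finset.mem_filter, Finset.mem_filter] at hx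
    rcases hx with h | h <;> exact hg x h.1
  calc _ ≤ ∑ x ∈ S.filter Q ∪ S.filter R, g x :=
        Finset.sum_le_sum_of_subset_of_nonneg h1 fun x hx _ => hpos x hx
    _ ≤ _ := by
        rw [← Finset.sum_union_inter]
        have : 0 ≤ ∑ x ∈ S.filter Q ∩ S.filter R, g x :=
          Finset.sum_nonneg fun x hx => hpos x (Finset.mem_union_left _ (Finset.mem_inter.1 hx).1)
        linarith

theorem piece_bound {ι : Type*} (S : Finset ι) (w μ : ι → ℝ) (hw : ∀ x ∈ S, 0 ≤ w x)
    (δ : ℝ) (hδ : 0 < δ) (a b B : ℝ) (ha : 0 < a)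
    (hB : ∑ x ∈ S.filter (fun x => μ x ≤ b), w x ≤ B) (P : ι → Prop) [DecidablePred P]
    (hP : ∀ x ∈ S, P x → a ≤ μ x ∧ μ x ≤ b) :
    ∑ x ∈ S.filter P, w x * μ x ^ (-δ) ≤ a ^ (-δ) * B := by
  calc ∑ x ∈ S.filter P, w x * μ x ^ (-δ) ≤ ∑ x ∈ S.filter P, a ^ (-δ) * w x := by
        refine Finset.sum_le_sum fun x hx => ?_
        rw [Finset.mem_filter] at hx
        have h := hP x hx.1 hx.2
        rw [mul_comm]
        exact mul_le_mul_of_nonneg_right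
          (Real.rpow_le_rpow_of_nonpos ha h.1 (by linarith)) (hw x hx.1)
    _ = a ^ (-δ) * ∑ x ∈ S.filter P, w x := by rw [Finset.mul_sum]
    _ ≤ a ^ (-δ) * ∑ x ∈ S.filter (fun x => μ x ≤ b), w x := by
        refine mul_le_mul_of_nonneg_left ?_ (Real.rpow_nonneg ha.le _)
        refine Finset.sum_le_sum_of_subset_of_nonneg ?_ ?_
        · intro x hx
          rw [Finset.mem_filter] at hx ⊢
          exact ⟨hx.1, (hP x hx.1 hx.2).2⟩
        · intro x hx _
          exact hw x (Finset.mem_filter.1 hx).1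
    _ ≤ _ := mul_le_mul_of_nonneg_left hB (Real.rpow_nonneg ha.le _)

theorem down_bound (δ : ℝ) (hδ : 0 < δ) (hδ1 : δ < 1) : ∃ C : ℝ, 0 ≤ C ∧
    ∀ (S : Finset BCF) (w μ : BCF → ℝ), (∀ x ∈ S, 0 ≤ w x) → (∀ x ∈ S, 0 < μ x) →
    ∀ M : ℝ, 0 ≤ M → (∀ y : ℝ, 0 < y → ∑ x ∈ S.filter (fun x => μ x ≤ y), w x ≤ M * y) →
    ∀ z : ℝ, 0 < z → (∀ x ∈ S, μ x < z) →
    ∑ x ∈ S, w x * μ x ^ (-δ) ≤ C * M * z ^ (1 - δ) := by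
  have hlt : (2:ℝ) ^ (δ - 1) < 1 := Real.rpow_lt_one_of_one_lt_of_neg (by norm_num) (by linarith)
  obtain ⟨C, hC⟩ : ∃ C : ℝ, C = 2 ^ δ / (1 - 2 ^ (δ - 1)) := ⟨_, rfl⟩
  have hC0 : 0 ≤ C := by
    rw [hC]; exact div_nonneg (by positivity) (by linarith)
  have hCeq : 2 ^ δ + C * 2 ^ (δ - 1) = C := by
    have : C * (1 - 2 ^ (δ - 1)) = 2 ^ δ := by
      rw [hC]; exact div_mul_cancel₀ _ (by linarith)
    linarith
  refine ⟨C, hC0, ?_⟩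
  intro S w μ hw hμ M hM hcum
  have key : ∀ n : ℕ, ∀ z : ℝ, 0 < z →
      ∑ x ∈ S.filter (fun x => z / 2 ^ n ≤ μ x ∧ μ x < z), w x * μ x ^ (-δ)
        ≤ C * M * z ^ (1 - δ) := by
    intro n
    induction n with
    | zero =>
      intro z hz
      have : S.filter (fun x => z / 2 ^ 0 ≤ μ x ∧ μ x < z) = ∅ := by
        refine Finset.filter_eq_empty_iff.2 fun x _ h => ?_
        have := h.1; have := h.2
        simp at *
        linarith
      rw [this, Finset.sum_empty]
      have := Real.rpow_nonneg hz.le (1 - δ)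
      positivity
    | succ n ih =>
      intro z hz
      have h1 := sum_filter_split S (fun x => w x * μ x ^ (-δ))
        (fun x hx => mul_nonneg (hw x hx) (Real.rpow_nonneg (hμ x hx).le _))
        (fun x => z / 2 ^ (n+1) ≤ μ x ∧ μ x < z)
        (fun x => z / 2 ≤ μ x ∧ μ x < z) (fun x => z / 2 / 2 ^ n ≤ μ x ∧ μ x < z / 2)
        (fun x _ h => by
          rcases le_or_gt (z/2) (μ x) with h' | h'
          · exact Or.inl ⟨h', h.2⟩
          · refine Or.inr ⟨?_, h'⟩
            have e : z / 2 / 2 ^ n = z / 2 ^ (n+1) := by rw [pow_succ]; field_simp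
            rw [e]; exact h.1)
      have h2 := piece_bound S w μ hw δ hδ (z/2) z (M * z) (by linarith) (hcum z hz)
        (fun x => z / 2 ≤ μ x ∧ μ x < z) (fun x _ h => ⟨h.1, h.2.le⟩)
      have h3 := ih (z/2) (by linarith)
      have e1 : (z/2) ^ (-δ) * (M * z) = 2 ^ δ * (M * z ^ (1-δ)) := by
        rw [Real.div_rpow hz.le (by norm_num), Real.rpow_neg (by norm_num : (0:ℝ) ≤ 2),
          Real.rpow_sub hz, Real.rpow_neg hz.le, Real.rpow_one]
        field_simp
      have e2 : (z/2) ^ (1-δ) = 2 ^ (δ-1) * z ^ (1-δ) := by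
        rw [Real.div_rpow hz.le (by norm_num), show δ - 1 = -(1-δ) by ring,
          Real.rpow_neg (by norm_num : (0:ℝ) ≤ 2)]
        field_simp
      rw [e1] at h2
      rw [e2] at h3
      calc _ ≤ _ := h1
        _ ≤ 2 ^ δ * (M * z ^ (1-δ)) + C * M * (2 ^ (δ-1) * z ^ (1-δ)) := add_le_add h2 h3
        _ = (2 ^ δ + C * 2 ^ (δ-1)) * M * z ^ (1-δ) := by ring
        _ = _ := by rw [hCeq]
  intro z hz hlz
  have hex : ∃ n : ℕ, ∀ x ∈ S, z / 2 ^ n ≤ μ x := by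
    have h1 : ∀ x ∈ S, ∀ᶠ n : ℕ in Filter.atTop, z / 2 ^ n ≤ μ x := by
      intro x hx
      have ht : Filter.Tendsto (fun n : ℕ => z / 2 ^ n) Filter.atTop (nhds 0) :=
        Filter.Tendsto.const_div_atTop (tendsto_pow_atTop_atTop_of_one_lt (by norm_num)) z
      exact (ht.eventually_lt_const (hμ x hx)).mono fun n h => h.le
    exact ((Finset.eventually_all S).2 h1).exists
  obtain ⟨n, hn⟩ := hex
  have h := key n z hz
  rwa [Finset.filter_true_of_mem fun x hx => ⟨hn x hx, hlz x hx⟩] at h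

theorem up_bound (δ : ℝ) (hδ1 : 1 < δ) : ∃ C : ℝ, 0 ≤ C ∧
    ∀ (S : Finset BCF) (w μ : BCF → ℝ), (∀ x ∈ S, 0 ≤ w x) →
    ∀ M : ℝ, 0 ≤ M → ∀ z0 : ℝ, 0 < z0 →
    (∀ y : ℝ, z0 ≤ y → ∑ x ∈ S.filter (fun x => μ x ≤ y), w x ≤ M * y) →
    (∀ x ∈ S, z0 < μ x) →
    ∑ x ∈ S, w x * μ x ^ (-δ) ≤ C * M * z0 ^ (1 - δ) := by
  have hlt : (2:ℝ) ^ (1 - δ) < 1 := Real.rpow_lt_one_of_one_lt_of_neg (by norm_num) (by linarith)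
  obtain ⟨C, hC⟩ : ∃ C : ℝ, C = 2 / (1 - 2 ^ (1 - δ)) := ⟨_, rfl⟩
  have hC0 : 0 ≤ C := by
    rw [hC]; exact div_nonneg (by positivity) (by linarith)
  have hCeq : 2 + C * 2 ^ (1 - δ) = C := by
    have : C * (1 - 2 ^ (1 - δ)) = 2 := by
      rw [hC]; exact div_mul_cancel₀ _ (by linarith)
    linarith
  refine ⟨C, hC0, ?_⟩
  intro S w μ hw M hM z0 hz0 hcum hlow
  have key : ∀ n : ℕ, ∀ z : ℝ, z0 ≤ z →
      ∑ x ∈ S.filter (fun x => z < μ x ∧ μ x ≤ z * 2 ^ n), w x * μ x ^ (-δ)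
        ≤ C * M * z ^ (1 - δ) := by
    intro n
    induction n with
    | zero =>
      intro z hz
      have : S.filter (fun x => z < μ x ∧ μ x ≤ z * 2 ^ 0) = ∅ := by
        refine Finset.filter_eq_empty_iff.2 fun x _ h => ?_
        have := h.1; have := h.2
        simp at *
        linarith
      rw [this, Finset.sum_empty]
      have := Real.rpow_nonneg (hz0.le.trans hz) (1 - δ)
      positivity
    | succ n ih =>
      intro z hz'
      have hz : 0 < z := lt_of_lt_of_le hz0 hz'
      have h1 := sum_filter_split S (fun x => w x * μ x ^ (-δ))
        (fun x hx => mul_nonneg (hw x hx) (Real.rpow_nonneg (hz0.trans (hlow x hx)).le _))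
        (fun x => z < μ x ∧ μ x ≤ z * 2 ^ (n+1))
        (fun x => z < μ x ∧ μ x ≤ 2 * z) (fun x => 2 * z < μ x ∧ μ x ≤ 2 * z * 2 ^ n)
        (fun x _ h => by
          rcases le_or_gt (μ x) (2 * z) with h' | h'
          · exact Or.inl ⟨h.1, h'⟩
          · refine Or.inr ⟨h', ?_⟩
            have e : 2 * z * 2 ^ n = z * 2 ^ (n+1) := by rw [pow_succ]; ring
            rw [e]; exact h.2)
      have h2 := piece_bound S w μ hw δ (by linarith) z (2*z) (M * (2*z)) hz
        (hcum (2*z) (by linarith))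
        (fun x => z < μ x ∧ μ x ≤ 2 * z) (fun x _ h => ⟨h.1.le, h.2⟩)
      have h3 := ih (2*z) (by linarith)
      have e1 : z ^ (-δ) * (M * (2*z)) = 2 * (M * z ^ (1-δ)) := by
        rw [Real.rpow_sub hz, Real.rpow_neg hz.le, Real.rpow_one]
        field_simp
      have e2 : (2*z) ^ (1-δ) = 2 ^ (1-δ) * z ^ (1-δ) := Real.mul_rpow (by norm_num) hz.le
      rw [e1] at h2
      rw [e2] at h3
      calc _ ≤ _ := h1
        _ ≤ 2 * (M * z ^ (1-δ)) + C * M * (2 ^ (1-δ) * z ^ (1-δ)) := add_le_add h2 h3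
        _ = (2 + C * 2 ^ (1-δ)) * M * z ^ (1-δ) := by ring
        _ = _ := by rw [hCeq]
  have hex : ∃ n : ℕ, ∀ x ∈ S, μ x ≤ z0 * 2 ^ n := by
    have h1 : ∀ x ∈ S, ∀ᶠ n : ℕ in Filter.atTop, μ x ≤ z0 * 2 ^ n := by
      intro x hx
      have ht : Filter.Tendsto (fun n : ℕ => z0 * 2 ^ n) Filter.atTop Filter.atTop :=
        Filter.Tendsto.const_mul_atTop hz0 (tendsto_pow_atTop_atTop_of_one_lt (by norm_num))
      exact ht.eventually_ge_atTop _
    exact ((Finset.eventually_all S).2 h1).exists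
  obtain ⟨n, hn⟩ := hex
  have h := key n z0 le_rfl
  rwa [Finset.filter_true_of_mem fun x hx => ⟨hlow x hx, hn x hx⟩] at h

theorem w_nonneg (q : ℕ) (x : BCF) : 0 ≤ ‖PhiHat' q x‖ / (stabCard x : ℝ) := by positivity

theorem w_le (q : ℕ) (x : BCF) : ‖PhiHat' q x‖ / (stabCard x : ℝ) ≤ ‖PhiHat' q x‖ := by
  rcases Nat.eq_zero_or_pos (stabCard x) with h | h
  · rw [h]; simp
  · exact div_le_self (norm_nonneg _) (by exact_mod_cast h)

theorem cum_bound {q : ℕ} (hq : Squarefree q) {M0 : ℝ}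
    (hM : K1 * 2560 ^ q.primeFactors.card ≤ M0) (S : Finset BCF)
    (hS : ∀ x ∈ S, inDual x ∧ disc x ≠ 0) (hinj : ∀ x ∈ S, ∀ y ∈ S, x ≠ y → ¬ SLeq x y)
    {y : ℝ} (hy : 0 ≤ y) :
    ∑ x ∈ S.filter (fun x => |(disc x : ℝ)| / (q:ℝ) ^ 8 ≤ y),
        ‖PhiHat' q x‖ / (stabCard x : ℝ) ≤ M0 * (q:ℝ)^2 * y ∧
    ∑ x ∈ S.filter (fun x => |(disc x : ℝ)| / (q:ℝ) ^ 8 ≤ y),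
        ‖PhiHat' q x‖ / (stabCard x : ℝ) ≤ M0 * ((q:ℝ) * y + 1 / q) := by
  have hq0 : (0:ℝ) < q := by exact_mod_cast Nat.pos_of_ne_zero hq.ne_zero
  have h := sum_bound hq (X := y * (q:ℝ)^8) (by positivity)
    (S.filter (fun x => |(disc x : ℝ)| / (q:ℝ) ^ 8 ≤ y))
    (fun x hx => by
      rw [Finset.mem_filter] at hx
      exact ⟨(hS x hx.1).1, (hS x hx.1).2, (div_le_iff₀ (by positivity)).1 hx.2⟩)
    (fun x hx y hy hxy => by
      by_contra hne
      exact hinj x (Finset.mem_filter.1 hx).1 y (Finset.mem_filter.1 hy).1 hne hxy)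
  have h0 : ∑ x ∈ S.filter (fun x => |(disc x : ℝ)| / (q:ℝ) ^ 8 ≤ y),
        ‖PhiHat' q x‖ / (stabCard x : ℝ) ≤
      ∑ x ∈ S.filter (fun x => |(disc x : ℝ)| / (q:ℝ) ^ 8 ≤ y), ‖PhiHat' q x‖ :=
    Finset.sum_le_sum fun x _ => w_le q x
  have e1 : y * (q:ℝ)^8 / (q:ℝ)^6 = (q:ℝ)^2 * y := by field_simp
  have e2 : y * (q:ℝ)^8 / (q:ℝ)^7 = (q:ℝ) * y := by field_simp
  rw [e1, e2] at h
  constructor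
  · rw [mul_assoc]
    exact h0.trans (h.1.trans (mul_le_mul_of_nonneg_right hM (by positivity)))
  · exact h0.trans (h.2.trans (mul_le_mul_of_nonneg_right hM (by positivity)))

theorem cum_bound_big {q : ℕ} (hq : Squarefree q) {M0 : ℝ} (hM0 : 0 ≤ M0)
    (hM : K1 * 2560 ^ q.primeFactors.card ≤ M0) (S : Finset BCF)
    (hS : ∀ x ∈ S, inDual x ∧ disc x ≠ 0) (hinj : ∀ x ∈ S, ∀ y ∈ S, x ≠ y → ¬ SLeq x y)
    {y : ℝ} (hy : ((q:ℝ)^2)⁻¹ ≤ y) :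
    ∑ x ∈ S.filter (fun x => |(disc x : ℝ)| / (q:ℝ) ^ 8 ≤ y),
        ‖PhiHat' q x‖ / (stabCard x : ℝ) ≤ 2 * M0 * q * y := by
  have hq0 : (0:ℝ) < q := by exact_mod_cast Nat.pos_of_ne_zero hq.ne_zero
  have hy0 : 0 ≤ y := le_trans (by positivity) hy
  refine (cum_bound hq hM S hS hinj hy0).2.trans ?_
  have h1 : 1 / (q:ℝ) ≤ q * y := by
    have : (q:ℝ) * ((q:ℝ)^2)⁻¹ ≤ q * y := mul_le_mul_of_nonneg_left hy hq0.le
    have e : (q:ℝ) * ((q:ℝ)^2)⁻¹ = 1 / q := by field_simp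
    linarith
  calc M0 * ((q:ℝ) * y + 1 / q) ≤ M0 * (q * y + q * y) := by gcongr
    _ = _ := by ring

theorem main_torsion :
    (∀ δ ε : ℝ, 0 < δ → δ < 1 → 0 < ε → ∃ C : ℝ,
      ∀ q : ℕ, Squarefree q →
      ∀ S : Finset BCF, (∀ x ∈ S, inDual x ∧ disc x ≠ 0) →
        (∀ x ∈ S, ∀ y ∈ S, x ≠ y → ¬ SLeq x y) →
        (∀ z : ℝ, 0 < z → z ≤ ((q : ℝ) ^ 3)⁻¹ →
          (∀ x ∈ S, (|disc x| : ℝ) / (q : ℝ) ^ 8 < z) →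
          ∑ x ∈ S, ‖PhiHat' q x‖ / (stabCard x : ℝ) * ((|disc x| : ℝ) / (q : ℝ) ^ 8) ^ (-δ)
            ≤ C * (q : ℝ) ^ ((2:ℝ) + ε) * z ^ (1 - δ)) ∧
        ((∀ x ∈ S, ((q : ℝ) ^ 3)⁻¹ < (|disc x| : ℝ) / (q : ℝ) ^ 8 ∧
            (|disc x| : ℝ) / (q : ℝ) ^ 8 < ((q : ℝ) ^ 2)⁻¹) →
          ∑ x ∈ S, ‖PhiHat' q x‖ / (stabCard x : ℝ) * ((|disc x| : ℝ) / (q : ℝ) ^ 8) ^ (-δ)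
            ≤ C * (q : ℝ) ^ (3 * δ - 1 + ε)) ∧
        (∀ z : ℝ, ((q : ℝ) ^ 2)⁻¹ < z →
          (∀ x ∈ S, ((q : ℝ) ^ 2)⁻¹ < (|disc x| : ℝ) / (q : ℝ) ^ 8 ∧
            (|disc x| : ℝ) / (q : ℝ) ^ 8 < z) →
          ∑ x ∈ S, ‖PhiHat' q x‖ / (stabCard x : ℝ) * ((|disc x| : ℝ) / (q : ℝ) ^ 8) ^ (-δ)
            ≤ C * (q : ℝ) ^ ((1:ℝ) + ε) * z ^ (1 - δ))) ∧
    (∀ δ ε : ℝ, 1 < δ → 0 < ε → ∃ C : ℝ,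
      ∀ q : ℕ, Squarefree q → ∀ z : ℝ, ((q : ℝ) ^ 2)⁻¹ < z →
      ∀ S : Finset BCF,
        (∀ x ∈ S, inDual x ∧ z < (|disc x| : ℝ) / (q : ℝ) ^ 8) →
        (∀ x ∈ S, ∀ y ∈ S, x ≠ y → ¬ SLeq x y) →
        ∑ x ∈ S, ‖PhiHat' q x‖ / (stabCard x : ℝ) * ((|disc x| : ℝ) / (q : ℝ) ^ 8) ^ (-δ)
          ≤ C * (q : ℝ) ^ ((1:ℝ) + ε) * z ^ (1 - δ)) := by
  constructor
  · intro δ ε hδ hδ1 hε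
    obtain ⟨Cd, hCd, hdown⟩ := down_bound δ hδ hδ1
    obtain ⟨Ce, hCe, hom⟩ := omega_bound 2560 ε (by norm_num) hε
    have hK := K1_nonneg
    obtain ⟨B, hB⟩ : ∃ B : ℝ, B = K1 * Ce := ⟨_, rfl⟩
    have hB0 : 0 ≤ B := by rw [hB]; positivity
    refine ⟨2 * Cd * B + 2 * B, ?_⟩
    intro q hq S hS hinj
    have hq0 : (0:ℝ) < q := by exact_mod_cast Nat.pos_of_ne_zero hq.ne_zero
    have hqe : (0:ℝ) < (q:ℝ) ^ ε := Real.rpow_pos_of_pos hq0 _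
    have hM : K1 * 2560 ^ q.primeFactors.card ≤ B * (q:ℝ) ^ ε := by
      rw [hB, mul_assoc]
      exact mul_le_mul_of_nonneg_left (hom q hq) hK
    have hM0 : 0 ≤ B * (q:ℝ) ^ ε := by positivity
    have hμ : ∀ x ∈ S, 0 < |(disc x : ℝ)| / (q:ℝ) ^ 8 := by
      intro x hx
      have : (disc x : ℝ) ≠ 0 := by exact_mod_cast (hS x hx).2
      positivity
    refine ⟨?_, ?_, ?_⟩
    · intro z hz _ hlz
      have h := hdown S (fun x => ‖PhiHat' q x‖ / (stabCard x : ℝ))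
        (fun x => |(disc x : ℝ)| / (q:ℝ) ^ 8) (fun x _ => w_nonneg q x) hμ
        (B * (q:ℝ)^ε * (q:ℝ)^2) (by positivity)
        (fun y hy => (cum_bound hq hM S hS hinj hy.le).1) z hz hlz
      refine h.trans ?_
      have hz' := Real.rpow_nonneg hz.le (1 - δ)
      rw [Real.rpow_add hq0, show (q:ℝ) ^ (2:ℝ) = (q:ℝ)^2 from Real.rpow_ofNat _ 2]
      have : 0 ≤ (q:ℝ)^2 * (q:ℝ)^ε * z ^ (1-δ) * (Cd * B + 2 * B) := by positivity
      nlinarith [this]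
    · intro hmid
      have hc := (cum_bound hq hM S hS hinj (y := ((q:ℝ)^2)⁻¹) (by positivity)).2
      have h := piece_bound S (fun x => ‖PhiHat' q x‖ / (stabCard x : ℝ))
        (fun x => |(disc x : ℝ)| / (q:ℝ) ^ 8) (fun x _ => w_nonneg q x) δ hδ
        (((q:ℝ)^3)⁻¹) _ _ (by positivity) hc (fun _ => True)
        (fun x hx _ => ⟨(hmid x hx).1.le, (hmid x hx).2.le⟩)
      rw [Finset.filter_true_of_mem (s := S) (p := fun _ => True) fun x _ => trivial] at h
      refine h.trans ?_
      have e1 : (((q:ℝ)^3)⁻¹) ^ (-δ) = (q:ℝ) ^ (3 * δ) := by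
        rw [Real.rpow_neg (by positivity), Real.inv_rpow (by positivity), inv_inv,
          ← Real.rpow_natCast, ← Real.rpow_mul hq0.le]
        norm_num
      have e2 : (q:ℝ) * ((q:ℝ)^2)⁻¹ + 1 / q = 2 * (q:ℝ)⁻¹ := by
        field_simp; norm_num
      have e3 : (q:ℝ) ^ (3 * δ - 1 + ε) = (q:ℝ) ^ (3*δ) * (q:ℝ)⁻¹ * (q:ℝ)^ε := by
        rw [Real.rpow_add hq0, Real.rpow_sub hq0, Real.rpow_one]; rfl
      rw [e1, e2, e3]
      have : 0 ≤ (q:ℝ) ^ (3*δ) * (q:ℝ)⁻¹ * (q:ℝ)^ε * (2 * Cd * B) := by positivity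
      nlinarith [this]
    · intro z hz hlz
      have hz0 : 0 < z := lt_trans (by positivity) hz
      have h := hdown S (fun x => ‖PhiHat' q x‖ / (stabCard x : ℝ))
        (fun x => |(disc x : ℝ)| / (q:ℝ) ^ 8) (fun x _ => w_nonneg q x) hμ
        (2 * (B * (q:ℝ)^ε) * q) (by positivity)
        (fun y hy => by
          rcases le_or_gt (((q:ℝ)^2)⁻¹) y with h' | h'
          · exact cum_bound_big hq hM0 hM S hS hinj h'
          · rw [Finset.filter_false_of_mem fun x hx hxy => by
              have := (hlz x hx).1
              linarith]
            rw [Finset.sum_empty]; positivity) z hz0 (fun x hx => (hlz x hx).2)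
      refine h.trans ?_
      have hz' := Real.rpow_nonneg hz0.le (1 - δ)
      rw [Real.rpow_add hq0, Real.rpow_one]
      have : 0 ≤ (q:ℝ) * (q:ℝ)^ε * z ^ (1-δ) * (2 * B) := by positivity
      nlinarith [this]
  · intro δ ε hδ1 hε
    obtain ⟨Cd, hCd, hup⟩ := up_bound δ hδ1
    obtain ⟨Ce, hCe, hom⟩ := omega_bound 2560 ε (by norm_num) hε
    have hK := K1_nonneg
    obtain ⟨B, hB⟩ : ∃ B : ℝ, B = K1 * Ce := ⟨_, rfl⟩
    have hB0 : 0 ≤ B := by rw [hB]; positivity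
    refine ⟨2 * Cd * B, ?_⟩
    intro q hq z hz S hS hinj
    have hq0 : (0:ℝ) < q := by exact_mod_cast Nat.pos_of_ne_zero hq.ne_zero
    have hqe : (0:ℝ) < (q:ℝ) ^ ε := Real.rpow_pos_of_pos hq0 _
    have hz0 : 0 < z := lt_trans (by positivity) hz
    have hM : K1 * 2560 ^ q.primeFactors.card ≤ B * (q:ℝ) ^ ε := by
      rw [hB, mul_assoc]
      exact mul_le_mul_of_nonneg_left (hom q hq) hK
    have hM0 : 0 ≤ B * (q:ℝ) ^ ε := by positivity
    have hS' : ∀ x ∈ S, inDual x ∧ disc x ≠ 0 := by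
      intro x hx
      refine ⟨(hS x hx).1, fun h0 => ?_⟩
      have := (hS x hx).2
      rw [h0] at this
      simp at this
      linarith
    have h := hup S (fun x => ‖PhiHat' q x‖ / (stabCard x : ℝ))
      (fun x => |(disc x : ℝ)| / (q:ℝ) ^ 8) (fun x _ => w_nonneg q x)
      (2 * (B * (q:ℝ)^ε) * q) (by positivity) z hz0
      (fun y hy => cum_bound_big hq hM0 hM S hS' hinj (hz.le.trans hy))
      (fun x hx => (hS x hx).2)
    refine h.trans (le_of_eq ?_)
    rw [Real.rpow_add hq0, Real.rpow_one]
    ring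

end BCF

open BCF in
/-- Proposition 3.6: weighted partial-sum bounds for the dual coefficients in the
3-torsion problem, where `μ(x) = |Disc(x)|/q⁸`. -/
theorem dual_weighted_bounds_torsion :
    (∀ δ ε : ℝ, 0 < δ → δ < 1 → 0 < ε → ∃ C : ℝ,
      ∀ q : ℕ, Squarefree q →
      ∀ S : Finset BCF, (∀ x ∈ S, inDual x ∧ disc x ≠ 0) →
        (∀ x ∈ S, ∀ y ∈ S, x ≠ y → ¬ SLeq x y) →
        -- (i) head up to z ≤ q⁻³
        (∀ z : ℝ, 0 < z → z ≤ ((q : ℝ) ^ 3)⁻¹ →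
          (∀ x ∈ S, (|disc x| : ℝ) / (q : ℝ) ^ 8 < z) →
          ∑ x ∈ S, ‖PhiHat' q x‖ / (stabCard x : ℝ) * ((|disc x| : ℝ) / (q : ℝ) ^ 8) ^ (-δ)
            ≤ C * (q : ℝ) ^ ((2:ℝ) + ε) * z ^ (1 - δ)) ∧
        -- (ii) the middle range q⁻³ < μ < q⁻²
        ((∀ x ∈ S, ((q : ℝ) ^ 3)⁻¹ < (|disc x| : ℝ) / (q : ℝ) ^ 8 ∧
            (|disc x| : ℝ) / (q : ℝ) ^ 8 < ((q : ℝ) ^ 2)⁻¹) →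
          ∑ x ∈ S, ‖PhiHat' q x‖ / (stabCard x : ℝ) * ((|disc x| : ℝ) / (q : ℝ) ^ 8) ^ (-δ)
            ≤ C * (q : ℝ) ^ (3 * δ - 1 + ε)) ∧
        -- (iii) the range q⁻² < μ < z
        (∀ z : ℝ, ((q : ℝ) ^ 2)⁻¹ < z →
          (∀ x ∈ S, ((q : ℝ) ^ 2)⁻¹ < (|disc x| : ℝ) / (q : ℝ) ^ 8 ∧
            (|disc x| : ℝ) / (q : ℝ) ^ 8 < z) →
          ∑ x ∈ S, ‖PhiHat' q x‖ / (stabCard x : ℝ) * ((|disc x| : ℝ) / (q : ℝ) ^ 8) ^ (-δ)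
            ≤ C * (q : ℝ) ^ ((1:ℝ) + ε) * z ^ (1 - δ))) ∧
    -- tail bound for δ > 1
    (∀ δ ε : ℝ, 1 < δ → 0 < ε → ∃ C : ℝ,
      ∀ q : ℕ, Squarefree q → ∀ z : ℝ, ((q : ℝ) ^ 2)⁻¹ < z →
      ∀ S : Finset BCF,
        (∀ x ∈ S, inDual x ∧ z < (|disc x| : ℝ) / (q : ℝ) ^ 8) →
        (∀ x ∈ S, ∀ y ∈ S, x ≠ y → ¬ SLeq x y) →
        ∑ x ∈ S, ‖PhiHat' q x‖ / (stabCard x : ℝ) * ((|disc x| : ℝ) / (q : ℝ) ^ 8) ^ (-δ)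
          ≤ C * (q : ℝ) ^ ((1:ℝ) + ε) * z ^ (1 - δ)) := by
  exact BCF.main_torsion
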